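/- (Kato–Ponce commutator estimate) Let $s > 0$ and $p \in (1,\infty)$. For all Schwartz functions $f, g$ on $\mathbb{R}^d$, $\|J^s(fg) - f J^s g\|_{L^p} \leq C\left(\|\nabla f\|_{L^{\infty}} \|J^{s-1} g\|_{L^p} + \|J^s f\|_{L^p} \|g\|_{L^{\infty}}\right)$. -/

import Mathlib

open MeasureTheory FourierTransform ENNReal

noncomputable section

/-- The Bessel potential `J^s = (I-Δ)^{s/2}`, the Fourier multiplier with symbol
`(1 + 4π²|ξ|²)^{s/2}`. -/
def besselPotential (d : ℕ) (s : ℝ) (f : EuclideanSpace ℝ (Fin d) → ℂ) :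
    EuclideanSpace ℝ (Fin d) → ℂ :=
  𝓕⁻ (fun ξ => (((1 + 4 * Real.pi ^ 2 * ‖ξ‖ ^ 2) ^ (s / 2) : ℝ) : ℂ) * 𝓕 f ξ)

namespace KatoPonce

open Set Filter Topology

/-- Index of the dyadic cube of side `2^{-k}` containing `x`. -/
def cell (d : ℕ) (k : ℤ) (x : EuclideanSpace ℝ (Fin d)) : Fin d → ℤ :=
  fun i => ⌊(2 : ℝ) ^ k * x i⌋

/-- The dyadic cube with a given index. -/
def dcube (d : ℕ) (q : ℤ × (Fin d → ℤ)) : Set (EuclideanSpace ℝ (Fin d)) :=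
  {x | cell d q.1 x = q.2}

lemma cell_eq_of_succ {d : ℕ} {k : ℤ} {x y : EuclideanSpace ℝ (Fin d)}
    (h : cell d (k + 1) x = cell d (k + 1) y) : cell d k x = cell d k y := by
  funext i
  have hi := congrFun h i
  simp only [cell] at hi ⊢
  have key : ∀ z : ℝ, ⌊(2 : ℝ) ^ k * z⌋ = ⌊(2 : ℝ) ^ (k + 1) * z⌋ / 2 := by
    intro z
    have : (2 : ℝ) ^ k * z = ((2 : ℝ) ^ (k + 1) * z) / (2 : ℕ) := by
      rw [zpow_add₀ (by norm_num)]; push_cast; ring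
    rw [this, Int.floor_div_natCast]; rfl
  rw [key, key, hi]

lemma cell_eq_of_le {d : ℕ} {j k : ℤ} (hjk : j ≤ k) {x y : EuclideanSpace ℝ (Fin d)}
    (h : cell d k x = cell d k y) : cell d j x = cell d j y := by
  revert h
  induction k, hjk using Int.leInduction with
  | base => exact id
  | succ n _ ih => exact fun h => ih (cell_eq_of_succ h)

lemma dcube_eq_preimage (d : ℕ) (q : ℤ × (Fin d → ℤ)) :
    dcube d q = (MeasurableEquiv.toLp 2 (Fin d → ℝ)).symm ⁻¹' (Set.univ.pi fun i =>
      Set.Ico ((2 : ℝ) ^ (-q.1) * q.2 i) ((2 : ℝ) ^ (-q.1) * (q.2 i + 1))) := by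
  ext x
  simp only [dcube, cell, mem_ofPred_eq, funext_iff, Set.mem_preimage, Set.mem_univ_pi, Set.mem_Ico,
    Int.floor_eq_iff]
  refine forall_congr' fun i => ?_
  have h2 : (0 : ℝ) < 2 ^ q.1 := by positivity
  simp only [zpow_neg, inv_mul_le_iff₀ h2, lt_inv_mul_iff₀ h2]
  rfl

lemma measurableSet_dcube (d : ℕ) (q : ℤ × (Fin d → ℤ)) : MeasurableSet (dcube d q) := by
  rw [dcube_eq_preimage]
  exact (MeasurableEquiv.measurable _)
    (MeasurableSet.univ_pi fun i => measurableSet_Ico)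

lemma volume_dcube (d : ℕ) (q : ℤ × (Fin d → ℤ)) :
    volume (dcube d q) = ENNReal.ofReal (2 ^ (-q.1)) ^ d := by
  rw [dcube_eq_preimage, (EuclideanSpace.volume_preserving_symm_measurableEquiv_toLp (Fin d)).measure_preimage
    (MeasurableSet.univ_pi fun i => measurableSet_Ico).nullMeasurableSet, volume_pi_pi]
  have : ∀ i : Fin d, volume (Set.Ico ((2 : ℝ) ^ (-q.1) * q.2 i) ((2 : ℝ) ^ (-q.1) * (q.2 i + 1)))
      = ENNReal.ofReal (2 ^ (-q.1)) := by
    intro i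
    rw [Real.volume_Ico]; congr 1; ring
  rw [Finset.prod_congr rfl fun i _ => this i]
  simp

lemma dist_le_of_mem_dcube {d : ℕ} {q : ℤ × (Fin d → ℤ)} {x y : EuclideanSpace ℝ (Fin d)}
    (hx : x ∈ dcube d q) (hy : y ∈ dcube d q) : dist x y ≤ √d * 2 ^ (-q.1) := by
  have key : ∀ i, |x i - y i| ≤ 2 ^ (-q.1) := by
    intro i
    rw [dcube_eq_preimage] at hx hy
    have hxi := hx i (mem_univ i)
    have hyi := hy i (mem_univ i)
    have e : ∀ z : EuclideanSpace ℝ (Fin d),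
      (MeasurableEquiv.toLp 2 (Fin d → ℝ)).symm z i = z i := fun z => rfl
    rw [e, mem_Ico] at hxi hyi
    rw [abs_le]; constructor <;> linarith [hxi.1, hxi.2, hyi.1, hyi.2]
  have h2 : (0 : ℝ) ≤ 2 ^ (-q.1) := by positivity
  rw [EuclideanSpace.dist_eq, ← Real.sqrt_sq h2, ← Real.sqrt_mul (by positivity)]
  apply Real.sqrt_le_sqrt
  calc ∑ i, dist (x i) (y i) ^ 2 ≤ ∑ i : Fin d, ((2 : ℝ) ^ (-q.1)) ^ 2 := by
        apply Finset.sum_le_sum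
        intro i _
        rw [Real.dist_eq]
        exact pow_le_pow_left₀ (abs_nonneg _) (key i) 2
    _ = _ := by simp

lemma volume_dcube_pos (d : ℕ) (q : ℤ × (Fin d → ℤ)) : 0 < volume (dcube d q) := by
  rw [volume_dcube]
  exact ENNReal.pow_pos (by simp; positivity) _

lemma volume_dcube_ne_top (d : ℕ) (q : ℤ × (Fin d → ℤ)) : volume (dcube d q) ≠ ∞ := by
  rw [volume_dcube]
  exact ENNReal.pow_ne_top ofReal_ne_top

/-- Calderón–Zygmund stopping cubes. -/
lemma exists_stopping_cubes {d : ℕ} (hd : 0 < d) (φ : EuclideanSpace ℝ (Fin d) → ℝ≥0∞)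
    (hφ : ∫⁻ x, φ x ≠ ∞) (t : ℝ≥0∞) (ht : t ≠ 0) :
    ∃ I : Set (ℤ × (Fin d → ℤ)), I.PairwiseDisjoint (dcube d) ∧
      (∀ q ∈ I, t * volume (dcube d q) ≤ ∫⁻ x in dcube d q, φ x) ∧
      (∀ q ∈ I, ∫⁻ x in dcube d q, φ x ≤ 2 ^ d * t * volume (dcube d q)) ∧
      (∀ x, x ∉ ⋃ q ∈ I, dcube d q → ∀ k,
        ∫⁻ y in dcube d (k, cell d k x), φ y ≤ t * volume (dcube d (k, cell d k x))) ∧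
      ∀ q ∈ I, (dcube d q).Nonempty := by
  set bad : ℤ → EuclideanSpace ℝ (Fin d) → Prop := fun k x =>
    t * volume (dcube d (k, cell d k x)) < ∫⁻ y in dcube d (k, cell d k x), φ y with hbad
  have hbd : ∀ x, ∃ b : ℤ, ∀ k, bad k x → b ≤ k := by
    intro x
    by_contra! hcon
    apply hφ
    rw [eq_top_iff]
    have hlim : Tendsto (fun n : ℕ => t * ENNReal.ofReal ((2 : ℝ) ^ n)) atTop (𝓝 (t * ∞)) := by
      refine ENNReal.Tendsto.const_mul ?_ (Or.inl top_ne_zero)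
      exact ENNReal.tendsto_ofReal_nhds_top.2
        (tendsto_pow_atTop_atTop_of_one_lt (by norm_num : (1:ℝ) < 2))
    rw [ENNReal.mul_top ht] at hlim
    refine le_of_tendsto' hlim fun n => ?_
    obtain ⟨k, hk, hkn⟩ := hcon (-(n : ℤ))
    refine le_trans ?_ (hk.le.trans (setLIntegral_le_lintegral _ _))
    rw [volume_dcube]
    gcongr
    calc ENNReal.ofReal (2 ^ n) ≤ ENNReal.ofReal (2 ^ (-k)) := by
          apply ENNReal.ofReal_le_ofReal
          rw [← zpow_natCast]
          exact zpow_le_zpow_right₀ (by norm_num) (by omega)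
      _ ≤ _ := by
          apply le_self_pow₀ _ hd.ne'
          rw [← ENNReal.ofReal_one]
          apply ENNReal.ofReal_le_ofReal
          apply one_le_zpow₀ (by norm_num) (by omega)
  have hcell : ∀ {j k : ℤ} {x y : EuclideanSpace ℝ (Fin d)}, j ≤ k → cell d k x = cell d k y →
      (bad j x ↔ bad j y) := by
    intro j k x y hjk h
    simp only [hbad, cell_eq_of_le hjk h]
  refine ⟨{q | ∃ x, q = (q.1, cell d q.1 x) ∧ bad q.1 x ∧ ∀ j < q.1, ¬ bad j x}, ?_, ?_, ?_, ?_, ?_⟩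
  · rintro ⟨k, n⟩ ⟨x, hx, hb, hm⟩ ⟨k', n'⟩ ⟨x', hx', hb', hm'⟩ hne
    rw [Function.onFun, Set.disjoint_left]
    intro z hz hz'
    apply hne
    simp only [Prod.mk.injEq, true_and] at hx hx'
    simp only [dcube, mem_ofPred_eq] at hz hz'
    have e : cell d k z = cell d k x := by rw [hz, hx]
    have e' : cell d k' z = cell d k' x' := by rw [hz', hx']
    have hk : k = k' := by
      apply le_antisymm
      · by_contra! hlt
        exact hm k' hlt (((hcell hlt.le e).1 ((hcell le_rfl e').2 hb')))
      · by_contra! hlt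
        exact hm' k hlt (((hcell hlt.le e').1 ((hcell le_rfl e).2 hb)))
    subst hk
    rw [← hz, ← hz']
  · rintro ⟨k, n⟩ ⟨x, hx, hb, hm⟩
    rw [hx]; exact hb.le
  · rintro ⟨k, n⟩ ⟨x, hx, hb, hm⟩
    rw [hx]
    have h1 := hm (k - 1) (by simp)
    simp only [hbad, not_lt] at h1
    have hsub : dcube d (k, cell d k x) ⊆ dcube d (k - 1, cell d (k - 1) x) := by
      intro y hy
      exact cell_eq_of_le (by simp) hy
    calc _ ≤ _ := lintegral_mono_set hsub
      _ ≤ _ := h1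
      _ = _ := by
        rw [volume_dcube, volume_dcube]
        have : ENNReal.ofReal (2 ^ (-(k - 1))) = 2 * ENNReal.ofReal (2 ^ (-k)) := by
          rw [show -(k - 1) = 1 + -k by ring, zpow_add₀ (by norm_num), ENNReal.ofReal_mul (by norm_num)]
          simp
        rw [this, mul_pow]
        ring
  · intro x hx k
    by_contra! hk
    apply hx
    obtain ⟨b, hb⟩ := hbd x
    obtain ⟨m, hm, hmin⟩ := Int.exists_least_of_bdd ⟨b, fun z hz => hb z hz⟩ ⟨k, hk⟩
    refine mem_biUnion (x := (m, cell d m x)) ⟨x, rfl, hm, fun j hj hbj => ?_⟩ rfl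
    exact absurd (hmin j hbj) (not_le.2 hj)
  · rintro ⟨k, n⟩ ⟨x, hx, hb, hm⟩
    exact ⟨x, by rw [hx]; rfl⟩

lemma tendsto_side_zero (d : ℕ) : Tendsto (fun n : ℕ => √d * (2 : ℝ) ^ (-(n : ℤ))) atTop (𝓝 0) := by
  have : Tendsto (fun n : ℕ => ((1:ℝ)/2) ^ n) atTop (𝓝 0) :=
    tendsto_pow_atTop_nhds_zero_of_lt_one (by norm_num) (by norm_num)
  have := this.const_mul (√(d:ℝ))
  rw [mul_zero] at this
  refine this.congr fun n => ?_
  simp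

/-- A continuous function is bounded by any bound for its dyadic averages. -/
lemma le_of_averages_le {d : ℕ} {φ : EuclideanSpace ℝ (Fin d) → ℝ≥0∞} (hφ : Continuous φ)
    {t : ℝ≥0∞} {x : EuclideanSpace ℝ (Fin d)}
    (h : ∀ k, ∫⁻ y in dcube d (k, cell d k x), φ y ≤ t * volume (dcube d (k, cell d k x))) :
    φ x ≤ t := by
  by_contra! hlt
  obtain ⟨t', ht, ht'⟩ := exists_between hlt
  have hopen : {y | t' < φ y} ∈ 𝓝 x := (isOpen_lt continuous_const hφ).mem_nhds ht'
  obtain ⟨ε, hε, hball⟩ := Metric.mem_nhds_iff.1 hopen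
  obtain ⟨n, hn⟩ := ((tendsto_side_zero d).eventually (gt_mem_nhds hε)).exists
  have hx : x ∈ dcube d ((n : ℤ), cell d n x) := rfl
  have h1 := h n
  have h2 : t' * volume (dcube d ((n : ℤ), cell d n x)) ≤ ∫⁻ y in dcube d ((n : ℤ), cell d n x), φ y := by
    rw [← setLIntegral_const]
    apply setLIntegral_mono' (measurableSet_dcube _ _)
    intro y hy
    have : y ∈ Metric.ball x ε := (dist_le_of_mem_dcube hy hx).trans_lt hn
    exact (hball this).le
  have h3 := h2.trans h1
  rw [ENNReal.mul_le_mul_iff_left (volume_dcube_pos _ _).ne' (volume_dcube_ne_top _ _)] at h3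
  exact absurd h3 (not_le.2 ht)

/-- The integral operator with kernel `K`. -/
def kint {d : ℕ} (K : EuclideanSpace ℝ (Fin d) → EuclideanSpace ℝ (Fin d) → ℂ)
    (f : EuclideanSpace ℝ (Fin d) → ℂ) (x : EuclideanSpace ℝ (Fin d)) : ℂ :=
  ∫ y, K x y * f y

lemma aestronglyMeasurable_kint {d : ℕ}
    {K : EuclideanSpace ℝ (Fin d) → EuclideanSpace ℝ (Fin d) → ℂ}
    (hK : Measurable (Function.uncurry K)) {f : EuclideanSpace ℝ (Fin d) → ℂ}
    (hf : AEStronglyMeasurable f volume) : AEStronglyMeasurable (kint K f) volume := by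
  have : AEStronglyMeasurable
      (fun z : EuclideanSpace ℝ (Fin d) × EuclideanSpace ℝ (Fin d) => K z.1 z.2 * f z.2)
      (volume.prod volume) :=
    hK.aestronglyMeasurable.mul (hf.comp_snd)
  exact this.integral_prod_right'

lemma integrable_kernel_mul {d : ℕ}
    {K : EuclideanSpace ℝ (Fin d) → EuclideanSpace ℝ (Fin d) → ℂ}
    (hK : Measurable (Function.uncurry K)) {M : ℝ} (hM : ∀ x y, ‖K x y‖ ≤ M)
    {f : EuclideanSpace ℝ (Fin d) → ℂ} (hf : Integrable f) (x : EuclideanSpace ℝ (Fin d)) :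
    Integrable (fun y => K x y * f y) :=
  hf.bdd_mul (c := M) (hK.comp measurable_prodMk_left).aestronglyMeasurable
    (ae_of_all _ fun y => hM x y)

/-- Hörmander's cancellation estimate for a mean-zero function on a small set. -/
lemma lintegral_kint_mean_zero_le {d : ℕ}
    {K : EuclideanSpace ℝ (Fin d) → EuclideanSpace ℝ (Fin d) → ℂ}
    (hK : Measurable (Function.uncurry K)) {M : ℝ} (hM : ∀ x y, ‖K x y‖ ≤ M)
    (hH : ∀ (r : ℝ) (y y' : EuclideanSpace ℝ (Fin d)), dist y y' ≤ r →
      ∫⁻ x in (Metric.ball y' (2 * r))ᶜ, ‖K x y - K x y'‖ₑ ≤ 1)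
    {b : EuclideanSpace ℝ (Fin d) → ℂ} (hb : Integrable b) {Q : Set (EuclideanSpace ℝ (Fin d))}
    (hQ : MeasurableSet Q) {c : EuclideanSpace ℝ (Fin d)} {r : ℝ} (hr : ∀ y ∈ Q, dist y c ≤ r)
    (h0 : ∫ y in Q, b y = 0) :
    ∫⁻ x in (Metric.ball c (2 * r))ᶜ, ‖∫ y in Q, K x y * b y‖ₑ ≤ ∫⁻ y in Q, ‖b y‖ₑ := by
  have hdiff : Measurable fun z : EuclideanSpace ℝ (Fin d) × EuclideanSpace ℝ (Fin d) =>
      ‖K z.1 z.2 - K z.1 c‖ₑ :=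
    (hK.sub (hK.comp (measurable_fst.prodMk measurable_const))).enorm
  calc _ ≤ ∫⁻ x in (Metric.ball c (2 * r))ᶜ, ∫⁻ y in Q, ‖K x y - K x c‖ₑ * ‖b y‖ₑ := by
        refine lintegral_mono fun x => ?_
        have e : ∫ y in Q, K x y * b y = ∫ y in Q, (K x y - K x c) * b y := by
          simp_rw [sub_mul]
          rw [integral_sub (integrable_kernel_mul hK hM hb x).integrableOn
            (hb.const_mul _).integrableOn, integral_const_mul, h0, mul_zero, sub_zero]
        dsimp only
        rw [e]
        refine (enorm_integral_le_lintegral_enorm _).trans (le_of_eq ?_)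
        simp_rw [enorm_mul]
    _ = ∫⁻ y in Q, ∫⁻ x in (Metric.ball c (2 * r))ᶜ, ‖K x y - K x c‖ₑ * ‖b y‖ₑ := by
        apply lintegral_lintegral_swap
        exact hdiff.aemeasurable.mul
          (hb.aestronglyMeasurable.restrict.comp_snd (f := b)).enorm
    _ = ∫⁻ y in Q, (∫⁻ x in (Metric.ball c (2 * r))ᶜ, ‖K x y - K x c‖ₑ) * ‖b y‖ₑ := by
        congr 1; funext y
        rw [lintegral_mul_const]
        exact hdiff.comp measurable_prodMk_right
    _ ≤ ∫⁻ y in Q, ‖b y‖ₑ := by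
        apply setLIntegral_mono' hQ
        intro y hy
        exact (mul_le_mul_left (hH r y c (hr y hy)) _).trans (one_mul _).le

lemma measure_norm_gt_le {d : ℕ} {f : EuclideanSpace ℝ (Fin d) → ℂ}
    {S : Set (EuclideanSpace ℝ (Fin d))} (hS : MeasurableSet S)
    (hf : AEStronglyMeasurable f volume) {t : ℝ} (ht : 0 < t) :
    volume ({x | t < ‖f x‖} ∩ S) ≤ (ENNReal.ofReal t)⁻¹ * ∫⁻ x in S, ‖f x‖ₑ := by
  have h := meas_ge_le_lintegral_div (μ := volume.restrict S) hf.restrict.enorm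
    (ε := ENNReal.ofReal t) (by simp [ht]) ofReal_ne_top
  rw [mul_comm, ← div_eq_mul_inv]
  refine le_trans ?_ h
  rw [Measure.restrict_apply' hS]
  refine measure_mono (inter_subset_inter_left _ fun x hx => ?_)
  rw [mem_ofPred_eq, ← ofReal_norm]
  exact ENNReal.ofReal_le_ofReal (le_of_lt hx)

/-- The dimensional constant in the Calderón–Zygmund level set estimate. -/
def czConst (d : ℕ) : ℝ≥0∞ :=
  (4 ^ d + volume (Metric.ball (0 : EuclideanSpace ℝ (Fin d)) (2 * √d)) + 2) * 2

lemma czConst_ne_top (d : ℕ) : czConst d ≠ ∞ := by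
  unfold czConst
  have : volume (Metric.ball (0 : EuclideanSpace ℝ (Fin d)) (2 * √d)) ≠ ∞ :=
    measure_ball_lt_top.ne
  finiteness

/-- Calderón–Zygmund level set estimate. -/
lemma measure_kint_gt_le {d : ℕ} (hd : 0 < d)
    {K : EuclideanSpace ℝ (Fin d) → EuclideanSpace ℝ (Fin d) → ℂ}
    (hK : Measurable (Function.uncurry K)) {M : ℝ} (hM : ∀ x y, ‖K x y‖ ≤ M)
    (hL2 : ∀ f : EuclideanSpace ℝ (Fin d) → ℂ, Integrable f → (∃ N : ℝ, ∀ x, ‖f x‖ ≤ N) →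
      ∫⁻ x, ‖kint K f x‖ₑ ^ 2 ≤ ∫⁻ x, ‖f x‖ₑ ^ 2)
    (hH : ∀ (r : ℝ) (y y' : EuclideanSpace ℝ (Fin d)), dist y y' ≤ r →
      ∫⁻ x in (Metric.ball y' (2 * r))ᶜ, ‖K x y - K x y'‖ₑ ≤ 1)
    {F : EuclideanSpace ℝ (Fin d) → ℂ} (hFc : Continuous F) (hF : Integrable F)
    {t : ℝ} (ht : 0 < t) :
    volume {x | 2 * t < ‖kint K F x‖} ≤
      (ENNReal.ofReal t)⁻¹ ^ 2 * (∫⁻ x in {x | ‖F x‖ ≤ t}, ‖F x‖ₑ ^ 2) +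
      czConst d * (ENNReal.ofReal t)⁻¹ * ∫⁻ x in {x | t < 2 * ‖F x‖}, ‖F x‖ₑ := by
  set τ := ENNReal.ofReal t with hτ
  have hτ0 : τ ≠ 0 := by simp [hτ, ht]
  have hτt : τ ≠ ∞ := ofReal_ne_top
  obtain ⟨I, hdisj, hlow, hup, hout, hne⟩ := exists_stopping_cubes hd (fun x => ‖F x‖ₑ)
    hF.2.ne τ hτ0
  have hI : I.Countable := I.to_countable
  have hmQ : ∀ q ∈ I, MeasurableSet (dcube d q) := fun q _ => measurableSet_dcube d q
  set Ω : Set (EuclideanSpace ℝ (Fin d)) := ⋃ q ∈ I, dcube d q with hΩ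
  have hΩm : MeasurableSet Ω := MeasurableSet.biUnion hI hmQ
  have hlin : ∀ φ : EuclideanSpace ℝ (Fin d) → ℝ≥0∞,
      ∫⁻ x in Ω, φ x = ∑' q : I, ∫⁻ x in dcube d q, φ x := fun φ =>
    lintegral_biUnion hI hmQ hdisj φ
  have hvolΩ' : volume Ω = ∑' q : I, volume (dcube d q) := measure_biUnion hI hdisj hmQ
  set W := ∫⁻ x in Ω, ‖F x‖ₑ with hW
  have hWtop : W ≠ ∞ := ((setLIntegral_le_lintegral _ _).trans_lt hF.2).ne
  have hvolΩ : τ * volume Ω ≤ W := by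
    rw [hvolΩ', hW, hlin, ← ENNReal.tsum_mul_left]
    exact ENNReal.tsum_le_tsum fun q => hlow q q.2
  have hvolΩ2 : volume Ω ≤ τ⁻¹ * W := by
    rw [mul_comm, ← div_eq_mul_inv, ENNReal.le_div_iff_mul_le (Or.inl hτ0) (Or.inl hτt), mul_comm]
    exact hvolΩ
  set S := ∫⁻ x in {x | t < 2 * ‖F x‖}, ‖F x‖ₑ with hS
  have hSm : MeasurableSet {x | t < 2 * ‖F x‖} :=
    (isOpen_lt continuous_const (by fun_prop)).measurableSet
  have hWS : W ≤ 2 * S := by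
    have h1 : W ≤ S + W / 2 := by
      calc W = (∫⁻ x in Ω ∩ {x | t < 2 * ‖F x‖}, ‖F x‖ₑ)
            + ∫⁻ x in Ω \ {x | t < 2 * ‖F x‖}, ‖F x‖ₑ := (lintegral_inter_add_sdiff _ _ hSm).symm
        _ ≤ S + ∫⁻ x in Ω \ {x | t < 2 * ‖F x‖}, τ / 2 := by
          gcongr ?_ + ?_
          · exact lintegral_mono_set inter_subset_right
          · apply setLIntegral_mono' (hΩm.diff hSm)
            rintro x ⟨_, hx⟩
            simp only [mem_ofPred_eq, not_lt] at hx
            rw [← ofReal_norm, hτ, show (2 : ℝ≥0∞) = ENNReal.ofReal 2 by simp,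
              ← ENNReal.ofReal_div_of_pos (by norm_num)]
            apply ENNReal.ofReal_le_ofReal
            linarith
        _ ≤ S + W / 2 := by
          gcongr
          rw [setLIntegral_const, ENNReal.div_eq_inv_mul, mul_assoc, ENNReal.div_eq_inv_mul]
          gcongr
          exact (mul_le_mul_right (measure_mono sdiff_subset) _).trans hvolΩ
    have h2 : W / 2 ≠ ∞ := by finiteness
    have h3 : W / 2 ≤ S := by
      have : W / 2 + W / 2 ≤ S + W / 2 := by rwa [ENNReal.add_halves]
      exact (ENNReal.add_le_add_iff_right h2).1 this
    calc W = 2 * (W / 2) := by rw [ENNReal.mul_div_cancel (by simp) (by simp)]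
      _ ≤ 2 * S := by gcongr
  -- the good part
  set avg : ℤ × (Fin d → ℤ) → ℂ := fun q => ⨍ y in dcube d q, F y with havg
  classical
  let G : EuclideanSpace ℝ (Fin d) → ℂ := fun x =>
    if h : ∃ q ∈ I, x ∈ dcube d q then avg h.choose else F x
  have hG1 : ∀ q ∈ I, ∀ x ∈ dcube d q, G x = avg q := by
    intro q hq x hx
    have h : ∃ q ∈ I, x ∈ dcube d q := ⟨q, hq, hx⟩
    have : h.choose = q := by
      by_contra hne
      exact Set.disjoint_left.1 (hdisj h.choose_spec.1 hq hne) h.choose_spec.2 hx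
    simp only [G, dif_pos h, this]
  have hG2 : ∀ x ∈ Ωᶜ, G x = F x := by
    intro x hx
    have h : ¬ ∃ q ∈ I, x ∈ dcube d q := by
      simpa [hΩ] using hx
    simp only [G, dif_neg h]
  have hGm : AEStronglyMeasurable G volume := by
    have h1 : AEStronglyMeasurable G (volume.restrict Ω) := by
      rw [hΩ, biUnion_eq_iUnion]
      have : Countable I := hI
      rw [aestronglyMeasurable_iUnion_iff]
      intro q
      exact aestronglyMeasurable_const.congr ((ae_restrict_iff' (measurableSet_dcube d q)).2
        (ae_of_all _ fun x hx => (hG1 q q.2 x hx).symm))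
    have h2 : AEStronglyMeasurable G (volume.restrict Ωᶜ) :=
      hFc.aestronglyMeasurable.restrict.congr ((ae_restrict_iff' hΩm.compl).2
        (ae_of_all _ fun x hx => (hG2 x hx).symm))
    have := aestronglyMeasurable_union_iff.2 ⟨h1, h2⟩
    rwa [union_compl_self, Measure.restrict_univ] at this
  have havg1 : ∀ q, volume (dcube d q) * ‖avg q‖ₑ ≤ ∫⁻ x in dcube d q, ‖F x‖ₑ := by
    intro q
    have h := measure_smul_setAverage F (volume_dcube_ne_top d q)
    rw [show volume (dcube d q) * ‖avg q‖ₑ = ‖volume.real (dcube d q) • avg q‖ₑ by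
      rw [enorm_smul, Real.enorm_eq_ofReal measureReal_nonneg,
        ofReal_measureReal (volume_dcube_ne_top d q)], havg, h]
    exact enorm_integral_le_lintegral_enorm _
  have havg2 : ∀ q ∈ I, ‖avg q‖ₑ ≤ 2 ^ d * τ := by
    intro q hq
    have := (havg1 q).trans (hup q hq)
    rwa [mul_comm, ENNReal.mul_le_mul_iff_left (volume_dcube_pos _ _).ne'
      (volume_dcube_ne_top _ _)] at this
  have hFout : ∀ x ∈ Ωᶜ, ‖F x‖ₑ ≤ τ := fun x hx =>
    le_of_averages_le (φ := fun x => ‖F x‖ₑ) (by fun_prop) (hout x hx)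
  have hGint : ∀ q ∈ I, ∫⁻ x in dcube d q, ‖G x‖ₑ ≤ ∫⁻ x in dcube d q, ‖F x‖ₑ := by
    intro q hq
    rw [setLIntegral_congr_fun (measurableSet_dcube d q)
      (fun x hx => by rw [hG1 q hq x hx]), setLIntegral_const, mul_comm]
    exact havg1 q
  have hGΩ : ∫⁻ x in Ω, ‖G x‖ₑ ≤ W := by
    rw [hlin, hW, hlin]
    exact ENNReal.tsum_le_tsum fun q => hGint q q.2
  have hGI : Integrable G := by
    refine ⟨hGm, ?_⟩
    rw [hasFiniteIntegral_iff_enorm, ← lintegral_add_compl _ hΩm]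
    refine ENNReal.add_lt_top.2 ⟨hGΩ.trans_lt hWtop.lt_top, ?_⟩
    rw [setLIntegral_congr_fun hΩm.compl (fun x hx => by rw [hG2 x hx])]
    exact (setLIntegral_le_lintegral _ _).trans_lt hF.2
  have hGb : ∀ x, ‖G x‖ₑ ≤ 2 ^ d * τ := by
    intro x
    by_cases hx : x ∈ Ω
    · obtain ⟨q, hq, hxq⟩ := mem_iUnion₂.1 hx
      rw [hG1 q hq x hxq]; exact havg2 q hq
    · rw [hG2 x hx]
      exact (hFout x hx).trans (le_mul_of_one_le_left (by simp) (one_le_pow₀ (by norm_num)))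
  have hG2int : ∫⁻ x, ‖G x‖ₑ ^ 2 ≤
      (∫⁻ x in {x | ‖F x‖ ≤ t}, ‖F x‖ₑ ^ 2) + (2 ^ d * τ) ^ 2 * volume Ω := by
    rw [← lintegral_add_compl _ hΩm, add_comm]
    gcongr ?_ + ?_
    · rw [setLIntegral_congr_fun hΩm.compl (fun x hx => by rw [hG2 x hx])]
      apply lintegral_mono_set
      intro x hx
      have := hFout x hx
      rw [← ofReal_norm, hτ, ENNReal.ofReal_le_ofReal_iff ht.le] at this
      exact this
    · rw [← setLIntegral_const]
      exact lintegral_mono fun x => pow_le_pow_left₀ (by simp) (hGb x) 2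
  have hTG : volume {x | t < ‖kint K G x‖} ≤ τ⁻¹ ^ 2 * ∫⁻ x, ‖G x‖ₑ ^ 2 := by
    have hb : ∃ N : ℝ, ∀ x, ‖G x‖ ≤ N := by
      refine ⟨2 ^ d * t, fun x => ?_⟩
      have := hGb x
      rwa [← ofReal_norm, hτ, show (2 : ℝ≥0∞) ^ d = ENNReal.ofReal (2 ^ d) by simp,
        ← ENNReal.ofReal_mul (by positivity), ENNReal.ofReal_le_ofReal_iff (by positivity)] at this
    refine le_trans ?_ (mul_le_mul_right (hL2 G hGI hb) _)
    have hm := aestronglyMeasurable_kint hK hGm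
    have h := meas_ge_le_lintegral_div (μ := volume) (f := fun x => ‖kint K G x‖ₑ ^ 2)
      (hm.enorm.pow_const 2) (ε := τ ^ 2) (by simp [hτ0]) (by finiteness)
    rw [← ENNReal.inv_pow, mul_comm, ← div_eq_mul_inv]
    refine le_trans (measure_mono fun x hx => ?_) h
    rw [mem_ofPred_eq, ← ofReal_norm]
    exact pow_le_pow_left₀ (by simp) (ENNReal.ofReal_le_ofReal (le_of_lt hx)) 2
  -- the bad part
  set c : ℤ × (Fin d → ℤ) → EuclideanSpace ℝ (Fin d) := fun q =>
    if h : (dcube d q).Nonempty then h.some else 0 with hc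
  have hcQ : ∀ q ∈ I, c q ∈ dcube d q := by
    intro q hq
    simp only [hc, dif_pos (hne q hq)]
    exact (hne q hq).some_mem
  set R : ℤ × (Fin d → ℤ) → ℝ := fun q => √d * 2 ^ (-q.1) with hR
  set Ωs : Set (EuclideanSpace ℝ (Fin d)) := ⋃ q ∈ I, Metric.ball (c q) (2 * R q) with hΩs
  have hΩsm : MeasurableSet Ωs := MeasurableSet.biUnion hI fun q _ => measurableSet_ball
  have hvolΩs : volume Ωs ≤
      volume (Metric.ball (0 : EuclideanSpace ℝ (Fin d)) (2 * √d)) * volume Ω := by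
    refine (measure_biUnion_le _ hI _).trans ?_
    rw [hvolΩ', ← ENNReal.tsum_mul_left]
    refine ENNReal.tsum_le_tsum fun q => ?_
    rw [hR, show 2 * (√d * (2 : ℝ) ^ (-q.1.1)) = 2 ^ (-q.1.1) * (2 * √d) by ring,
      Measure.addHaar_ball_mul_of_pos _ _ (by positivity), volume_dcube]
    simp only [finrank_euclideanSpace, Fintype.card_fin]
    rw [ENNReal.ofReal_pow (by positivity), mul_comm]
  set b : EuclideanSpace ℝ (Fin d) → ℂ := fun x => F x - G x with hb
  have hbI : Integrable b := hF.sub hGI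
  have hbmean : ∀ q ∈ I, ∫ y in dcube d q, b y = 0 := by
    intro q hq
    rw [hb, integral_sub hF.integrableOn hGI.integrableOn,
      setIntegral_congr_fun (g := fun _ => avg q) (measurableSet_dcube d q)
        (fun x hx => hG1 q hq x hx), setIntegral_const, havg,
      measure_smul_setAverage F (volume_dcube_ne_top d q), sub_self]
  have hbW : ∫⁻ x in Ω, ‖b x‖ₑ ≤ 2 * W := by
    calc _ ≤ ∫⁻ x in Ω, (‖F x‖ₑ + ‖G x‖ₑ) := lintegral_mono fun x => enorm_sub_le
      _ = W + ∫⁻ x in Ω, ‖G x‖ₑ := lintegral_add_left (by fun_prop) _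
      _ ≤ W + W := by gcongr
      _ = _ := (two_mul _).symm
  have hTb : ∫⁻ x in Ωsᶜ, ‖kint K b x‖ₑ ≤ 2 * W := by
    refine le_trans ?_ hbW
    rw [hlin]
    have hpt : ∀ x, ‖kint K b x‖ₑ ≤ ∑' q : I, ‖∫ y in dcube d q, K x y * b y‖ₑ := by
      intro x
      have hinteg := integrable_kernel_mul hK hM hbI x
      have e : kint K b x = ∫ y in Ω, K x y * b y := by
        rw [kint]
        refine (setIntegral_eq_integral_of_forall_compl_eq_zero fun y hy => ?_).symm
        simp [hb, hG2 y hy]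
      have hs : HasSum (fun q : I => ∫ y in dcube d q, K x y * b y) (kint K b x) := by
        rw [e, hΩ, biUnion_eq_iUnion]
        have : Countable I := hI
        exact hasSum_integral_iUnion (fun q => hmQ q q.2)
          (fun q q' hqq => hdisj q.2 q'.2 (fun h => hqq (Subtype.ext h))) hinteg.integrableOn
      rw [← hs.tsum_eq]
      exact enorm_tsum_le_tsum_enorm
    have : Countable I := hI
    calc _ ≤ ∫⁻ x in Ωsᶜ, ∑' q : I, ‖∫ y in dcube d q, K x y * b y‖ₑ := lintegral_mono hpt
      _ = ∑' q : I, ∫⁻ x in Ωsᶜ, ‖∫ y in dcube d q, K x y * b y‖ₑ := by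
        refine lintegral_tsum fun q => ?_
        have := aestronglyMeasurable_kint hK
          (hbI.aestronglyMeasurable.indicator (measurableSet_dcube d q))
        refine (this.restrict.enorm).congr (ae_of_all _ fun x => ?_)
        dsimp only
        rw [kint, ← integral_indicator (measurableSet_dcube d q)]
        congr 2; funext y
        by_cases hy : y ∈ dcube d q <;> simp [hy]
      _ ≤ _ := by
        refine ENNReal.tsum_le_tsum fun q => ?_
        refine le_trans (lintegral_mono_set ?_) (lintegral_kint_mean_zero_le hK hM hH hbI
          (hmQ q q.2) (c := c q) (r := R q)
          (fun y hy => dist_le_of_mem_dcube hy (hcQ q q.2)) (hbmean q q.2))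
        exact compl_subset_compl.2 (subset_biUnion_of_mem (u := fun q => Metric.ball (c q) (2 * R q)) q.2)
  have hsub : {x | 2 * t < ‖kint K F x‖} ⊆
      {x | t < ‖kint K G x‖} ∪ (Ωs ∪ ({x | t < ‖kint K b x‖} ∩ Ωsᶜ)) := by
    intro x hx
    by_contra hcon
    simp only [mem_union, mem_inter_iff, mem_ofPred_eq, mem_compl_iff, not_or, not_and, not_lt,
      not_not] at hcon hx
    obtain ⟨h1, h2, h3⟩ := hcon
    have h3' : ‖kint K b x‖ ≤ t := by
      by_contra! h; exact h2 (h3 h)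
    have e : kint K F x = kint K G x + kint K b x := by
      rw [kint, kint, kint, ← integral_add (integrable_kernel_mul hK hM hGI x)
        (integrable_kernel_mul hK hM hbI x)]
      congr 1; funext y; simp only [hb]; ring
    have := norm_add_le (kint K G x) (kint K b x)
    rw [← e] at this
    linarith
  calc _ ≤ _ := measure_mono hsub
    _ ≤ volume {x | t < ‖kint K G x‖} + (volume Ωs + volume ({x | t < ‖kint K b x‖} ∩ Ωsᶜ)) :=
      (measure_union_le _ _).trans (by gcongr; exact measure_union_le _ _)
    _ ≤ τ⁻¹ ^ 2 * ((∫⁻ x in {x | ‖F x‖ ≤ t}, ‖F x‖ₑ ^ 2) + (2 ^ d * τ) ^ 2 * volume Ω) +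
        (volume (Metric.ball (0 : EuclideanSpace ℝ (Fin d)) (2 * √d)) * volume Ω +
          τ⁻¹ * (2 * W)) := by
      gcongr
      · exact hTG.trans (by gcongr)
      · exact (measure_norm_gt_le hΩsm.compl
          (aestronglyMeasurable_kint hK hbI.aestronglyMeasurable) ht).trans (by gcongr)
    _ = τ⁻¹ ^ 2 * (∫⁻ x in {x | ‖F x‖ ≤ t}, ‖F x‖ₑ ^ 2) + ((4 ^ d +
        volume (Metric.ball (0 : EuclideanSpace ℝ (Fin d)) (2 * √d))) * volume Ω +
          2 * (τ⁻¹ * W)) := by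
      have : τ⁻¹ ^ 2 * (2 ^ d * τ) ^ 2 = 4 ^ d := by
        rw [mul_pow, ← pow_mul, mul_comm d 2, pow_mul, mul_left_comm, ← mul_pow,
          ENNReal.inv_mul_cancel hτ0 hτt]
        norm_num
      rw [mul_add, ← mul_assoc _ _ (volume Ω), this]
      ring
    _ ≤ τ⁻¹ ^ 2 * (∫⁻ x in {x | ‖F x‖ ≤ t}, ‖F x‖ₑ ^ 2) + ((4 ^ d +
        volume (Metric.ball (0 : EuclideanSpace ℝ (Fin d)) (2 * √d))) * (τ⁻¹ * (2 * S)) +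
          2 * (τ⁻¹ * (2 * S))) := by
      gcongr
      exact hvolΩ2.trans (by gcongr)
    _ = _ := by
      rw [czConst]; ring

lemma lintegral_setLIntegral_mul_swap {d : ℕ} {D : Set (ℝ × EuclideanSpace ℝ (Fin d))}
    (hD : MeasurableSet D) {φ : EuclideanSpace ℝ (Fin d) → ℝ≥0∞} (hφ : Measurable φ)
    {w : ℝ → ℝ≥0∞} (hw : Measurable w) :
    ∫⁻ t in Ioi (0 : ℝ), (∫⁻ x in {x | (t, x) ∈ D}, φ x) * w t =
      ∫⁻ x, φ x * ∫⁻ t in Ioi (0 : ℝ) ∩ {t | (t, x) ∈ D}, w t := by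
  have hD1 : ∀ t, MeasurableSet {x | (t, x) ∈ D} := fun t => measurable_prodMk_left hD
  have hD2 : ∀ x, MeasurableSet {t | (t, x) ∈ D} := fun x => measurable_prodMk_right hD
  have hm : Measurable (Function.uncurry fun t x => D.indicator (fun z => φ z.2 * w z.1) (t, x)) :=
    ((hφ.comp measurable_snd).mul (hw.comp measurable_fst)).indicator hD
  calc _ = ∫⁻ t in Ioi (0 : ℝ), ∫⁻ x, D.indicator (fun z => φ z.2 * w z.1) (t, x) := by
        refine lintegral_congr fun t => ?_
        rw [← lintegral_mul_const _ hφ, ← lintegral_indicator (hD1 t)]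
        rfl
    _ = ∫⁻ x, ∫⁻ t in Ioi (0 : ℝ), D.indicator (fun z => φ z.2 * w z.1) (t, x) :=
        lintegral_lintegral_swap hm.aemeasurable
    _ = _ := by
        refine lintegral_congr fun x => ?_
        rw [← lintegral_const_mul _ hw, inter_comm, ← Measure.restrict_restrict (hD2 x),
          ← lintegral_indicator (hD2 x)]
        rfl

lemma lintegral_Ioi_rpow {a r : ℝ} (ha : 0 < a) (hr : r < -1) :
    ∫⁻ t in Ioi a, ENNReal.ofReal (t ^ r) = ENNReal.ofReal (a ^ (r + 1) / (-(r + 1))) := by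
  rw [← ofReal_integral_eq_lintegral_ofReal (integrableOn_Ioi_rpow_of_lt hr ha)
    ((ae_restrict_iff' measurableSet_Ioi).2 (ae_of_all _ fun t ht =>
      Real.rpow_nonneg (ha.trans ht).le _)), integral_Ioi_rpow_of_lt hr ha]
  congr 1; rw [div_neg, neg_div]

lemma lintegral_Ioc_rpow {a r : ℝ} (ha : 0 ≤ a) (hr : -1 < r) :
    ∫⁻ t in Ioc 0 a, ENNReal.ofReal (t ^ r) = ENNReal.ofReal (a ^ (r + 1) / (r + 1)) := by
  have hi : IntervalIntegrable (fun t : ℝ => t ^ r) volume 0 a :=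
    intervalIntegral.intervalIntegrable_rpow' hr
  rw [← ofReal_integral_eq_lintegral_ofReal
    ((intervalIntegrable_iff_integrableOn_Ioc_of_le ha).1 hi)
    ((ae_restrict_iff' measurableSet_Ioc).2 (ae_of_all _ fun t ht =>
      Real.rpow_nonneg ht.1.le _)), ← intervalIntegral.integral_of_le ha, integral_rpow (Or.inl hr),
      Real.zero_rpow (by linarith), sub_zero]

lemma lintegral_low_level_le {d : ℕ} {F : EuclideanSpace ℝ (Fin d) → ℂ} (hF : Continuous F)
    {p : ℝ} (hp2 : p < 2) :
    ∫⁻ t in Ioi (0 : ℝ), (∫⁻ x in {x | ‖F x‖ ≤ t}, ‖F x‖ₑ ^ 2) * ENNReal.ofReal (t ^ (p - 3)) ≤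
      ENNReal.ofReal (2 - p)⁻¹ * ∫⁻ x, ‖F x‖ₑ ^ p := by
  have key := lintegral_setLIntegral_mul_swap (D := {z | ‖F z.2‖ ≤ z.1})
    (isClosed_le (by fun_prop) (by fun_prop)).measurableSet (φ := fun x => ‖F x‖ₑ ^ 2)
    (by fun_prop) (w := fun t => ENNReal.ofReal (t ^ (p - 3))) (by fun_prop)
  simp only [mem_ofPred_eq] at key
  rw [key, ← lintegral_const_mul _ (by fun_prop)]
  refine lintegral_mono fun x => ?_
  by_cases h0 : F x = 0
  · simp [h0]
  have hx : 0 < ‖F x‖ := norm_pos_iff.2 h0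
  have e : ∫⁻ t in Ioi (0 : ℝ) ∩ {t | ‖F x‖ ≤ t}, ENNReal.ofReal (t ^ (p - 3)) =
      ∫⁻ t in Ioi ‖F x‖, ENNReal.ofReal (t ^ (p - 3)) := by
    rw [show Ioi (0 : ℝ) ∩ {t | ‖F x‖ ≤ t} = Ici ‖F x‖ from by
      ext t; simp only [mem_inter_iff, mem_Ioi, mem_ofPred_eq, mem_Ici]
      exact ⟨fun h => h.2, fun h => ⟨hx.trans_le h, h⟩⟩, setLIntegral_congr Ioi_ae_eq_Ici.symm]
  rw [e, lintegral_Ioi_rpow hx (by linarith), ← ofReal_norm, ENNReal.ofReal_rpow_of_pos hx,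
    ← ENNReal.ofReal_pow hx.le, ← ENNReal.ofReal_mul (by positivity),
    ← ENNReal.ofReal_mul (by simp; linarith)]
  apply ENNReal.ofReal_le_ofReal
  rw [show p - 3 + 1 = p - 2 by ring, show -(p - 2) = 2 - p by ring, ← Real.rpow_natCast,
    mul_div_assoc', ← Real.rpow_add hx, div_eq_inv_mul]
  simp

lemma lintegral_high_level_le {d : ℕ} {F : EuclideanSpace ℝ (Fin d) → ℂ} (hF : Continuous F)
    {p : ℝ} (hp : 1 < p) :
    ∫⁻ t in Ioi (0 : ℝ), (∫⁻ x in {x | t < 2 * ‖F x‖}, ‖F x‖ₑ) * ENNReal.ofReal (t ^ (p - 2)) ≤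
      ENNReal.ofReal (2 ^ (p - 1) / (p - 1)) * ∫⁻ x, ‖F x‖ₑ ^ p := by
  have key := lintegral_setLIntegral_mul_swap (D := {z | z.1 < 2 * ‖F z.2‖})
    (isOpen_lt (by fun_prop) (by fun_prop)).measurableSet (φ := fun x => ‖F x‖ₑ)
    (by fun_prop) (w := fun t => ENNReal.ofReal (t ^ (p - 2))) (by fun_prop)
  simp only [mem_ofPred_eq] at key
  rw [key, ← lintegral_const_mul _ (by fun_prop)]
  refine lintegral_mono fun x => ?_
  by_cases h0 : F x = 0
  · simp [h0]
  have hx : 0 < ‖F x‖ := norm_pos_iff.2 h0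
  have e : ∫⁻ t in Ioi (0 : ℝ) ∩ {t | t < 2 * ‖F x‖}, ENNReal.ofReal (t ^ (p - 2)) ≤
      ∫⁻ t in Ioc 0 (2 * ‖F x‖), ENNReal.ofReal (t ^ (p - 2)) :=
    lintegral_mono_set fun t ht => ⟨ht.1, le_of_lt ht.2⟩
  refine (mul_le_mul_right e _).trans ?_
  rw [lintegral_Ioc_rpow (by positivity) (by linarith), ← ofReal_norm,
    ENNReal.ofReal_rpow_of_pos hx,
    ← ENNReal.ofReal_mul (by positivity), ← ENNReal.ofReal_mul (by
      have := Real.rpow_nonneg (show (0:ℝ) ≤ 2 by norm_num) (p - 1)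
      exact div_nonneg this (by linarith))]
  apply ENNReal.ofReal_le_ofReal
  rw [show p - 2 + 1 = p - 1 by ring, Real.mul_rpow (by norm_num) hx.le, mul_div_assoc',
    mul_left_comm, show ‖F x‖ * ‖F x‖ ^ (p - 1) = ‖F x‖ ^ p by
      rw [← Real.rpow_one_add' hx.le (by linarith)]; ring_nf]
  apply le_of_eq; ring

/-- Hypotheses on a singular kernel: qualitative integrability, and normalised Hörmander and
`L²` bounds. -/
structure IsCZ {d : ℕ} (K : EuclideanSpace ℝ (Fin d) → EuclideanSpace ℝ (Fin d) → ℂ) : Prop where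
  meas : Measurable (Function.uncurry K)
  bdd : ∃ M : ℝ, ∀ x y, ‖K x y‖ ≤ M
  hormander : ∀ (r : ℝ) (y y' : EuclideanSpace ℝ (Fin d)), dist y y' ≤ r →
      ∫⁻ x in (Metric.ball y' (2 * r))ᶜ, ‖K x y - K x y'‖ₑ ≤ 1
  L2 : ∀ f : EuclideanSpace ℝ (Fin d) → ℂ, Integrable f → (∃ N : ℝ, ∀ x, ‖f x‖ ≤ N) →
      ∫⁻ x, ‖kint K f x‖ₑ ^ 2 ≤ ∫⁻ x, ‖f x‖ₑ ^ 2

/-- The constant in the strong-type bound below exponent two. -/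
def czLp (d : ℕ) (p : ℝ) : ℝ≥0∞ :=
  ENNReal.ofReal (2 ^ p) * (ENNReal.ofReal p * (ENNReal.ofReal (2 - p)⁻¹ +
    czConst d * ENNReal.ofReal (2 ^ (p - 1) / (p - 1))))

lemma czLp_ne_top (d : ℕ) (p : ℝ) : czLp d p ≠ ∞ := by
  have := czConst_ne_top d
  unfold czLp
  finiteness

lemma IsCZ.lintegral_rpow_le_of_lt_two {d : ℕ} (hd : 0 < d)
    {K : EuclideanSpace ℝ (Fin d) → EuclideanSpace ℝ (Fin d) → ℂ} (hK : IsCZ K)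
    {F : EuclideanSpace ℝ (Fin d) → ℂ} (hFc : Continuous F) (hF : Integrable F)
    {p : ℝ} (hp : 1 < p) (hp2 : p < 2) :
    ∫⁻ x, ‖kint K F x‖ₑ ^ p ≤ czLp d p * ∫⁻ x, ‖F x‖ₑ ^ p := by
  obtain ⟨M, hM⟩ := hK.bdd
  have hm := aestronglyMeasurable_kint hK.meas hF.aestronglyMeasurable
  have e1 : ∫⁻ x, ‖kint K F x‖ₑ ^ p =
      ENNReal.ofReal (2 ^ p) * ∫⁻ x, ENNReal.ofReal ((‖kint K F x‖ / 2) ^ p) := by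
    rw [← lintegral_const_mul' _ _ ofReal_ne_top]
    refine lintegral_congr fun x => ?_
    rw [← ENNReal.ofReal_mul (by positivity), ← Real.mul_rpow (by norm_num) (by positivity),
      mul_div_cancel₀ _ (by norm_num), ← ofReal_norm,
      ENNReal.ofReal_rpow_of_nonneg (norm_nonneg _) (by linarith)]
  rw [e1, lintegral_rpow_eq_lintegral_meas_lt_mul volume (ae_of_all _ fun x => by positivity)
    (by exact (hm.norm.aemeasurable.div_const 2)) (by linarith), czLp]
  simp only [mul_assoc]
  refine mul_le_mul_right (mul_le_mul_right ?_ _) _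
  calc _ ≤ ∫⁻ t in Ioi (0 : ℝ), ((∫⁻ x in {x | ‖F x‖ ≤ t}, ‖F x‖ₑ ^ 2) *
          ENNReal.ofReal (t ^ (p - 3)) + czConst d * ((∫⁻ x in {x | t < 2 * ‖F x‖}, ‖F x‖ₑ) *
            ENNReal.ofReal (t ^ (p - 2)))) := by
        apply setLIntegral_mono' measurableSet_Ioi
        intro t ht
        have ht' : 0 < t := ht
        have h := measure_kint_gt_le hd hK.meas hM hK.L2 hK.hormander hFc hF ht'
        have e2 : {x | t < ‖kint K F x‖ / 2} = {x | 2 * t < ‖kint K F x‖} := by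
          ext x; simp only [mem_ofPred_eq]; rw [lt_div_iff₀ (by norm_num), mul_comm]
        rw [e2]
        refine (mul_le_mul_left h _).trans (le_of_eq ?_)
        have a1 : (ENNReal.ofReal t)⁻¹ * ENNReal.ofReal (t ^ (p - 1)) =
            ENNReal.ofReal (t ^ (p - 2)) := by
          rw [← ENNReal.ofReal_inv_of_pos ht', ← ENNReal.ofReal_mul (by positivity),
            ← Real.rpow_neg_one, ← Real.rpow_add ht']
          ring_nf
        have a2 : (ENNReal.ofReal t)⁻¹ * ENNReal.ofReal (t ^ (p - 2)) =
            ENNReal.ofReal (t ^ (p - 3)) := by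
          rw [← ENNReal.ofReal_inv_of_pos ht', ← ENNReal.ofReal_mul (by positivity),
            ← Real.rpow_neg_one, ← Real.rpow_add ht']
          ring_nf
        rw [← a2, ← a1]
        ring
    _ = (∫⁻ t in Ioi (0 : ℝ), ((∫⁻ x in {x | ‖F x‖ ≤ t}, ‖F x‖ₑ ^ 2) *
          ENNReal.ofReal (t ^ (p - 3)))) + czConst d * ∫⁻ t in Ioi (0 : ℝ),
            ((∫⁻ x in {x | t < 2 * ‖F x‖}, ‖F x‖ₑ) * ENNReal.ofReal (t ^ (p - 2))) := by
        rw [← lintegral_const_mul' _ _ (czConst_ne_top d), lintegral_add_left]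
        refine Measurable.mul ?_ (by fun_prop)
        have hD : MeasurableSet {z : ℝ × EuclideanSpace ℝ (Fin d) | ‖F z.2‖ ≤ z.1} :=
          (isClosed_le (by fun_prop) (by fun_prop)).measurableSet
        have : Measurable fun z : ℝ × EuclideanSpace ℝ (Fin d) =>
          {z : ℝ × EuclideanSpace ℝ (Fin d) | ‖F z.2‖ ≤ z.1}.indicator
            (fun z => ‖F z.2‖ₑ ^ 2) z := 
            Measurable.indicator (((hFc.comp continuous_snd).enorm.measurable).pow_const 2) hD
        have e3 : (fun t : ℝ => ∫⁻ x in {x | ‖F x‖ ≤ t}, ‖F x‖ₑ ^ 2) = fun t => ∫⁻ x,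
            {z : ℝ × EuclideanSpace ℝ (Fin d) | ‖F z.2‖ ≤ z.1}.indicator
              (fun z => ‖F z.2‖ₑ ^ 2) (t, x) := by
          funext t
          rw [← lintegral_indicator (isClosed_le hFc.norm continuous_const).measurableSet]
          rfl
        rw [e3]
        exact this.lintegral_prod_right'
    _ ≤ ENNReal.ofReal (2 - p)⁻¹ * (∫⁻ x, ‖F x‖ₑ ^ p) + czConst d *
          (ENNReal.ofReal (2 ^ (p - 1) / (p - 1)) * ∫⁻ x, ‖F x‖ₑ ^ p) := by
        gcongr
        · exact lintegral_low_level_le hFc hp2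
        · exact lintegral_high_level_le hFc hp
    _ = _ := by ring

lemma lintegral_rpow_lt_top_of_bdd {d : ℕ} {u : EuclideanSpace ℝ (Fin d) → ℂ}
    (hu : Integrable u) {N : ℝ} (hN : ∀ x, ‖u x‖ ≤ N) {p : ℝ} (hp : 1 ≤ p) :
    ∫⁻ x, ‖u x‖ₑ ^ p < ∞ := by
  calc ∫⁻ x, ‖u x‖ₑ ^ p ≤ ∫⁻ x, ENNReal.ofReal N ^ (p - 1) * ‖u x‖ₑ := by
        refine lintegral_mono fun x => ?_
        have hx : ‖u x‖ₑ ≤ ENNReal.ofReal N := by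
          rw [← ofReal_norm]; exact ENNReal.ofReal_le_ofReal (hN x)
        calc ‖u x‖ₑ ^ p = ‖u x‖ₑ ^ (p - 1) * ‖u x‖ₑ := by
              nth_rewrite 3 [← ENNReal.rpow_one ‖u x‖ₑ]
              rw [← ENNReal.rpow_add_of_nonneg _ _ (by linarith) zero_le_one]; ring_nf
          _ ≤ _ := by
              gcongr
    _ = ENNReal.ofReal N ^ (p - 1) * ∫⁻ x, ‖u x‖ₑ :=
        lintegral_const_mul' _ _ (ENNReal.rpow_ne_top_of_nonneg (by linarith) ofReal_ne_top)
    _ < ∞ := ENNReal.mul_lt_top (ENNReal.rpow_lt_top_of_nonneg (by linarith) ofReal_ne_top) hu.2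

/-- Duality: a bound for the transposed kernel gives one for the kernel. -/
lemma lintegral_rpow_le_of_dual {d : ℕ}
    {K : EuclideanSpace ℝ (Fin d) → EuclideanSpace ℝ (Fin d) → ℂ}
    (hK : Measurable (Function.uncurry K)) {M : ℝ} (hM : ∀ x y, ‖K x y‖ ≤ M)
    {F : EuclideanSpace ℝ (Fin d) → ℂ} (hF : Integrable F) (hu : Integrable (kint K F))
    {N : ℝ} (hN : ∀ x, ‖kint K F x‖ ≤ N) {p q : ℝ} (hp : 2 ≤ p) (hpq : p.HolderConjugate q)
    {C : ℝ≥0∞}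
    (h : ∀ h : EuclideanSpace ℝ (Fin d) → ℂ, Integrable h → (∃ N : ℝ, ∀ x, ‖h x‖ ≤ N) →
      (Continuous (kint K F) → Continuous h) →
      ∫⁻ x, ‖kint (fun x y => K y x) h x‖ₑ ^ q ≤ C * ∫⁻ x, ‖h x‖ₑ ^ q) :
    ∫⁻ x, ‖kint K F x‖ₑ ^ p ≤ C ^ (p - 1) * ∫⁻ x, ‖F x‖ₑ ^ p := by
  set u := kint K F with hudef
  let g : EuclideanSpace ℝ (Fin d) → ℂ := fun x => ((‖u x‖ ^ (p - 2) : ℝ) : ℂ) * star (u x)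
  have hgn : ∀ x, ‖g x‖ = ‖u x‖ ^ (p - 1) := by
    intro x
    simp only [g, norm_mul, norm_star, Complex.norm_real]
    rw [Real.norm_of_nonneg (by positivity)]
    nth_rewrite 2 [← Real.rpow_one ‖u x‖]
    rw [← Real.rpow_add_of_nonneg (norm_nonneg _) (by linarith) zero_le_one]
    ring_nf
  have hgm : AEStronglyMeasurable g volume := by
    have h1 : AEStronglyMeasurable (fun x => ((‖u x‖ ^ (p - 2) : ℝ) : ℂ)) volume :=
      (Continuous.comp_aestronglyMeasurable (g := fun z : ℂ => ((‖z‖ ^ (p - 2) : ℝ) : ℂ))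
        (Complex.continuous_ofReal.comp (continuous_norm.rpow_const fun _ => Or.inr (by linarith)))
        hu.aestronglyMeasurable)
    exact h1.mul hu.aestronglyMeasurable.star
  have hgI : Integrable g := by
    refine ⟨hgm, ?_⟩
    rw [hasFiniteIntegral_iff_enorm]
    have := lintegral_rpow_lt_top_of_bdd hu hN (p := p - 1) (by linarith)
    refine lt_of_eq_of_lt (lintegral_congr fun x => ?_) this
    rw [← ofReal_norm, hgn, ← ofReal_norm, ENNReal.ofReal_rpow_of_nonneg (norm_nonneg _) (by linarith)]
  have hgb : ∃ N : ℝ, ∀ x, ‖g x‖ ≤ N := ⟨N ^ (p - 1), fun x => by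
    rw [hgn]; exact Real.rpow_le_rpow (norm_nonneg _) (hN x) (by linarith)⟩
  have hgc : Continuous u → Continuous g := fun hc =>
    (Complex.continuous_ofReal.comp (hc.norm.rpow_const fun _ => Or.inr (by linarith))).mul hc.star
  have hg := h g hgI hgb hgc
  have hgq : ∫⁻ x, ‖g x‖ₑ ^ q = ∫⁻ x, ‖u x‖ₑ ^ p := by
    refine lintegral_congr fun x => ?_
    rw [← ofReal_norm, hgn, ← ofReal_norm, ENNReal.ofReal_rpow_of_nonneg (by positivity) hpq.symm.nonneg,
      ENNReal.ofReal_rpow_of_nonneg (by positivity) hpq.nonneg, ← Real.rpow_mul (norm_nonneg _)]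
    congr 2
    exact hpq.sub_one_mul_conj
  set I := ∫⁻ x, ‖u x‖ₑ ^ p with hI
  have hItop : I ≠ ∞ := (lintegral_rpow_lt_top_of_bdd hu hN (by linarith)).ne
  have hswap : ∫ x, u x * g x = ∫ y, F y * kint (fun x y => K y x) g y := by
    have hinteg : Integrable (fun z : EuclideanSpace ℝ (Fin d) × EuclideanSpace ℝ (Fin d) =>
        K z.1 z.2 * (g z.1 * F z.2)) (volume.prod volume) :=
      (hgI.mul_prod hF).bdd_mul (c := M) hK.aestronglyMeasurable (ae_of_all _ fun z => hM _ _)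
    calc _ = ∫ x, ∫ y, K x y * (g x * F y) := by
          congr 1; funext x
          rw [hudef, kint, ← integral_mul_const]
          congr 1; funext y; ring
      _ = ∫ y, ∫ x, K x y * (g x * F y) := integral_integral_swap hinteg
      _ = _ := by
          congr 1; funext y
          rw [kint, ← integral_const_mul]
          congr 1; funext x; ring
  have hIeq : I = ‖∫ x, u x * g x‖ₑ := by
    have : ∀ x, u x * g x = ((‖u x‖ ^ p : ℝ) : ℂ) := by
      intro x
      simp only [g]
      rw [mul_left_comm, Complex.star_def, Complex.mul_conj, ← Complex.ofReal_mul,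
        Complex.normSq_eq_norm_sq, ← Real.rpow_natCast, ← Real.rpow_add_of_nonneg (norm_nonneg _) (by linarith) (by norm_num)]
      congr 2; push_cast; ring
    simp_rw [this]
    rw [integral_complex_ofReal, ← ofReal_norm, Complex.norm_real, Real.norm_of_nonneg
      (integral_nonneg fun x => by positivity), ofReal_integral_eq_lintegral_ofReal]
    · refine lintegral_congr fun x => ?_
      rw [← ofReal_norm, ENNReal.ofReal_rpow_of_nonneg (by positivity) hpq.nonneg]
    · refine ⟨?_, ?_⟩
      · exact (Continuous.comp_aestronglyMeasurable (g := fun z : ℂ => (‖z‖ ^ p : ℝ))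
          ((continuous_norm.rpow_const fun _ => Or.inr (by linarith)))
          hu.aestronglyMeasurable)
      · rw [hasFiniteIntegral_iff_enorm]
        refine lt_of_eq_of_lt (lintegral_congr fun x => ?_) hItop.lt_top
        rw [Real.enorm_eq_ofReal (by positivity), ← ofReal_norm,
          ENNReal.ofReal_rpow_of_nonneg (by positivity) hpq.nonneg]
    · exact ae_of_all _ fun x => by positivity
  set P := ∫⁻ x, ‖F x‖ₑ ^ p with hP
  have hI1 : I ≤ P ^ (1 / p) * (C * I) ^ (1 / q) := by
    calc I = ‖∫ y, F y * kint (fun x y => K y x) g y‖ₑ := by rw [hIeq, hswap]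
      _ ≤ ∫⁻ y, ‖F y‖ₑ * ‖kint (fun x y => K y x) g y‖ₑ := by
        refine (enorm_integral_le_lintegral_enorm _).trans (le_of_eq ?_)
        simp_rw [enorm_mul]
      _ ≤ P ^ (1 / p) * (∫⁻ y, ‖kint (fun x y => K y x) g y‖ₑ ^ q) ^ (1 / q) :=
        ENNReal.lintegral_mul_le_Lp_mul_Lq volume hpq hF.aestronglyMeasurable.enorm
          (aestronglyMeasurable_kint (K := fun x y => K y x) (hK.comp measurable_swap) hgm).enorm
      _ ≤ _ := by
        have := hpq.symm.nonneg
        gcongr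
        rw [hgq] at hg; exact hg
  by_cases hI0 : I = 0
  · rw [hI0]; simp
  have hI2 : I ^ (1 / p) ≤ P ^ (1 / p) * C ^ (1 / q) := by
    have hq' : 0 ≤ 1 / q := by have := hpq.symm.nonneg; positivity
    rw [ENNReal.mul_rpow_of_nonneg _ _ hq', ← mul_assoc] at hI1
    have hIq0 : I ^ (1 / q) ≠ 0 := (ENNReal.rpow_pos (pos_iff_ne_zero.2 hI0) hItop).ne'
    have hIqt : I ^ (1 / q) ≠ ∞ := ENNReal.rpow_ne_top_of_nonneg hq' hItop
    rw [← ENNReal.mul_le_mul_iff_left hIq0 hIqt]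
    refine le_trans (le_of_eq ?_) hI1
    rw [← ENNReal.rpow_add _ _ hI0 hItop, one_div, one_div, hpq.inv_add_inv_eq_one, ENNReal.rpow_one]
  have hp0 : p ≠ 0 := hpq.ne_zero
  calc I = (I ^ (1 / p)) ^ p := by rw [← ENNReal.rpow_mul, one_div_mul_cancel hp0, ENNReal.rpow_one]
    _ ≤ (P ^ (1 / p) * C ^ (1 / q)) ^ p := by
      have := hpq.nonneg; gcongr
    _ = _ := by
      rw [ENNReal.mul_rpow_of_nonneg _ _ hpq.nonneg, ← ENNReal.rpow_mul, ← ENNReal.rpow_mul,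
        one_div_mul_cancel hp0, ENNReal.rpow_one, mul_comm, one_div, mul_comm q⁻¹,
        ← div_eq_mul_inv, hpq.div_conj_eq_sub_one]

/-- The square of the `L²` norm. -/
abbrev sqNorm {d : ℕ} (f : EuclideanSpace ℝ (Fin d) → ℂ) : ℝ≥0∞ := ∫⁻ x, ‖f x‖ₑ ^ 2

lemma sqNorm_eq_eLpNorm {d : ℕ} (f : EuclideanSpace ℝ (Fin d) → ℂ) :
    sqNorm f = eLpNorm f 2 volume ^ 2 := by
  have := eLpNorm_nnreal_pow_eq_lintegral (μ := volume) (f := f) (p := 2) two_ne_zero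
  norm_num at this
  exact this.symm

/-- The weight `(1 + ρ |x - y|) ^ δ`. -/
def wt {d : ℕ} (δ ρ : ℝ) (x y : EuclideanSpace ℝ (Fin d)) : ℝ≥0∞ :=
  ENNReal.ofReal ((1 + ρ * dist x y) ^ δ)

lemma wt_comm {d : ℕ} (δ ρ : ℝ) (x y : EuclideanSpace ℝ (Fin d)) : wt δ ρ x y = wt δ ρ y x := by
  rw [wt, wt, dist_comm]

lemma one_le_wt {d : ℕ} {δ ρ : ℝ} (hδ : 0 ≤ δ) (hρ : 0 ≤ ρ) (x y : EuclideanSpace ℝ (Fin d)) :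
    1 ≤ wt δ ρ x y := by
  rw [wt, ENNReal.one_le_ofReal]
  refine Real.one_le_rpow ?_ hδ
  have := mul_nonneg hρ (dist_nonneg (x := x) (y := y))
  linarith

lemma measurable_wt {d : ℕ} (δ ρ : ℝ) :
    Measurable (Function.uncurry (wt (d := d) δ ρ)) := by
  unfold wt Function.uncurry
  fun_prop

/-- A kernel concentrated at scale `1 / ρ`, with Schur and Lipschitz bounds in both variables. -/
structure ScaledKernel {d : ℕ} (δ ρ : ℝ) (A : ℝ≥0∞)
    (k : EuclideanSpace ℝ (Fin d) → EuclideanSpace ℝ (Fin d) → ℂ) : Prop where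
  meas : Measurable (Function.uncurry k)
  bdd : ∃ M : ℝ, ∀ x y, ‖k x y‖ ≤ M
  col : ∀ y, ∫⁻ x, ‖k x y‖ₑ * wt δ ρ x y ≤ A
  row : ∀ x, ∫⁻ y, ‖k x y‖ₑ * wt δ ρ x y ≤ A
  lipCol : ∀ y y', ∫⁻ x, ‖k x y - k x y'‖ₑ ≤ A * ENNReal.ofReal (ρ * dist y y')
  lipRow : ∀ x x', ∫⁻ y, ‖k x y - k x' y‖ₑ ≤ A * ENNReal.ofReal (ρ * dist x x')

lemma ScaledKernel.swap {d : ℕ} {δ ρ : ℝ} {A : ℝ≥0∞}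
    {k : EuclideanSpace ℝ (Fin d) → EuclideanSpace ℝ (Fin d) → ℂ} (h : ScaledKernel δ ρ A k) :
    ScaledKernel δ ρ A (fun x y => k y x) where
  meas := h.meas.comp measurable_swap
  bdd := h.bdd.imp fun M hM x y => hM y x
  col y := by simpa only [wt_comm δ ρ y] using h.row y
  row x := by simpa only [wt_comm δ ρ _ x] using h.col x
  lipCol := h.lipRow
  lipRow := h.lipCol

/-- The terms dominating the Hörmander integrals of the dyadic pieces. -/
def hterm (δ : ℝ) (i : ℤ) : ℝ≥0∞ :=
  if 0 ≤ i then 2 * ENNReal.ofReal ((2 : ℝ) ^ (-δ * i)) else ENNReal.ofReal ((2 : ℝ) ^ (i + 1))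

lemma tsum_hterm_ne_top {δ : ℝ} (hδ : 0 < δ) : ∑' i : ℤ, hterm δ i ≠ ∞ := by
  rw [tsum_of_nat_of_neg_add_one ENNReal.summable ENNReal.summable]
  have e1 : ∀ n : ℕ, hterm δ n = 2 * ENNReal.ofReal ((2 : ℝ) ^ (-δ)) ^ n := by
    intro n
    rw [hterm, if_pos (by positivity), ← ENNReal.ofReal_pow (by positivity), ← Real.rpow_natCast,
      ← Real.rpow_mul (by norm_num)]
    push_cast; rfl
  have e2 : ∀ n : ℕ, hterm δ (-(n + 1)) = ENNReal.ofReal (2⁻¹) ^ n := by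
    intro n
    rw [hterm, if_neg (by omega), ← ENNReal.ofReal_pow (by positivity)]
    congr 1
    rw [inv_pow, ← zpow_natCast, ← zpow_neg]
    congr 1; ring
  simp_rw [e1, e2]
  rw [ENNReal.tsum_mul_left, ENNReal.tsum_geometric, ENNReal.tsum_geometric]
  have h1 : (1 - ENNReal.ofReal ((2 : ℝ) ^ (-δ)))⁻¹ ≠ ∞ := by
    rw [ENNReal.inv_ne_top, ne_eq, tsub_eq_zero_iff_le, not_le, ENNReal.ofReal_lt_one]
    exact Real.rpow_lt_one_of_one_lt_of_neg (by norm_num) (by linarith)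
  have h2 : (1 - ENNReal.ofReal (2⁻¹))⁻¹ ≠ ∞ := by
    rw [ENNReal.inv_ne_top, ne_eq, tsub_eq_zero_iff_le, not_le, ENNReal.ofReal_lt_one]
    norm_num
  finiteness

lemma ScaledKernel.hormander_le {d : ℕ} {δ : ℝ} (hδ : 0 < δ) {A : ℝ≥0∞} {j : ℕ}
    {k : EuclideanSpace ℝ (Fin d) → EuclideanSpace ℝ (Fin d) → ℂ}
    (h : ScaledKernel δ (2 ^ j) A k) {r : ℝ} {y y' : EuclideanSpace ℝ (Fin d)}
    (hr : dist y y' ≤ r) {i : ℤ} (h1 : (2 : ℝ) ^ i ≤ 2 ^ j * r) (h2 : 2 ^ j * r < (2 : ℝ) ^ (i + 1)) :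
    ∫⁻ x in (Metric.ball y' (2 * r))ᶜ, ‖k x y - k x y'‖ₑ ≤ A * hterm δ i := by
  have hr0 : 0 ≤ r := dist_nonneg.trans hr
  rw [hterm]
  split_ifs with hi
  · have hfar : ∀ z, dist z y' ≤ r →
        ∫⁻ x in (Metric.ball y' (2 * r))ᶜ, ‖k x z‖ₑ ≤ A * ENNReal.ofReal ((2 : ℝ) ^ (-δ * i)) := by
      intro z hz
      have hpos : (0 : ℝ) < 2 ^ (δ * i) := by positivity
      calc ∫⁻ x in (Metric.ball y' (2 * r))ᶜ, ‖k x z‖ₑ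
          ≤ ∫⁻ x in (Metric.ball y' (2 * r))ᶜ, (‖k x z‖ₑ * wt δ (2 ^ j) x z) *
              ENNReal.ofReal ((2 : ℝ) ^ (-δ * i)) := by
            refine setLIntegral_mono' Metric.isOpen_ball.measurableSet.compl fun x hx => ?_
            rw [mul_assoc]
            refine le_mul_of_one_le_right' ?_
            rw [wt, ← ENNReal.ofReal_mul (by positivity), ENNReal.one_le_ofReal, neg_mul,
              Real.rpow_neg (by norm_num), ← div_eq_mul_inv, one_le_div hpos,
              mul_comm δ, Real.rpow_mul (by norm_num), Real.rpow_intCast]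
            refine Real.rpow_le_rpow (by positivity) ?_ hδ.le
            have hx' : 2 * r ≤ dist x y' := by simpa using hx
            have : r ≤ dist x z := by
              have := dist_triangle x z y'
              linarith
            have : (2 : ℝ) ^ j * r ≤ 2 ^ j * dist x z := by gcongr
            linarith
        _ ≤ ∫⁻ x, (‖k x z‖ₑ * wt δ (2 ^ j) x z) * ENNReal.ofReal ((2 : ℝ) ^ (-δ * i)) :=
            setLIntegral_le_lintegral _ _
        _ = (∫⁻ x, ‖k x z‖ₑ * wt δ (2 ^ j) x z) * ENNReal.ofReal ((2 : ℝ) ^ (-δ * i)) :=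
            lintegral_mul_const' _ _ ofReal_ne_top
        _ ≤ _ := by gcongr; exact h.col z
    calc _ ≤ ∫⁻ x in (Metric.ball y' (2 * r))ᶜ, (‖k x y‖ₑ + ‖k x y'‖ₑ) :=
          lintegral_mono fun x => enorm_sub_le
      _ = (∫⁻ x in (Metric.ball y' (2 * r))ᶜ, ‖k x y‖ₑ) +
          ∫⁻ x in (Metric.ball y' (2 * r))ᶜ, ‖k x y'‖ₑ :=
          lintegral_add_left (h.meas.comp measurable_prodMk_right).enorm _
      _ ≤ _ := add_le_add (hfar y hr) (hfar y' (by simpa using hr0))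
      _ = _ := by ring
  · calc _ ≤ _ := setLIntegral_le_lintegral _ _
      _ ≤ _ := h.lipCol y y'
      _ ≤ _ := by
        gcongr
        refine le_trans ?_ h2.le
        gcongr

/-- The Hörmander condition for a sum of kernels at different dyadic scales. -/
lemma hormander_sum_le {d : ℕ} {δ : ℝ} (hδ : 0 < δ) {A : ℝ≥0∞} (J : Finset ℕ)
    {k : ℕ → EuclideanSpace ℝ (Fin d) → EuclideanSpace ℝ (Fin d) → ℂ}
    (h : ∀ j ∈ J, ScaledKernel δ (2 ^ j) A (k j)) {r : ℝ} {y y' : EuclideanSpace ℝ (Fin d)}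
    (hr : dist y y' ≤ r) :
    ∫⁻ x in (Metric.ball y' (2 * r))ᶜ, ‖(∑ j ∈ J, k j x y) - ∑ j ∈ J, k j x y'‖ₑ ≤
      A * ∑' i : ℤ, hterm δ i := by
  rcases (dist_nonneg.trans hr).eq_or_lt with rfl | hr0
  · have : y = y' := dist_le_zero.1 hr
    simp [this]
  obtain ⟨n, hn1, hn2⟩ := exists_mem_Ico_zpow hr0 (one_lt_two (α := ℝ))
  calc _ ≤ ∫⁻ x in (Metric.ball y' (2 * r))ᶜ, ∑ j ∈ J, ‖k j x y - k j x y'‖ₑ := by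
        refine lintegral_mono fun x => ?_
        dsimp only
        rw [← Finset.sum_sub_distrib]
        exact enorm_sum_le _ _
    _ = ∑ j ∈ J, ∫⁻ x in (Metric.ball y' (2 * r))ᶜ, ‖k j x y - k j x y'‖ₑ :=
        lintegral_finsetSum' _ fun j hj => (((h j hj).meas.comp measurable_prodMk_right).sub
          ((h j hj).meas.comp measurable_prodMk_right)).enorm.aemeasurable
    _ ≤ ∑ j ∈ J, A * hterm δ (j + n) := by
        refine Finset.sum_le_sum fun j hj => (h j hj).hormander_le hδ hr ?_ ?_
        · rw [zpow_add₀ two_ne_zero, zpow_natCast]; gcongr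
        · rw [add_assoc, zpow_add₀ two_ne_zero, zpow_natCast]; gcongr
    _ ≤ ∑' j : ℕ, A * hterm δ (j + n) := ENNReal.sum_le_tsum _
    _ = A * ∑' j : ℕ, hterm δ (j + n) := ENNReal.tsum_mul_left
    _ ≤ _ := by
        gcongr
        exact ENNReal.tsum_comp_le_tsum_of_injective (f := fun j : ℕ => (j : ℤ) + n)
          (fun a b hab => by simpa using hab) (hterm δ)

lemma sqNorm_kint_le_of_schwartz {d : ℕ}
    {K : EuclideanSpace ℝ (Fin d) → EuclideanSpace ℝ (Fin d) → ℂ}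
    (hK : Measurable (Function.uncurry K)) {M : ℝ} (hM : ∀ x y, ‖K x y‖ ≤ M) {R : ℝ≥0∞}
    (hRt : R ≠ ∞) (hR : ∀ x, ∫⁻ y, ‖K x y‖ₑ ≤ R) {B : ℝ≥0∞} (hB : B ≠ ∞)
    (h : ∀ F : SchwartzMap (EuclideanSpace ℝ (Fin d)) ℂ, sqNorm (kint K F) ≤ B * sqNorm F)
    {f : EuclideanSpace ℝ (Fin d) → ℂ} (hf : Integrable f) {N : ℝ} (hN : ∀ x, ‖f x‖ ≤ N) :
    sqNorm (kint K f) ≤ B * sqNorm f := by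
  have hf2 : MemLp f 2 volume := by
    refine ⟨hf.aestronglyMeasurable, ?_⟩
    have := lintegral_rpow_lt_top_of_bdd hf hN (p := 2) (by norm_num)
    have e := sqNorm_eq_eLpNorm f
    simp only [ENNReal.rpow_ofNat] at this
    rw [sqNorm] at e
    rw [e] at this
    by_contra hc
    rw [not_lt, top_le_iff] at hc
    rw [hc] at this
    simp at this
  have hex : ∀ n : ℕ, ∃ F : SchwartzMap (EuclideanSpace ℝ (Fin d)) ℂ,
      eLpNorm (f - ⇑F) 2 volume ≤ ENNReal.ofReal (1 / (n + 1)) := by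
    intro n
    obtain ⟨g, hg1, hg2, hg3⟩ := hf2.exist_eLpNorm_sub_le (by simp) (by norm_num)
      (ε := 1 / ((n : ℝ) + 1)) (by positivity)
    exact ⟨hg1.toSchwartzMap hg2, hg3⟩
  choose F hF using hex
  have hlim : Tendsto (fun n => eLpNorm (f - ⇑(F n)) 2 volume) atTop (𝓝 0) := by
    refine tendsto_of_tendsto_of_tendsto_of_le_of_le tendsto_const_nhds ?_ (fun _ => zero_le) hF
    rw [← ENNReal.ofReal_zero]
    exact ENNReal.tendsto_ofReal tendsto_one_div_add_atTop_nhds_zero_nat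
  have hlim2 : Tendsto (fun n => B * (eLpNorm f 2 volume + eLpNorm (f - ⇑(F n)) 2 volume) ^ 2)
      atTop (𝓝 (B * sqNorm f)) := by
    rw [sqNorm_eq_eLpNorm]
    refine ENNReal.Tendsto.const_mul ?_ (Or.inr hB)
    have := (tendsto_const_nhds (x := eLpNorm f 2 volume)).add hlim
    rw [add_zero] at this
    exact ENNReal.Tendsto.pow this
  have hpt : ∀ x, Tendsto (fun n => kint K (F n) x) atTop (𝓝 (kint K f x)) := by
    intro x
    rw [tendsto_iff_edist_tendsto_0]
    have hbound : ∀ n, edist (kint K (F n) x) (kint K f x) ≤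
        (ENNReal.ofReal M * R) ^ (1 / 2 : ℝ) * eLpNorm (f - ⇑(F n)) 2 volume := by
      intro n
      rw [edist_comm, edist_eq_enorm_sub, kint, kint, ← integral_sub (integrable_kernel_mul hK hM hf x)
        (integrable_kernel_mul hK hM (F n).integrable x)]
      calc _ ≤ ∫⁻ y, ‖K x y * f y - K x y * F n y‖ₑ := enorm_integral_le_lintegral_enorm _
        _ = ∫⁻ y, ((fun y => ‖K x y‖ₑ) * fun y => ‖(f - ⇑(F n)) y‖ₑ) y := by
            refine lintegral_congr fun y => ?_
            rw [← mul_sub, enorm_mul]; rfl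
        _ ≤ _ := ENNReal.lintegral_mul_le_Lp_mul_Lq volume Real.HolderConjugate.two_two
            (hK.comp measurable_prodMk_left).enorm.aemeasurable
            (hf.aestronglyMeasurable.sub (F n).integrable.aestronglyMeasurable).enorm
        _ ≤ _ := by
            rw [eLpNorm_eq_lintegral_rpow_enorm_toReal two_ne_zero (by simp)]
            simp only [ENNReal.toReal_ofNat]
            gcongr
            calc ∫⁻ y, ‖K x y‖ₑ ^ (2 : ℝ) ≤ ∫⁻ y, ENNReal.ofReal M * ‖K x y‖ₑ := by
                  refine lintegral_mono fun y => ?_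
                  rw [ENNReal.rpow_ofNat, sq]
                  gcongr
                  rw [← ofReal_norm]
                  exact ENNReal.ofReal_le_ofReal (hM x y)
              _ = ENNReal.ofReal M * ∫⁻ y, ‖K x y‖ₑ := lintegral_const_mul' _ _ ofReal_ne_top
              _ ≤ _ := by gcongr; exact hR x
    refine tendsto_of_tendsto_of_tendsto_of_le_of_le tendsto_const_nhds ?_ (fun _ => zero_le) hbound
    have := ENNReal.Tendsto.const_mul (a := (ENNReal.ofReal M * R) ^ (1 / 2 : ℝ)) hlim
      (Or.inr (by finiteness))
    rwa [mul_zero] at this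
  calc sqNorm (kint K f) = ∫⁻ x, liminf (fun n => ‖kint K (F n) x‖ₑ ^ 2) atTop := by
        refine lintegral_congr fun x => ?_
        exact (ENNReal.Tendsto.pow (n := 2) ((continuous_enorm.tendsto _).comp (hpt x))).liminf_eq.symm
    _ ≤ liminf (fun n => ∫⁻ x, ‖kint K (F n) x‖ₑ ^ 2) atTop :=
        lintegral_liminf_le' fun n =>
          (aestronglyMeasurable_kint hK (F n).integrable.aestronglyMeasurable).enorm.pow_const 2
    _ ≤ liminf (fun n => B * (eLpNorm f 2 volume + eLpNorm (f - ⇑(F n)) 2 volume) ^ 2) atTop := by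
        refine liminf_le_liminf (Eventually.of_forall fun n => (h (F n)).trans ?_)
        rw [sqNorm_eq_eLpNorm]
        have hsub : eLpNorm (F n) 2 volume ≤
            eLpNorm f 2 volume + eLpNorm (f - ⇑(F n)) 2 volume := by
          have := eLpNorm_sub_le (μ := volume) (p := 2) hf.aestronglyMeasurable
            (hf.aestronglyMeasurable.sub (F n).integrable.aestronglyMeasurable) (by norm_num)
          rwa [_root_.sub_sub_cancel] at this
        gcongr
    _ = _ := hlim2.liminf_eq

/-- `L²` boundedness on bounded integrable functions. -/
def L2Bound {d : ℕ} (B : ℝ≥0∞)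
    (K : EuclideanSpace ℝ (Fin d) → EuclideanSpace ℝ (Fin d) → ℂ) : Prop :=
  ∀ f : EuclideanSpace ℝ (Fin d) → ℂ, Integrable f → (∃ N : ℝ, ∀ x, ‖f x‖ ≤ N) →
    sqNorm (kint K f) ≤ B * sqNorm f

lemma norm_kint_le_of_row {d : ℕ}
    {K : EuclideanSpace ℝ (Fin d) → EuclideanSpace ℝ (Fin d) → ℂ} {R : ℝ≥0∞}
    (hRt : R ≠ ∞) (hR : ∀ x, ∫⁻ y, ‖K x y‖ₑ ≤ R)
    {f : EuclideanSpace ℝ (Fin d) → ℂ} {N : ℝ} (hN : ∀ x, ‖f x‖ ≤ N) (x : EuclideanSpace ℝ (Fin d)) :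
    ‖kint K f x‖ ≤ (R * ENNReal.ofReal N).toReal := by
  rw [← toReal_enorm]
  refine ENNReal.toReal_mono (by finiteness) ?_
  calc _ ≤ ∫⁻ y, ‖K x y * f y‖ₑ := enorm_integral_le_lintegral_enorm _
    _ ≤ ∫⁻ y, ‖K x y‖ₑ * ENNReal.ofReal N := by
        refine lintegral_mono fun y => ?_
        rw [enorm_mul]
        gcongr
        rw [← ofReal_norm]
        exact ENNReal.ofReal_le_ofReal (hN y)
    _ = (∫⁻ y, ‖K x y‖ₑ) * ENNReal.ofReal N := lintegral_mul_const' _ _ ofReal_ne_top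
    _ ≤ _ := by gcongr; exact hR x

lemma integrable_kint_of_col {d : ℕ}
    {K : EuclideanSpace ℝ (Fin d) → EuclideanSpace ℝ (Fin d) → ℂ}
    (hK : Measurable (Function.uncurry K)) {R : ℝ≥0∞}
    (hRt : R ≠ ∞) (hR : ∀ y, ∫⁻ x, ‖K x y‖ₑ ≤ R)
    {f : EuclideanSpace ℝ (Fin d) → ℂ} (hf : Integrable f) : Integrable (kint K f) := by
  refine ⟨aestronglyMeasurable_kint hK hf.aestronglyMeasurable, ?_⟩
  have hm := hK.enorm.aemeasurable.mul (hf.aestronglyMeasurable.comp_snd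
    (μ := (volume : Measure (EuclideanSpace ℝ (Fin d))))).enorm
  calc ∫⁻ x, ‖kint K f x‖ₑ ≤ ∫⁻ x, ∫⁻ y, ‖K x y‖ₑ * ‖f y‖ₑ := by
        refine lintegral_mono fun x => (enorm_integral_le_lintegral_enorm _).trans (le_of_eq ?_)
        simp_rw [enorm_mul]
    _ = ∫⁻ y, ∫⁻ x, ‖K x y‖ₑ * ‖f y‖ₑ := lintegral_lintegral_swap hm
    _ ≤ ∫⁻ y, R * ‖f y‖ₑ := by
        refine lintegral_mono fun y => ?_
        dsimp only
        have hm' : Measurable fun x => ‖K x y‖ₑ := (hK.comp measurable_prodMk_right).enorm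
        rw [lintegral_mul_const _ hm']
        gcongr
        exact hR y
    _ = R * ∫⁻ y, ‖f y‖ₑ := lintegral_const_mul' _ _ hRt
    _ < ∞ := ENNReal.mul_lt_top hRt.lt_top hf.2

lemma L2Bound.swap {d : ℕ} {B : ℝ≥0∞}
    {K : EuclideanSpace ℝ (Fin d) → EuclideanSpace ℝ (Fin d) → ℂ} (h : L2Bound B K)
    (hK : Measurable (Function.uncurry K)) {M : ℝ} (hM : ∀ x y, ‖K x y‖ ≤ M) {R : ℝ≥0∞}
    (hRt : R ≠ ∞) (hR : ∀ x, ∫⁻ y, ‖K x y‖ₑ ≤ R) (hC : ∀ y, ∫⁻ x, ‖K x y‖ₑ ≤ R) :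
    L2Bound B (fun x y => K y x) := by
  rintro f hf ⟨N, hN⟩
  have := lintegral_rpow_le_of_dual (K := fun x y => K y x) (hK.comp measurable_swap)
    (fun x y => hM y x) hf (integrable_kint_of_col (K := fun x y => K y x)
      (hK.comp measurable_swap) hRt hR hf)
    (norm_kint_le_of_row (K := fun x y => K y x) hRt hC hN) le_rfl Real.HolderConjugate.two_two
    (C := B) (fun g hg hgN _ => by simpa only [ENNReal.rpow_ofNat] using h g hg hgN)
  norm_num at this
  exact this

lemma lintegral_rpow_le_of_hormander {d : ℕ} (hd : 0 < d)
    {K : EuclideanSpace ℝ (Fin d) → EuclideanSpace ℝ (Fin d) → ℂ}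
    (hK : Measurable (Function.uncurry K)) (hM : ∃ M : ℝ, ∀ x y, ‖K x y‖ ≤ M) {B : ℝ} (hB : 0 < B)
    (hH : ∀ (r : ℝ) (y y' : EuclideanSpace ℝ (Fin d)), dist y y' ≤ r →
      ∫⁻ x in (Metric.ball y' (2 * r))ᶜ, ‖K x y - K x y'‖ₑ ≤ ENNReal.ofReal B)
    (hL : L2Bound (ENNReal.ofReal B ^ 2) K) {F : EuclideanSpace ℝ (Fin d) → ℂ}
    (hFc : Continuous F) (hF : Integrable F) {p : ℝ} (hp : 1 < p) (hp2 : p < 2) :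
    ∫⁻ x, ‖kint K F x‖ₑ ^ p ≤ ENNReal.ofReal B ^ p * (czLp d p * ∫⁻ x, ‖F x‖ₑ ^ p) := by
  have hk : ∀ f, kint (fun x y => (B : ℂ)⁻¹ * K x y) f = fun x => (B : ℂ)⁻¹ * kint K f x := by
    intro f
    funext x
    rw [kint, kint, ← integral_const_mul]
    simp_rw [mul_assoc]
  have hb0 : ENNReal.ofReal B ≠ 0 := by simpa using hB
  have he : ‖(B : ℂ)⁻¹‖ₑ = (ENNReal.ofReal B)⁻¹ := by
    rw [← ofReal_norm, norm_inv, Complex.norm_real, Real.norm_of_nonneg hB.le,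
      ENNReal.ofReal_inv_of_pos hB]
  have hcz : IsCZ (fun x y => (B : ℂ)⁻¹ * K x y) := by
    refine ⟨hK.const_mul _, ?_, ?_, ?_⟩
    · obtain ⟨M, hM⟩ := hM
      refine ⟨‖(B : ℂ)⁻¹‖ * M, fun x y => ?_⟩
      rw [norm_mul]
      gcongr
      exact hM x y
    · intro r y y' hr
      simp_rw [← mul_sub, enorm_mul, he]
      rw [lintegral_const_mul' _ _ (by finiteness), mul_comm, ← div_eq_mul_inv]
      exact ENNReal.div_le_of_le_mul (by rw [one_mul]; exact hH r y y' hr)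
    · intro f hf hN
      rw [hk]
      simp_rw [enorm_mul, he, mul_pow]
      rw [lintegral_const_mul' _ _ (by finiteness), ← ENNReal.inv_pow, mul_comm, ← div_eq_mul_inv]
      exact ENNReal.div_le_of_le_mul (by rw [mul_comm]; exact hL f hf hN)
  have := hcz.lintegral_rpow_le_of_lt_two hd hFc hF hp hp2
  rw [hk] at this
  simp_rw [enorm_mul, he, ENNReal.mul_rpow_of_nonneg _ _ (zero_le_one.trans hp.le)] at this
  rw [lintegral_const_mul' _ _ (by
    refine ENNReal.rpow_ne_top_of_nonneg (by linarith) (by finiteness))] at this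
  calc _ = ENNReal.ofReal B ^ p * (((ENNReal.ofReal B)⁻¹) ^ p * ∫⁻ x, ‖kint K F x‖ₑ ^ p) := by
        rw [← mul_assoc, ← ENNReal.mul_rpow_of_nonneg _ _ (zero_le_one.trans hp.le),
          ENNReal.mul_inv_cancel hb0 ofReal_ne_top, ENNReal.one_rpow, one_mul]
    _ ≤ _ := by gcongr

/-- Calderón–Zygmund bounds for a finite sum of kernels at different dyadic scales. -/
lemma exists_lintegral_rpow_sum_le {d : ℕ} (hd : 0 < d) {δ : ℝ} (hδ : 0 < δ) {p : ℝ} (hp : 1 < p) :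
    ∃ C : ℝ≥0∞, C ≠ ∞ ∧ ∀ (A : ℝ), 0 < A → ∀ (J : Finset ℕ)
      (k : ℕ → EuclideanSpace ℝ (Fin d) → EuclideanSpace ℝ (Fin d) → ℂ),
      (∀ j ∈ J, ScaledKernel δ (2 ^ j) (ENNReal.ofReal A) (k j)) →
      ((∀ F : SchwartzMap (EuclideanSpace ℝ (Fin d)) ℂ,
        sqNorm (kint (fun x y => ∑ j ∈ J, k j x y) F) ≤ ENNReal.ofReal A ^ 2 * sqNorm F) ∨
      (∀ F : SchwartzMap (EuclideanSpace ℝ (Fin d)) ℂ,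
        sqNorm (kint (fun x y => ∑ j ∈ J, k j y x) F) ≤ ENNReal.ofReal A ^ 2 * sqNorm F)) →
      ∀ F : EuclideanSpace ℝ (Fin d) → ℂ, Continuous F → Integrable F →
      (∃ N : ℝ, ∀ x, ‖F x‖ ≤ N) → Continuous (kint (fun x y => ∑ j ∈ J, k j x y) F) →
      ∫⁻ x, ‖kint (fun x y => ∑ j ∈ J, k j x y) F x‖ₑ ^ p ≤
        C * ENNReal.ofReal A ^ p * ∫⁻ x, ‖F x‖ₑ ^ p := by
  set S := ∑' i : ℤ, hterm δ i with hS
  have hSt : S ≠ ∞ := tsum_hterm_ne_top hδ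
  set c : ℝ := 1 + S.toReal with hc
  have hc1 : 1 ≤ c := by simp [hc]
  have hSc : S ≤ ENNReal.ofReal c := by
    rw [← ENNReal.ofReal_toReal hSt]; exact ENNReal.ofReal_le_ofReal (by simp [hc])
  have hct : ∀ q : ℝ, 0 ≤ q → ENNReal.ofReal c ^ q ≠ ∞ := fun q hq =>
    ENNReal.rpow_ne_top_of_nonneg hq ofReal_ne_top
  -- facts about kernels
  have key : ∀ (A : ℝ), 0 < A → ∀ (J : Finset ℕ)
      (k : ℕ → EuclideanSpace ℝ (Fin d) → EuclideanSpace ℝ (Fin d) → ℂ),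
      (∀ j ∈ J, ScaledKernel δ (2 ^ j) (ENNReal.ofReal A) (k j)) →
      Measurable (Function.uncurry fun x y => ∑ j ∈ J, k j x y) ∧
      (∃ M : ℝ, ∀ x y, ‖∑ j ∈ J, k j x y‖ ≤ M) ∧
      (∃ R : ℝ≥0∞, R ≠ ∞ ∧ (∀ x, ∫⁻ y, ‖∑ j ∈ J, k j x y‖ₑ ≤ R)) := by
    intro A hA J k h
    refine ⟨?_, ?_, ?_⟩
    · have := Finset.measurable_sum (f := fun j => Function.uncurry (k j)) J
        (fun j hj => (h j hj).meas)
      convert this using 2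
      simp [Function.uncurry]
    · have h2 : ∀ j, ∃ M : ℝ, j ∈ J → ∀ x y, ‖k j x y‖ ≤ M := fun j => by
        by_cases hj : j ∈ J
        · obtain ⟨M, hM⟩ := (h j hj).bdd
          exact ⟨M, fun _ => hM⟩
        · exact ⟨0, fun h => absurd h hj⟩
      choose M hM using h2
      exact ⟨∑ j ∈ J, M j, fun x y => (norm_sum_le _ _).trans
        (Finset.sum_le_sum fun j hj => hM j hj x y)⟩
    · refine ⟨∑ j ∈ J, ENNReal.ofReal A, by simp [ENNReal.mul_eq_top], fun x => ?_⟩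
      calc _ ≤ ∫⁻ y, ∑ j ∈ J, ‖k j x y‖ₑ := lintegral_mono fun y => enorm_sum_le _ _
        _ = ∑ j ∈ J, ∫⁻ y, ‖k j x y‖ₑ := lintegral_finsetSum' _ fun j hj =>
            ((h j hj).meas.comp measurable_prodMk_left).enorm.aemeasurable
        _ ≤ _ := by
            refine Finset.sum_le_sum fun j hj => le_trans (lintegral_mono fun y => ?_)
              ((h j hj).row x)
            exact le_mul_of_one_le_right' (one_le_wt hδ.le (by positivity) _ _)
  -- exponents below two
  have low : ∀ q : ℝ, 1 < q → q < 2 → ∀ (A : ℝ), 0 < A → ∀ (J : Finset ℕ)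
      (k : ℕ → EuclideanSpace ℝ (Fin d) → EuclideanSpace ℝ (Fin d) → ℂ),
      (∀ j ∈ J, ScaledKernel δ (2 ^ j) (ENNReal.ofReal A) (k j)) →
      L2Bound (ENNReal.ofReal A ^ 2) (fun x y => ∑ j ∈ J, k j x y) →
      ∀ F : EuclideanSpace ℝ (Fin d) → ℂ, Continuous F → Integrable F →
      ∫⁻ x, ‖kint (fun x y => ∑ j ∈ J, k j x y) F x‖ₑ ^ q ≤
        (ENNReal.ofReal A ^ q * ENNReal.ofReal c ^ q * czLp d q) * ∫⁻ x, ‖F x‖ₑ ^ q := by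
    intro q hq hq2 A hA J k h hL F hFc hF
    obtain ⟨hm, hb, -⟩ := key A hA J k h
    have hB : (0 : ℝ) < A * c := by positivity
    have := lintegral_rpow_le_of_hormander hd hm hb hB (fun r y y' hr =>
      (hormander_sum_le hδ J h hr).trans (by
        rw [ENNReal.ofReal_mul hA.le]; gcongr)) (fun f hf hN => (hL f hf hN).trans (by
        gcongr; nlinarith)) hFc hF hq hq2
    refine this.trans (le_of_eq ?_)
    rw [ENNReal.ofReal_mul hA.le, ENNReal.mul_rpow_of_nonneg _ _ (by linarith), mul_assoc, mul_assoc,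
      mul_assoc]
  have hL2 : ∀ (A : ℝ), 0 < A → ∀ (J : Finset ℕ)
      (k : ℕ → EuclideanSpace ℝ (Fin d) → EuclideanSpace ℝ (Fin d) → ℂ),
      (∀ j ∈ J, ScaledKernel δ (2 ^ j) (ENNReal.ofReal A) (k j)) →
      (∀ F : SchwartzMap (EuclideanSpace ℝ (Fin d)) ℂ,
        sqNorm (kint (fun x y => ∑ j ∈ J, k j x y) F) ≤ ENNReal.ofReal A ^ 2 * sqNorm F) →
      L2Bound (ENNReal.ofReal A ^ 2) (fun x y => ∑ j ∈ J, k j x y) ∧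
      L2Bound (ENNReal.ofReal A ^ 2) (fun x y => ∑ j ∈ J, k j y x) := by
    intro A hA J k h hS
    obtain ⟨hm, ⟨M, hb⟩, R, hRt, hR⟩ := key A hA J k h
    obtain ⟨-, -, R', hRt', hR'⟩ := key A hA J (fun j x y => k j y x) fun j hj => (h j hj).swap
    have hL : L2Bound (ENNReal.ofReal A ^ 2) (fun x y => ∑ j ∈ J, k j x y) := by
      rintro f hf ⟨N, hN⟩
      exact sqNorm_kint_le_of_schwartz hm hb hRt hR (by finiteness) hS hf hN
    refine ⟨hL, hL.swap hm hb (R := R ⊔ R') (by simp [hRt, hRt']) (fun x => (hR x).trans le_sup_left)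
      (fun y => (hR' y).trans le_sup_right)⟩
  have hq' := Real.HolderConjugate.conjExponent hp
  set q := p.conjExponent with hq
  refine ⟨1 ⊔ ENNReal.ofReal c ^ p * czLp d p ⊔ (ENNReal.ofReal c ^ q * czLp d q) ^ (p - 1), ?_, ?_⟩
  · have h1 := hct p (by linarith)
    have h2 := hct q hq'.symm.nonneg
    have h3 := czLp_ne_top d p
    have h4 := czLp_ne_top d q
    have h5 : (ENNReal.ofReal c ^ q * czLp d q) ^ (p - 1) ≠ ∞ :=
      ENNReal.rpow_ne_top_of_nonneg (by linarith) (by finiteness)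
    have h6 : ENNReal.ofReal c ^ p * czLp d p ≠ ∞ := by finiteness
    simp only [ne_eq, max_eq_top, not_or]
    exact ⟨⟨one_ne_top, h6⟩, h5⟩
  intro A hA J k h hor F hFc hF hFN hKc
  have hL : L2Bound (ENNReal.ofReal A ^ 2) (fun x y => ∑ j ∈ J, k j x y) ∧
      L2Bound (ENNReal.ofReal A ^ 2) (fun x y => ∑ j ∈ J, k j y x) := by
    rcases hor with hS | hS
    · exact hL2 A hA J k h hS
    · exact (hL2 A hA J (fun j x y => k j y x) (fun j hj => (h j hj).swap) hS).symm
  rcases lt_trichotomy p 2 with hp2 | rfl | hp2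
  · refine (low p hp hp2 A hA J k h hL.1 F hFc hF).trans ?_
    rw [mul_assoc (ENNReal.ofReal A ^ p), mul_comm (ENNReal.ofReal A ^ p)]
    exact mul_le_mul_left (mul_le_mul_left (le_sup_right.trans le_sup_left) _) _
  · have := hL.1 F hF hFN
    simp only [ENNReal.rpow_ofNat]
    refine this.trans ?_
    gcongr
    refine le_mul_of_one_le_left' (le_sup_left.trans le_sup_left)
  · obtain ⟨hm, ⟨M, hb⟩, R, hRt, hR⟩ := key A hA J k h
    obtain ⟨-, -, R', hRt', hR'⟩ := key A hA J (fun j x y => k j y x) fun j hj => (h j hj).swap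
    obtain ⟨N, hN⟩ := hFN
    have hq1 : 1 < q := hq'.symm.lt
    have hq2 : q < 2 := by
      rw [hq, Real.conjExponent, div_lt_iff₀ (by linarith)]; linarith
    have := lintegral_rpow_le_of_dual hm hb hF (integrable_kint_of_col hm hRt' hR' hF)
      (norm_kint_le_of_row hRt hR hN) hp2.le hq' (C := ENNReal.ofReal A ^ q * ENNReal.ofReal c ^ q *
        czLp d q) (fun g hg _ hc => low q hq1 hq2 A hA J (fun j x y => k j y x)
        (fun j hj => (h j hj).swap) hL.2 g (hc hKc) hg)
    refine this.trans ?_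
    gcongr
    rw [mul_assoc, ENNReal.mul_rpow_of_nonneg _ _ (by linarith), ← ENNReal.rpow_mul,
      show q * (p - 1) = p by rw [hq, Real.conjExponent]; field_simp [(by linarith : p - 1 ≠ 0)], mul_comm]
    gcongr
    exact le_sup_right

/-- The Euclidean space of dimension `d`. -/
abbrev Eu (d : ℕ) := EuclideanSpace ℝ (Fin d)

/-- A kernel concentrated at scale `1 / ρ` in the sense of Schur's test. -/
structure SchurKernel {d : ℕ} (δ ρ : ℝ) (A : ℝ≥0∞) (k : Eu d → Eu d → ℂ) : Prop where
  meas : Measurable (Function.uncurry k)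
  bdd : ∃ M : ℝ, ∀ x y, ‖k x y‖ ≤ M
  col : ∀ y, ∫⁻ x, ‖k x y‖ₑ * wt δ ρ x y ≤ A
  row : ∀ x, ∫⁻ y, ‖k x y‖ₑ * wt δ ρ x y ≤ A

/-- Lipschitz dependence of a kernel on its first variable. -/
def LipRow {d : ℕ} (ρ : ℝ) (A : ℝ≥0∞) (k : Eu d → Eu d → ℂ) : Prop :=
  ∀ x x', ∫⁻ y, ‖k x y - k x' y‖ₑ ≤ A * ENNReal.ofReal (ρ * dist x x')

/-- Composition of kernels. -/
def kcomp {d : ℕ} (a b : Eu d → Eu d → ℂ) (x y : Eu d) : ℂ := ∫ z, a x z * b z y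

lemma kcomp_swap {d : ℕ} (a b : Eu d → Eu d → ℂ) :
    (fun x y => kcomp a b y x) = kcomp (fun x y => b y x) (fun x y => a y x) := by
  funext x y
  simp only [kcomp, mul_comm]

lemma wt_mul_le {d : ℕ} {δ ρ : ℝ} (hδ : 0 ≤ δ) (hρ : 0 ≤ ρ) (x y z : Eu d) :
    wt δ ρ x y ≤ wt δ ρ x z * wt δ ρ z y := by
  have h0 := dist_nonneg (x := x) (y := y)
  have h1 := dist_nonneg (x := x) (y := z)
  have h2 := dist_nonneg (x := z) (y := y)
  rw [wt, wt, wt, ← ENNReal.ofReal_mul (by positivity), ← Real.mul_rpow (by positivity) (by positivity)]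
  refine ENNReal.ofReal_le_ofReal (Real.rpow_le_rpow (by positivity) ?_ hδ)
  have := mul_le_mul_of_nonneg_left (dist_triangle x z y) hρ
  nlinarith [mul_nonneg (mul_nonneg hρ h1) (mul_nonneg hρ h2)]

namespace SchurKernel

variable {d : ℕ} {δ ρ : ℝ} {A B : ℝ≥0∞} {a b : Eu d → Eu d → ℂ}

lemma swap (h : SchurKernel δ ρ A a) : SchurKernel δ ρ A (fun x y => a y x) where
  meas := h.meas.comp measurable_swap
  bdd := h.bdd.imp fun M hM x y => hM y x
  col y := by simpa only [wt_comm δ ρ y] using h.row y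
  row x := by simpa only [wt_comm δ ρ _ x] using h.col x

lemma lintegral_row_le (h : SchurKernel δ ρ A a) (hδ : 0 ≤ δ) (hρ : 0 ≤ ρ) (x : Eu d) :
    ∫⁻ y, ‖a x y‖ₑ ≤ A :=
  (lintegral_mono fun y => le_mul_of_one_le_right' (one_le_wt hδ hρ x y)).trans (h.row x)

lemma lintegral_col_le (h : SchurKernel δ ρ A a) (hδ : 0 ≤ δ) (hρ : 0 ≤ ρ) (y : Eu d) :
    ∫⁻ x, ‖a x y‖ₑ ≤ A :=
  h.swap.lintegral_row_le hδ hρ y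

lemma integrable_row (h : SchurKernel δ ρ A a) (hδ : 0 ≤ δ) (hρ : 0 ≤ ρ) (hA : A ≠ ∞) (x : Eu d) :
    Integrable (fun y => a x y) :=
  ⟨(h.meas.comp measurable_prodMk_left).aestronglyMeasurable,
    (h.lintegral_row_le hδ hρ x).trans_lt hA.lt_top⟩

lemma integrable_col (h : SchurKernel δ ρ A a) (hδ : 0 ≤ δ) (hρ : 0 ≤ ρ) (hA : A ≠ ∞) (y : Eu d) :
    Integrable (fun x => a x y) :=
  h.swap.integrable_row hδ hρ hA y

lemma integrable_kcomp (ha : SchurKernel δ ρ A a) (hb : SchurKernel δ ρ B b) (hδ : 0 ≤ δ)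
    (hρ : 0 ≤ ρ) (hB : B ≠ ∞) (x y : Eu d) : Integrable (fun z => a x z * b z y) := by
  obtain ⟨M, hM⟩ := ha.bdd
  exact integrable_kernel_mul ha.meas hM (hb.integrable_col hδ hρ hB y) x

lemma measurable_kcomp (ha : Measurable (Function.uncurry a)) (hb : Measurable (Function.uncurry b)) :
    Measurable (Function.uncurry (kcomp a b)) := by
  have hm : Measurable fun q : (Eu d × Eu d) × Eu d => a q.1.1 q.2 * b q.2 q.1.2 :=
    (ha.comp ((measurable_fst.comp measurable_fst).prodMk measurable_snd)).mul
      (hb.comp (measurable_snd.prodMk (measurable_snd.comp measurable_fst)))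
  exact (hm.stronglyMeasurable.integral_prod_right (ν := volume)).measurable

lemma enorm_kcomp_mul_le (a b : Eu d → Eu d → ℂ) (hδ : 0 ≤ δ) (hρ : 0 ≤ ρ) (x y : Eu d) :
    ‖kcomp a b x y‖ₑ * wt δ ρ x y ≤ ∫⁻ z, (‖a x z‖ₑ * wt δ ρ x z) * (‖b z y‖ₑ * wt δ ρ z y) := by
  have h1 : ‖kcomp a b x y‖ₑ * wt δ ρ x y ≤ (∫⁻ z, ‖a x z * b z y‖ₑ) * wt δ ρ x y :=
    mul_le_mul_left (enorm_integral_le_lintegral_enorm _) _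
  have h2 : (∫⁻ z, ‖a x z * b z y‖ₑ) * wt δ ρ x y = ∫⁻ z, ‖a x z * b z y‖ₑ * wt δ ρ x y :=
    (lintegral_mul_const' _ _ ofReal_ne_top).symm
  refine h1.trans (h2.trans_le (lintegral_mono fun z => ?_))
  rw [enorm_mul, mul_mul_mul_comm]
  exact mul_le_mul_right (wt_mul_le hδ hρ x y z) _

lemma comp_col (ha : SchurKernel δ ρ A a) (hb : SchurKernel δ ρ B b) (hδ : 0 ≤ δ)
    (hρ : 0 ≤ ρ) (hA : A ≠ ∞) (y : Eu d) : ∫⁻ x, ‖kcomp a b x y‖ₑ * wt δ ρ x y ≤ A * B := by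
  set f : Eu d → Eu d → ℝ≥0∞ := fun x z => ‖a x z‖ₑ * wt δ ρ x z with hf
  set g : Eu d → ℝ≥0∞ := fun z => ‖b z y‖ₑ * wt δ ρ z y with hg
  have hfm : Measurable (Function.uncurry f) := ha.meas.enorm.mul (measurable_wt δ ρ)
  have hb' : Measurable fun z => b z y := hb.meas.comp measurable_prodMk_right
  have hw' : Measurable fun z => wt δ ρ z y := by unfold wt; fun_prop
  have hgm : Measurable g := hb'.enorm.mul hw'
  have hm : Measurable (Function.uncurry fun x z => f x z * g z) :=
    hfm.mul (hgm.comp measurable_snd)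
  have h1 : ∫⁻ x, ‖kcomp a b x y‖ₑ * wt δ ρ x y ≤ ∫⁻ x, ∫⁻ z, f x z * g z :=
    lintegral_mono fun x => enorm_kcomp_mul_le a b hδ hρ x y
  have h2 : ∫⁻ x, ∫⁻ z, f x z * g z = ∫⁻ z, ∫⁻ x, f x z * g z :=
    lintegral_lintegral_swap hm.aemeasurable
  have h3 : ∫⁻ z, ∫⁻ x, f x z * g z ≤ ∫⁻ z, A * g z := by
    refine lintegral_mono fun z => ?_
    have h4 : Measurable fun x => f x z := hfm.comp measurable_prodMk_right
    dsimp only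
    rw [lintegral_mul_const _ h4]
    exact mul_le_mul_left (ha.col z) _
  have h5 : ∫⁻ z, A * g z = A * ∫⁻ z, g z := lintegral_const_mul' _ _ hA
  exact h1.trans (h2.le.trans (h3.trans (h5.le.trans (mul_le_mul_right (hb.col y) _))))

lemma comp (ha : SchurKernel δ ρ A a) (hb : SchurKernel δ ρ B b) (hδ : 0 ≤ δ)
    (hρ : 0 ≤ ρ) (hA : A ≠ ∞) (hB : B ≠ ∞) : SchurKernel δ ρ (A * B) (kcomp a b) where
  meas := measurable_kcomp ha.meas hb.meas
  bdd := by
    obtain ⟨M, hM⟩ := hb.bdd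
    refine ⟨(A * ENNReal.ofReal M).toReal, fun x y => ?_⟩
    have := norm_kint_le_of_row hA (ha.lintegral_row_le hδ hρ) (f := fun z => b z y)
      (fun z => hM z y) x
    exact this
  col := ha.comp_col hb hδ hρ hA
  row x := by
    have := hb.swap.comp_col ha.swap hδ hρ hB x
    rw [← kcomp_swap] at this
    rw [mul_comm A]
    simpa only [wt_comm δ ρ _ x] using this

lemma lipRow_comp (ha : SchurKernel δ ρ A a) (hb : SchurKernel δ ρ B b) (hδ : 0 ≤ δ)
    (hρ : 0 ≤ ρ) (hB : B ≠ ∞) {C : ℝ≥0∞} (hl : LipRow ρ C a) :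
    LipRow ρ (C * B) (kcomp a b) := by
  intro x x'
  have hm : Measurable fun q : Eu d × Eu d => ‖a x q.2 - a x' q.2‖ₑ * ‖b q.2 q.1‖ₑ :=
    (((ha.meas.comp measurable_prodMk_left).sub (ha.meas.comp measurable_prodMk_left)).enorm.comp
      measurable_snd).mul (hb.meas.comp measurable_swap).enorm
  calc ∫⁻ y, ‖kcomp a b x y - kcomp a b x' y‖ₑ ≤ ∫⁻ y, ∫⁻ z, ‖a x z - a x' z‖ₑ * ‖b z y‖ₑ := by
        refine lintegral_mono fun y => ?_
        rw [kcomp, kcomp, ← integral_sub (ha.integrable_kcomp hb hδ hρ hB x y)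
          (ha.integrable_kcomp hb hδ hρ hB x' y)]
        refine (enorm_integral_le_lintegral_enorm _).trans (le_of_eq ?_)
        simp_rw [← sub_mul, enorm_mul]
    _ = ∫⁻ z, ∫⁻ y, ‖a x z - a x' z‖ₑ * ‖b z y‖ₑ := lintegral_lintegral_swap hm.aemeasurable
    _ ≤ ∫⁻ z, ‖a x z - a x' z‖ₑ * B := by
        refine lintegral_mono fun z => ?_
        dsimp only
        rw [lintegral_const_mul' _ _ enorm_ne_top]
        gcongr
        exact hb.lintegral_row_le hδ hρ z
    _ = (∫⁻ z, ‖a x z - a x' z‖ₑ) * B := lintegral_mul_const' _ _ hB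
    _ ≤ _ := by
        rw [mul_right_comm]
        gcongr
        exact hl x x'

lemma comp_scaled (ha : SchurKernel δ ρ A a) (hb : SchurKernel δ ρ B b) (hδ : 0 ≤ δ)
    (hρ : 0 ≤ ρ) (hA : A ≠ ∞) (hB : B ≠ ∞) (hl : LipRow ρ A a) (hl' : LipRow ρ B (fun x y => b y x)) :
    ScaledKernel δ ρ (A * B) (kcomp a b) where
  meas := (ha.comp hb hδ hρ hA hB).meas
  bdd := (ha.comp hb hδ hρ hA hB).bdd
  col := (ha.comp hb hδ hρ hA hB).col
  row := (ha.comp hb hδ hρ hA hB).row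
  lipRow := ha.lipRow_comp hb hδ hρ hB hl
  lipCol y y' := by
    have := hb.swap.lipRow_comp ha.swap hδ hρ hA hl' y y'
    rw [← kcomp_swap] at this
    rw [mul_comm A]
    exact this

lemma kint_kcomp (ha : SchurKernel δ ρ A a) (hb : SchurKernel δ ρ B b) (hδ : 0 ≤ δ)
    (hρ : 0 ≤ ρ) (hB : B ≠ ∞) {f : Eu d → ℂ} (hf : Integrable f) :
    kint (kcomp a b) f = kint a (kint b f) := by
  funext x
  obtain ⟨M, hM⟩ := ha.bdd
  have hm : AEStronglyMeasurable (fun q : Eu d × Eu d => a x q.2 * b q.2 q.1 * f q.1)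
      (volume.prod volume) :=
    (((ha.meas.comp measurable_prodMk_left).comp measurable_snd).mul
      (hb.meas.comp measurable_swap)).aestronglyMeasurable.mul hf.aestronglyMeasurable.comp_fst
  have hinteg : Integrable (fun q : Eu d × Eu d => a x q.2 * b q.2 q.1 * f q.1)
      (volume.prod volume) := by
    refine ⟨hm, ?_⟩
    rw [hasFiniteIntegral_iff_enorm, lintegral_prod _ hm.enorm]
    calc _ ≤ ∫⁻ y, ENNReal.ofReal M * B * ‖f y‖ₑ := by
          refine lintegral_mono fun y => ?_
          simp_rw [enorm_mul]
          rw [lintegral_mul_const' _ _ enorm_ne_top]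
          gcongr
          calc ∫⁻ z, ‖a x z‖ₑ * ‖b z y‖ₑ ≤ ∫⁻ z, ENNReal.ofReal M * ‖b z y‖ₑ := by
                refine lintegral_mono fun z => ?_
                gcongr
                rw [← ofReal_norm]
                exact ENNReal.ofReal_le_ofReal (hM x z)
            _ = ENNReal.ofReal M * ∫⁻ z, ‖b z y‖ₑ := lintegral_const_mul' _ _ ofReal_ne_top
            _ ≤ _ := by gcongr; exact hb.lintegral_col_le hδ hρ y
      _ = ENNReal.ofReal M * B * ∫⁻ y, ‖f y‖ₑ := lintegral_const_mul' _ _ (by finiteness)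
      _ < ∞ := ENNReal.mul_lt_top (by finiteness) hf.2
  calc kint (kcomp a b) f x = ∫ y, ∫ z, a x z * b z y * f y := by
        rw [kint]
        congr 1; funext y
        rw [kcomp, ← integral_mul_const]
    _ = ∫ z, ∫ y, a x z * b z y * f y := integral_integral_swap hinteg
    _ = _ := by
        rw [kint]
        congr 1; funext z
        rw [kint, ← integral_const_mul]
        simp_rw [mul_assoc]

/-- Schur's test in `L²`. -/
lemma sqNorm_kint_le (ha : SchurKernel δ ρ A a) (hδ : 0 ≤ δ) (hρ : 0 ≤ ρ) (hA : A ≠ ∞)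
    {f : Eu d → ℂ} (hf : AEStronglyMeasurable f volume) :
    sqNorm (kint a f) ≤ A ^ 2 * sqNorm f := by
  have hmeas : ∀ x, AEMeasurable (fun y => ‖a x y‖ₑ) volume := fun x =>
    (ha.meas.comp measurable_prodMk_left).enorm.aemeasurable
  have hm2 : AEMeasurable (Function.uncurry fun x y => ‖a x y‖ₑ * ‖f y‖ₑ ^ 2)
      (volume.prod volume) := ha.meas.enorm.aemeasurable.mul (hf.comp_snd.enorm.pow_const 2)
  calc sqNorm (kint a f) ≤ ∫⁻ x, A * ∫⁻ y, ‖a x y‖ₑ * ‖f y‖ₑ ^ 2 := by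
        refine lintegral_mono fun x => ?_
        have hle : ‖kint a f x‖ₑ ≤ (∫⁻ y, ‖a x y‖ₑ) ^ (1 / 2 : ℝ) *
            (∫⁻ y, ‖a x y‖ₑ * ‖f y‖ₑ ^ 2) ^ (1 / 2 : ℝ) := by
          have h2 : ∀ t : ℝ≥0∞, (t ^ (1 / 2 : ℝ)) ^ (2 : ℝ) = t := fun t => by
            rw [← ENNReal.rpow_mul]; norm_num
          calc _ ≤ ∫⁻ y, ‖a x y * f y‖ₑ := enorm_integral_le_lintegral_enorm _
            _ = ∫⁻ y, ((fun y => ‖a x y‖ₑ ^ (1 / 2 : ℝ)) *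
                fun y => ‖a x y‖ₑ ^ (1 / 2 : ℝ) * ‖f y‖ₑ) y := by
                refine lintegral_congr fun y => ?_
                rw [Pi.mul_apply, enorm_mul, ← mul_assoc,
                  ← ENNReal.rpow_add_of_nonneg _ _ (by norm_num) (by norm_num)]
                norm_num
            _ ≤ _ := ENNReal.lintegral_mul_le_Lp_mul_Lq volume Real.HolderConjugate.two_two
                ((hmeas x).pow_const _) (((hmeas x).pow_const _).mul hf.enorm)
            _ = _ := by
                congr 2
                · exact lintegral_congr fun y => h2 _
                · refine lintegral_congr fun y => ?_
                  rw [ENNReal.mul_rpow_of_nonneg _ _ (by norm_num), h2, ENNReal.rpow_ofNat]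
        calc ‖kint a f x‖ₑ ^ 2 ≤ ((∫⁻ y, ‖a x y‖ₑ) ^ (1 / 2 : ℝ) *
              (∫⁻ y, ‖a x y‖ₑ * ‖f y‖ₑ ^ 2) ^ (1 / 2 : ℝ)) ^ 2 := by gcongr
          _ = (∫⁻ y, ‖a x y‖ₑ) * ∫⁻ y, ‖a x y‖ₑ * ‖f y‖ₑ ^ 2 := by
              have h3 : ∀ t : ℝ≥0∞, (t ^ (1 / 2 : ℝ)) ^ 2 = t := fun t => by
                rw [← ENNReal.rpow_ofNat, ← ENNReal.rpow_mul]; norm_num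
              rw [mul_pow, h3, h3]
          _ ≤ _ := by gcongr; exact ha.lintegral_row_le hδ hρ x
    _ = A * ∫⁻ x, ∫⁻ y, ‖a x y‖ₑ * ‖f y‖ₑ ^ 2 := lintegral_const_mul' _ _ hA
    _ = A * ∫⁻ y, ∫⁻ x, ‖a x y‖ₑ * ‖f y‖ₑ ^ 2 := by rw [lintegral_lintegral_swap hm2]
    _ ≤ A * ∫⁻ y, A * ‖f y‖ₑ ^ 2 := by
        gcongr with y
        have hm' : Measurable fun x => ‖a x y‖ₑ := (ha.meas.comp measurable_prodMk_right).enorm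
        rw [lintegral_mul_const _ hm']
        gcongr
        exact ha.lintegral_col_le hδ hρ y
    _ = _ := by rw [lintegral_const_mul' _ _ hA, ← mul_assoc, sq]

end SchurKernel

lemma ScaledKernel.schur {d : ℕ} {δ ρ : ℝ} {A : ℝ≥0∞} {k : Eu d → Eu d → ℂ}
    (h : ScaledKernel δ ρ A k) : SchurKernel δ ρ A k :=
  ⟨h.meas, h.bdd, h.col, h.row⟩

/-- Multiplying a kernel by a bounded function of the second variable. -/
lemma SchurKernel.mul_right {d : ℕ} {δ ρ : ℝ} {A : ℝ≥0∞} {k : Eu d → Eu d → ℂ}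
    (h : SchurKernel δ ρ A k) {m : Eu d → ℂ} (hm : Measurable m) {N : ℝ} (hN : ∀ x, ‖m x‖ ≤ N) :
    SchurKernel δ ρ (A * ENNReal.ofReal N) (fun x y => k x y * m y) := by
  have hb : ∀ x y, ‖k x y * m y‖ₑ * wt δ ρ x y ≤ ‖k x y‖ₑ * wt δ ρ x y * ENNReal.ofReal N := by
    intro x y
    rw [enorm_mul, mul_right_comm]
    gcongr
    rw [← ofReal_norm]
    exact ENNReal.ofReal_le_ofReal (hN y)
  refine ⟨h.meas.mul (hm.comp measurable_snd), ?_, fun y => ?_, fun x => ?_⟩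
  · obtain ⟨M, hM⟩ := h.bdd
    refine ⟨M * N, fun x y => ?_⟩
    rw [norm_mul]
    exact mul_le_mul (hM x y) (hN y) (norm_nonneg _) ((norm_nonneg _).trans (hM x y))
  · refine (lintegral_mono fun x => hb x y).trans ?_
    rw [lintegral_mul_const' _ _ ofReal_ne_top]
    gcongr
    exact h.col y
  · refine (lintegral_mono fun y => hb x y).trans ?_
    rw [lintegral_mul_const' _ _ ofReal_ne_top]
    gcongr
    exact h.row x

lemma LipRow.mul_right {d : ℕ} {ρ : ℝ} {A : ℝ≥0∞} {k : Eu d → Eu d → ℂ}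
    (h : LipRow ρ A k) {m : Eu d → ℂ} {N : ℝ} (hN : ∀ x, ‖m x‖ ≤ N) :
    LipRow ρ (A * ENNReal.ofReal N) (fun x y => k x y * m y) := by
  intro x x'
  calc _ ≤ ∫⁻ y, ‖k x y - k x' y‖ₑ * ENNReal.ofReal N := by
        refine lintegral_mono fun y => ?_
        rw [← sub_mul, enorm_mul]
        gcongr
        rw [← ofReal_norm]
        exact ENNReal.ofReal_le_ofReal (hN y)
    _ = (∫⁻ y, ‖k x y - k x' y‖ₑ) * ENNReal.ofReal N := lintegral_mul_const' _ _ ofReal_ne_top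
    _ ≤ _ := by
      rw [mul_right_comm]
      gcongr
      exact h x x'

/-- Complex-valued Schwartz functions on `ℝ^d`. -/
abbrev Sw (d : ℕ) := SchwartzMap (Eu d) ℂ

/-- The Fourier multiplier with real symbol `σ`. -/
def mult {d : ℕ} (σ : Eu d → ℝ) : Sw d →L[ℝ] Sw d := SchwartzMap.fourierMultiplierCLM ℂ σ

/-- The product of two Schwartz functions. -/
def prodS {d : ℕ} (f g : Sw d) : Sw d := SchwartzMap.pairing (ContinuousLinearMap.mul ℂ ℂ) f g

@[simp] lemma prodS_apply {d : ℕ} (f g : Sw d) (x : Eu d) : prodS f g x = f x * g x := by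
  simp [prodS, SchwartzMap.pairing_apply_apply]

lemma fourier_mult {d : ℕ} {σ : Eu d → ℝ} (hσ : σ.HasTemperateGrowth) (f : Sw d) (ξ : Eu d) :
    𝓕 (mult σ f) ξ = σ ξ * 𝓕 f ξ := by
  simp [mult, SchwartzMap.fourierMultiplierCLM_apply, SchwartzMap.smulLeftCLM_apply_apply hσ]

lemma ext_fourier {d : ℕ} {f g : Sw d} (h : ∀ ξ, 𝓕 f ξ = 𝓕 g ξ) : f = g := by
  have h1 : 𝓕 f = 𝓕 g := by ext ξ; exact h ξ
  have := congrArg (fun u : Sw d => 𝓕⁻ u) h1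
  simpa using this

lemma fourier_add_apply {d : ℕ} (f g : Sw d) (ξ : Eu d) : 𝓕 (f + g) ξ = 𝓕 f ξ + 𝓕 g ξ := by
  rw [FourierTransform.fourier_add]; rfl

lemma fourier_sub_apply {d : ℕ} (f g : Sw d) (ξ : Eu d) : 𝓕 (f - g) ξ = 𝓕 f ξ - 𝓕 g ξ := by
  have h : 𝓕 (f - g) = 𝓕 f - 𝓕 g :=
    map_sub (FourierTransform.fourierCLM ℂ (Sw d)) f g
  rw [h]; rfl

lemma fourier_sum_apply {d : ℕ} {ι : Type*} (J : Finset ι) (f : ι → Sw d) (ξ : Eu d) :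
    𝓕 (∑ j ∈ J, f j) ξ = ∑ j ∈ J, 𝓕 (f j) ξ := by
  have h : 𝓕 (∑ j ∈ J, f j) = ∑ j ∈ J, 𝓕 (f j) :=
    map_sum (FourierTransform.fourierCLM ℂ (Sw d)) f J
  rw [h, sum_apply]

lemma fourier_smul_apply {d : ℕ} (c : ℝ) (f : Sw d) (ξ : Eu d) :
    𝓕 (c • f) ξ = c * 𝓕 f ξ := by
  have h : 𝓕 (c • f) = c • 𝓕 f :=
    map_smul (FourierTransform.fourierCLM ℝ (Sw d)) c f
  rw [h]; simp

lemma mult_mult {d : ℕ} {σ τ : Eu d → ℝ} (hσ : σ.HasTemperateGrowth)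
    (hτ : τ.HasTemperateGrowth) (f : Sw d) :
    mult σ (mult τ f) = mult (fun ξ => σ ξ * τ ξ) f := by
  rw [mult, mult, mult, SchwartzMap.fourierMultiplierCLM_fourierMultiplierCLM_apply hσ hτ]
  rfl

lemma mult_eq_of_fourier {d : ℕ} {σ : Eu d → ℝ} (hσ : σ.HasTemperateGrowth) {f g : Sw d}
    (h : ∀ ξ, 𝓕 g ξ = σ ξ * 𝓕 f ξ) : mult σ f = g :=
  ext_fourier fun ξ => by rw [fourier_mult hσ, h]

lemma mult_congr {d : ℕ} {σ τ : Eu d → ℝ} (hσ : σ.HasTemperateGrowth)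
    (hτ : τ.HasTemperateGrowth) {f : Sw d} (h : ∀ ξ, 𝓕 f ξ ≠ 0 → σ ξ = τ ξ) :
    mult σ f = mult τ f := by
  refine mult_eq_of_fourier hσ fun ξ => ?_
  rw [fourier_mult hτ]
  by_cases h0 : 𝓕 f ξ = 0
  · simp [h0]
  · rw [h ξ h0]

lemma integrable_norm_sq {d : ℕ} (f : Sw d) : Integrable (fun x => ‖f x‖ ^ 2) := by
  have := (f.memLp (p := 2) (μ := volume)).integrable_norm_pow (by norm_num)
  simpa using this

lemma sqNorm_eq_ofReal {d : ℕ} (f : Sw d) :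
    sqNorm f = ENNReal.ofReal (∫ x, ‖f x‖ ^ 2) := by
  rw [ofReal_integral_eq_lintegral_ofReal (integrable_norm_sq f) (ae_of_all _ fun x => by positivity)]
  refine lintegral_congr fun x => ?_
  rw [ENNReal.ofReal_pow (norm_nonneg _), ofReal_norm]

lemma sqNorm_fourier {d : ℕ} (f : Sw d) : sqNorm (𝓕 f : Sw d) = sqNorm f := by
  rw [sqNorm_eq_ofReal, sqNorm_eq_ofReal, SchwartzMap.integral_norm_sq_fourier]

lemma enorm_ofReal_mul_sq (a : ℝ) (z : ℂ) :
    ‖(a : ℂ) * z‖ₑ ^ 2 = ENNReal.ofReal (a ^ 2) * ‖z‖ₑ ^ 2 := by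
  rw [enorm_mul, mul_pow, ← ofReal_norm (a : ℂ), ← ENNReal.ofReal_pow (norm_nonneg _)]
  simp

lemma sum_sqNorm_mult_le {d : ℕ} {ι : Type*} (J : Finset ι) {σ : ι → Eu d → ℝ}
    (hσ : ∀ j ∈ J, (σ j).HasTemperateGrowth) {C : ℝ}
    (h : ∀ ξ, ∑ j ∈ J, σ j ξ ^ 2 ≤ C) (f : Sw d) :
    ∑ j ∈ J, sqNorm (mult (σ j) f) ≤ ENNReal.ofReal C * sqNorm f := by
  calc ∑ j ∈ J, sqNorm (mult (σ j) f)
      = ∑ j ∈ J, ∫⁻ ξ, ‖𝓕 (mult (σ j) f) ξ‖ₑ ^ 2 :=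
        Finset.sum_congr rfl fun j _ => (sqNorm_fourier _).symm
    _ = ∑ j ∈ J, ∫⁻ ξ, ENNReal.ofReal (σ j ξ ^ 2) * ‖𝓕 f ξ‖ₑ ^ 2 :=
        Finset.sum_congr rfl fun j hj => lintegral_congr fun ξ => by
          rw [fourier_mult (hσ j hj), enorm_ofReal_mul_sq]
    _ = ∫⁻ ξ, ∑ j ∈ J, ENNReal.ofReal (σ j ξ ^ 2) * ‖𝓕 f ξ‖ₑ ^ 2 := by
        rw [lintegral_finsetSum']
        intro j hj
        have h1 : Measurable fun ξ => ENNReal.ofReal (σ j ξ ^ 2) :=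
          (((hσ j hj).1.continuous.pow 2).measurable).ennreal_ofReal
        have h2 : Measurable fun ξ => ‖𝓕 f ξ‖ₑ ^ 2 :=
          ((𝓕 f : Sw d).continuous.measurable.enorm).pow_const 2
        exact (h1.mul h2).aemeasurable
    _ ≤ ∫⁻ ξ, ENNReal.ofReal C * ‖𝓕 f ξ‖ₑ ^ 2 := by
        refine lintegral_mono fun ξ => ?_
        rw [← Finset.sum_mul, ← ENNReal.ofReal_sum_of_nonneg fun j _ => sq_nonneg _]
        gcongr
        exact h ξ
    _ = ENNReal.ofReal C * sqNorm f := by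
        rw [lintegral_const_mul']
        · exact congrArg _ (sqNorm_fourier f)
        · exact ENNReal.ofReal_ne_top

lemma sqNorm_mult_le {d : ℕ} {σ : Eu d → ℝ} (hσ : σ.HasTemperateGrowth) {C : ℝ}
    (h : ∀ ξ, σ ξ ^ 2 ≤ C) (f : Sw d) :
    sqNorm (mult σ f) ≤ ENNReal.ofReal C * sqNorm f := by
  simpa using sum_sqNorm_mult_le {0} (σ := fun _ : ℕ => σ) (by simpa using hσ) (by simpa using h) f

lemma sqNorm_sum_mult_le {d : ℕ} {ι : Type*} (J : Finset ι) {σ : ι → Eu d → ℝ}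
    (hσ : ∀ j ∈ J, (σ j).HasTemperateGrowth) {C : ℝ}
    (h : ∀ ξ, ∑ j ∈ J, σ j ξ ^ 2 ≤ C) (u : ι → Sw d) :
    sqNorm (∑ j ∈ J, mult (σ j) (u j) : Sw d) ≤ ENNReal.ofReal C * ∑ j ∈ J, sqNorm (u j) := by
  have hm : ∀ j, AEMeasurable (fun ξ => ‖𝓕 (u j) ξ‖ₑ ^ 2) := fun j =>
    (((𝓕 (u j) : Sw d).continuous.measurable.enorm).pow_const 2).aemeasurable
  calc sqNorm (∑ j ∈ J, mult (σ j) (u j) : Sw d)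
      = ∫⁻ ξ, ‖𝓕 (∑ j ∈ J, mult (σ j) (u j)) ξ‖ₑ ^ 2 := (sqNorm_fourier _).symm
    _ ≤ ∫⁻ ξ, ENNReal.ofReal C * ∑ j ∈ J, ‖𝓕 (u j) ξ‖ₑ ^ 2 := by
        refine lintegral_mono fun ξ => ?_
        rw [fourier_sum_apply, Finset.sum_congr rfl fun j hj => fourier_mult (hσ j hj) (u j) ξ]
        have h1 : ‖∑ j ∈ J, (σ j ξ : ℂ) * 𝓕 (u j) ξ‖ ^ 2 ≤ C * ∑ j ∈ J, ‖𝓕 (u j) ξ‖ ^ 2 := by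
          calc ‖∑ j ∈ J, (σ j ξ : ℂ) * 𝓕 (u j) ξ‖ ^ 2
              ≤ (∑ j ∈ J, |σ j ξ| * ‖𝓕 (u j) ξ‖) ^ 2 := by
                gcongr
                refine (norm_sum_le _ _).trans_eq (Finset.sum_congr rfl fun j _ => by simp)
            _ ≤ (∑ j ∈ J, |σ j ξ| ^ 2) * ∑ j ∈ J, ‖𝓕 (u j) ξ‖ ^ 2 :=
                Finset.sum_mul_sq_le_sq_mul_sq _ _ _
            _ ≤ _ := by
                gcongr
                simpa using h ξ
        have hC : 0 ≤ C := (Finset.sum_nonneg fun j _ => sq_nonneg _).trans (h 0)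
        have h2 := ENNReal.ofReal_le_ofReal h1
        rw [ENNReal.ofReal_pow (norm_nonneg _), ofReal_norm, ENNReal.ofReal_mul hC,
          ENNReal.ofReal_sum_of_nonneg fun j _ => by positivity] at h2
        refine h2.trans_eq ?_
        congr 1
        refine Finset.sum_congr rfl fun j _ => ?_
        rw [ENNReal.ofReal_pow (norm_nonneg _), ofReal_norm]
    _ = ENNReal.ofReal C * ∑ j ∈ J, sqNorm (u j) := by
        rw [lintegral_const_mul' _ _ ENNReal.ofReal_ne_top, lintegral_finsetSum' _ fun j _ => hm j]
        congr 1
        exact Finset.sum_congr rfl fun j _ => sqNorm_fourier (u j)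

lemma convolution_apply_eq {d : ℕ} (f g : Sw d) (x : Eu d) :
    SchwartzMap.convolution (ContinuousLinearMap.mul ℂ ℂ) f g x = ∫ t, f t * g (x - t) := by
  rw [SchwartzMap.convolution_apply]; rfl

lemma fourier_prodS {d : ℕ} (f g : Sw d) (ξ : Eu d) :
    𝓕 (prodS f g) ξ = ∫ t, 𝓕 f t * 𝓕 g (ξ - t) := by
  set c := SchwartzMap.convolution (ContinuousLinearMap.mul ℂ ℂ) (𝓕 f) (𝓕 g) with hc
  have h1 : 𝓕⁻ c = prodS f g := by
    ext x
    have e : ∀ u : Sw d, 𝓕⁻ u x = 𝓕 u (-x) := fun u => by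
      rw [SchwartzMap.fourierInv_coe, SchwartzMap.fourier_coe, Real.fourierInv_eq_fourier_neg]
    have e2 : ∀ u : Sw d, 𝓕 (𝓕 u : Sw d) (-x) = u x := fun u => by
      rw [← e]; simp
    rw [e, hc, SchwartzMap.fourier_convolution, SchwartzMap.pairing_apply_apply, e2, e2]
    simp
  rw [← h1, FourierTransform.fourier_fourierInv_eq, hc, convolution_apply_eq]

lemma fourier_prodS_eq_zero {d : ℕ} {f g : Sw d} {ξ : Eu d}
    (h : ∀ t, 𝓕 f t ≠ 0 → 𝓕 g (ξ - t) ≠ 0 → False) : 𝓕 (prodS f g) ξ = 0 := by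
  rw [fourier_prodS]
  refine integral_eq_zero_of_ae (ae_of_all _ fun t => ?_)
  by_contra h0
  exact h t (left_ne_zero_of_mul h0) (right_ne_zero_of_mul h0)

/-- `κ` is the convolution kernel of the multiplier with symbol `σ`. -/
def IsKernel {d : ℕ} (κ : Sw d) (σ : Eu d → ℝ) : Prop := ∀ ξ, 𝓕 κ ξ = σ ξ

lemma mult_apply_eq {d : ℕ} {κ : Sw d} {σ : Eu d → ℝ} (hσ : σ.HasTemperateGrowth)
    (h : IsKernel κ σ) (f : Sw d) (x : Eu d) : mult σ f x = ∫ y, κ (x - y) * f y := by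
  have h1 : mult σ f = SchwartzMap.convolution (ContinuousLinearMap.mul ℂ ℂ) κ f := by
    refine mult_eq_of_fourier hσ fun ξ => ?_
    rw [SchwartzMap.fourier_convolution, SchwartzMap.pairing_apply_apply, h ξ]
    rfl
  rw [h1, convolution_apply_eq, ← integral_sub_left_eq_self _ volume x]
  simp

lemma mult_eq_kint {d : ℕ} {κ : Sw d} {σ : Eu d → ℝ} (hσ : σ.HasTemperateGrowth)
    (h : IsKernel κ σ) (f : Sw d) : ⇑(mult σ f) = kint (fun x y => κ (x - y)) f := by
  funext x
  exact mult_apply_eq hσ h f x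

lemma lintegral_comp_smul {d : ℕ} {c : ℝ} (hc : 0 < c) {f : Eu d → ℝ≥0∞} (hf : Measurable f) :
    ∫⁻ x, f (c • x) = ENNReal.ofReal ((c ^ d)⁻¹) * ∫⁻ x, f x := by
  have h := Measure.map_addHaar_smul (volume : Measure (Eu d)) hc.ne'
  rw [← lintegral_map hf (measurable_const_smul c), h, lintegral_smul_measure]
  simp [abs_of_pos hc]

lemma enorm_sub_le_lintegral_fderiv {d : ℕ} (K : Sw d) (v h : Eu d) :
    ‖K (v + h) - K v‖ₑ ≤ ∫⁻ t in Ioc (0 : ℝ) 1, ‖fderiv ℝ K (v + t • h)‖ₑ * ‖h‖ₑ := by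
  have hd : ∀ t : ℝ, HasDerivAt (fun t : ℝ => K (v + t • h)) (fderiv ℝ K (v + t • h) h) t := by
    intro t
    have h1 : HasDerivAt (fun t : ℝ => v + t • h) h t := by
      simpa using ((hasDerivAt_id t).smul_const h).const_add v
    exact (K.differentiable.differentiableAt (x := v + t • h)).hasFDerivAt.comp_hasDerivAt t h1
  have hc : Continuous fun t : ℝ => fderiv ℝ K (v + t • h) h := by
    have : Continuous (fderiv ℝ K) := (K.smooth 1).continuous_fderiv (by norm_num)
    fun_prop
  have h2 := intervalIntegral.integral_eq_sub_of_hasDerivAt (a := 0) (b := 1)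
    (fun t _ => hd t) (hc.intervalIntegrable _ _)
  simp only [one_smul, zero_smul, add_zero] at h2
  rw [← h2, intervalIntegral.integral_of_le zero_le_one]
  refine (enorm_integral_le_lintegral_enorm _).trans (lintegral_mono fun t => ?_)
  exact ContinuousLinearMap.le_opENorm _ _

lemma lintegral_enorm_sub_le {d : ℕ} (K : Sw d) (h : Eu d) :
    ∫⁻ v, ‖K (v + h) - K v‖ₑ ≤ (∫⁻ v, ‖fderiv ℝ K v‖ₑ) * ‖h‖ₑ := by
  have hc : Continuous (fderiv ℝ K) := (K.smooth 1).continuous_fderiv (by norm_num)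
  calc ∫⁻ v, ‖K (v + h) - K v‖ₑ
      ≤ ∫⁻ v, ∫⁻ t in Ioc (0 : ℝ) 1, ‖fderiv ℝ K (v + t • h)‖ₑ * ‖h‖ₑ :=
        lintegral_mono fun v => enorm_sub_le_lintegral_fderiv K v h
    _ = ∫⁻ t in Ioc (0 : ℝ) 1, ∫⁻ v, ‖fderiv ℝ K (v + t • h)‖ₑ * ‖h‖ₑ := by
        rw [lintegral_lintegral_swap]
        refine Measurable.aemeasurable ?_
        have : Continuous fun z : Eu d × ℝ => fderiv ℝ K (z.1 + z.2 • h) := by fun_prop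
        exact (this.measurable.enorm).mul_const _
    _ = ∫⁻ t in Ioc (0 : ℝ) 1, (∫⁻ v, ‖fderiv ℝ K v‖ₑ) * ‖h‖ₑ := by
        refine lintegral_congr fun t => ?_
        rw [lintegral_mul_const' _ _ enorm_ne_top,
          lintegral_add_right_eq_self (fun v => ‖fderiv ℝ K v‖ₑ) (t • h)]
    _ = _ := by simp

/-- The symbol `σ` is even and its convolution kernel is concentrated at scale `1 / ρ`, with a
weight of order `w`. -/
structure Good {d : ℕ} (w A ρ : ℝ) (σ : Eu d → ℝ) : Prop where
  nonneg : 0 ≤ A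
  even : ∀ ξ, σ (-ξ) = σ ξ
  ker : ∃ κ : Sw d, IsKernel κ σ ∧
    ∫⁻ u, ‖κ u‖ₑ * ENNReal.ofReal ((1 + ρ * ‖u‖) ^ w) ≤ ENNReal.ofReal A ∧
    ∀ h, ∫⁻ u, ‖κ (u + h) - κ u‖ₑ ≤ ENNReal.ofReal (A * (ρ * ‖h‖))

/-- The supremum of the Schwartz seminorms controlling the kernel bounds. -/
def kerSeminorm (d : ℕ) : Seminorm ℝ (Sw d) :=
  (Finset.Iic (d + 3, 1)).sup (fun m => SchwartzMap.seminorm ℝ m.1 m.2)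

lemma exists_lintegral_le_kerSeminorm (d : ℕ) : ∃ C : ℝ, 0 ≤ C ∧ ∀ K : Sw d,
    ∫⁻ u, ‖K u‖ₑ * ENNReal.ofReal ((1 + ‖u‖) ^ (2 : ℝ)) ≤ ENNReal.ofReal (C * kerSeminorm d K) ∧
    ∫⁻ u, ‖fderiv ℝ K u‖ₑ ≤ ENNReal.ofReal (C * kerSeminorm d K) := by
  set I := ∫⁻ x : Eu d, ENNReal.ofReal ((1 + ‖x‖) ^ (-((d : ℝ) + 1))) with hI
  have hIt : I < ∞ := finite_integral_one_add_norm (by simp)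
  have key : ∀ (K : Sw d) (x : Eu d) (n : ℕ), n ≤ 1 →
      ‖iteratedFDeriv ℝ n K x‖ * (1 + ‖x‖) ^ (2 : ℝ) ≤
        2 ^ (d + 3) * kerSeminorm d K * (1 + ‖x‖) ^ (-((d : ℝ) + 1)) := by
    intro K x n hn
    have h := SchwartzMap.one_add_le_sup_seminorm_apply (𝕜 := ℝ) (m := (d + 3, 1)) le_rfl hn K x
    have hp : 0 < 1 + ‖x‖ := by positivity
    have e : (1 + ‖x‖) ^ (2 : ℝ) = (1 + ‖x‖) ^ (d + 3) * (1 + ‖x‖) ^ (-((d : ℝ) + 1)) := by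
      rw [← Real.rpow_natCast, ← Real.rpow_add hp]
      congr 1
      push_cast; ring
    rw [e, ← mul_assoc, mul_comm ‖_‖]
    exact mul_le_mul_of_nonneg_right h (by positivity)
  have key2 : ∀ (K : Sw d) (n : ℕ), n ≤ 1 →
      ∫⁻ x, ENNReal.ofReal (‖iteratedFDeriv ℝ n K x‖ * (1 + ‖x‖) ^ (2 : ℝ)) ≤
        ENNReal.ofReal (2 ^ (d + 3) * I.toReal * kerSeminorm d K) := by
    intro K n hn
    have h0 : 0 ≤ 2 ^ (d + 3) * kerSeminorm d K := by positivity
    calc _ ≤ ∫⁻ x, ENNReal.ofReal (2 ^ (d + 3) * kerSeminorm d K) *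
          ENNReal.ofReal ((1 + ‖x‖) ^ (-((d : ℝ) + 1))) := by
          refine lintegral_mono fun x => ?_
          rw [← ENNReal.ofReal_mul h0]
          exact ENNReal.ofReal_le_ofReal (key K x n hn)
      _ = ENNReal.ofReal (2 ^ (d + 3) * kerSeminorm d K) * I :=
          lintegral_const_mul' _ _ ENNReal.ofReal_ne_top
      _ = _ := by
          rw [← ENNReal.ofReal_toReal hIt.ne, ← ENNReal.ofReal_mul h0]
          congr 1
          rw [ENNReal.ofReal_toReal hIt.ne]
          ring
  refine ⟨2 ^ (d + 3) * I.toReal, by positivity, fun K => ⟨?_, ?_⟩⟩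
  · refine le_trans (lintegral_mono fun x => ?_) (key2 K 0 zero_le_one)
    rw [ENNReal.ofReal_mul (norm_nonneg _), norm_iteratedFDeriv_zero, ofReal_norm]
  · refine le_trans (lintegral_mono fun x => ?_) (key2 K 1 le_rfl)
    rw [norm_iteratedFDeriv_one, ← ofReal_norm]
    refine ENNReal.ofReal_le_ofReal (le_mul_of_one_le_right (norm_nonneg _) ?_)
    exact Real.one_le_rpow (by linarith [norm_nonneg x]) (by norm_num)

/-- The `L¹`-normalised dilate of a Schwartz function. -/
def dilS {d : ℕ} (c : ℝ) (hc : c ≠ 0) (K : Sw d) : Sw d :=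
  (c ^ d) • SchwartzMap.compCLMOfContinuousLinearEquiv ℝ
    (ContinuousLinearEquiv.smulLeft (Units.mk0 c hc) : Eu d ≃L[ℝ] Eu d) K

lemma dilS_apply {d : ℕ} {c : ℝ} (hc : c ≠ 0) (K : Sw d) (x : Eu d) :
    dilS c hc K x = (c ^ d : ℝ) * K (c • x) := by
  simp [dilS, Units.smul_def]

lemma fourier_dilS {d : ℕ} {c : ℝ} (hc : 0 < c) (K : Sw d) (ξ : Eu d) :
    𝓕 (dilS c hc.ne' K) ξ = 𝓕 K (c⁻¹ • ξ) := by
  rw [SchwartzMap.fourier_coe, SchwartzMap.fourier_coe, Real.fourier_eq, Real.fourier_eq]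
  have h := Measure.integral_comp_smul (volume : Measure (Eu d))
    (fun v => Real.fourierChar (-(inner ℝ v (c⁻¹ • ξ))) • K v) c
  have e : ∀ v : Eu d, inner ℝ (c • v) (c⁻¹ • ξ) = inner ℝ v ξ := fun v => by
    rw [inner_smul_left, inner_smul_right, ← mul_assoc]
    simp [hc.ne']
  simp only [e] at h
  calc ∫ v, Real.fourierChar (-(inner ℝ v ξ)) • dilS c hc.ne' K v
      = ∫ v, (c ^ d : ℝ) • (Real.fourierChar (-(inner ℝ v ξ)) • K (c • v)) := by
        refine integral_congr_ae (ae_of_all _ fun v => ?_)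
        simp only [dilS_apply, Circle.smul_def, smul_eq_mul, Complex.real_smul]
        ring
    _ = _ := by
        rw [integral_smul, h, smul_smul]
        simp [abs_of_pos hc, hc.ne']

/-- Rescaling a kernel bound to scale `ρ`. -/
lemma good_of_kernel {d : ℕ} {A ρ : ℝ} (hρ : 0 < ρ) (hA : 0 ≤ A) {K : Sw d} {σ : Eu d → ℝ}
    (he : ∀ ξ, σ (-ξ) = σ ξ)
    (hK : ∀ ξ, 𝓕 K (ρ⁻¹ • ξ) = σ ξ)
    (h1 : ∫⁻ u, ‖K u‖ₑ * ENNReal.ofReal ((1 + ‖u‖) ^ (2 : ℝ)) ≤ ENNReal.ofReal A)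
    (h2 : ∫⁻ u, ‖fderiv ℝ K u‖ₑ ≤ ENNReal.ofReal A) : Good 2 A ρ σ := by
  have hc : ∀ z : ℂ, ‖((ρ ^ d : ℝ) : ℂ) * z‖ₑ = ENNReal.ofReal (ρ ^ d) * ‖z‖ₑ := by
    intro z
    rw [enorm_mul, ← ofReal_norm ((ρ ^ d : ℝ) : ℂ)]
    simp [abs_of_pos hρ]
  have hcc : ENNReal.ofReal (ρ ^ d) * ENNReal.ofReal ((ρ ^ d)⁻¹) = 1 := by
    rw [← ENNReal.ofReal_mul (by positivity), mul_inv_cancel₀ (by positivity), ENNReal.ofReal_one]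
  refine ⟨hA, he, dilS ρ hρ.ne' K, fun ξ => ?_, ?_, fun h => ?_⟩
  · rw [fourier_dilS hρ, hK]
  · have e : ∀ u : Eu d, ‖dilS ρ hρ.ne' K u‖ₑ * ENNReal.ofReal ((1 + ρ * ‖u‖) ^ (2 : ℝ)) =
        ENNReal.ofReal (ρ ^ d) *
          (fun v => ‖K v‖ₑ * ENNReal.ofReal ((1 + ‖v‖) ^ (2 : ℝ))) (ρ • u) := by
      intro u
      simp only [dilS_apply, hc, norm_smul, Real.norm_eq_abs, abs_of_pos hρ, mul_assoc]
    have hm : Measurable fun v : Eu d => ‖K v‖ₑ * ENNReal.ofReal ((1 + ‖v‖) ^ (2 : ℝ)) := by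
      have := K.continuous.measurable
      fun_prop
    rw [lintegral_congr e, lintegral_const_mul' _ _ ENNReal.ofReal_ne_top,
      lintegral_comp_smul hρ hm, ← mul_assoc, hcc, one_mul]
    exact h1
  · have e : ∀ u : Eu d, ‖dilS ρ hρ.ne' K (u + h) - dilS ρ hρ.ne' K u‖ₑ =
        ENNReal.ofReal (ρ ^ d) * (fun v => ‖K (v + ρ • h) - K v‖ₑ) (ρ • u) := by
      intro u
      simp only [dilS_apply, ← mul_sub, hc, smul_add]
    have hm : Measurable fun v : Eu d => ‖K (v + ρ • h) - K v‖ₑ := by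
      have := K.continuous.measurable
      fun_prop
    rw [lintegral_congr e, lintegral_const_mul' _ _ ENNReal.ofReal_ne_top,
      lintegral_comp_smul hρ hm, ← mul_assoc, hcc, one_mul, ENNReal.ofReal_mul hA]
    refine (lintegral_enorm_sub_le K (ρ • h)).trans ?_
    rw [← ofReal_norm, norm_smul, Real.norm_eq_abs, abs_of_pos hρ]
    gcongr

/-- A smooth family of profiles with uniformly compact support yields uniformly good symbols. -/
theorem exists_good {d : ℕ} {Φ : ℝ × Eu d → ℝ} (hΦ : ContDiff ℝ (⊤ : ℕ∞) Φ) {R : ℝ}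
    (hR : ∀ e η, R < ‖η‖ → Φ (e, η) = 0) (he : ∀ e η, Φ (e, -η) = Φ (e, η)) :
    ∃ A : ℝ, 0 < A ∧ ∀ e ∈ Icc (0 : ℝ) 1, ∀ ρ : ℝ, 0 < ρ →
      Good 2 A ρ (fun ξ => Φ (e, ρ⁻¹ • ξ)) := by
  have hs : ∀ e, ContDiff ℝ (⊤ : ℕ∞) (fun η : Eu d => (Φ (e, η) : ℂ)) := fun e =>
    Complex.ofRealCLM.contDiff.comp (hΦ.comp (contDiff_prodMk_right e))
  have hsupp : ∀ e, HasCompactSupport (fun η : Eu d => (Φ (e, η) : ℂ)) := fun e => by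
    refine HasCompactSupport.of_support_subset_isCompact (isCompact_closedBall (0 : Eu d) R) ?_
    intro η hη
    by_contra h
    simp only [Metric.mem_closedBall, dist_zero_right, not_le] at h
    exact hη (by simp [hR e η h])
  let τ : ℝ → Sw d := fun e => (hsupp e).toSchwartzMap (hs e)
  have hτ : ∀ e η, τ e η = Φ (e, η) := fun e η => rfl
  have hbdd : ∀ k n : ℕ, ∃ M : ℝ, ∀ e ∈ Icc (0 : ℝ) 1, SchwartzMap.seminorm ℝ k n (τ e) ≤ M := by
    intro k n
    set Ψ : ℝ × Eu d → ℂ := fun z => (Φ z : ℂ) with hΨ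
    have hΨs : ContDiff ℝ (⊤ : ℕ∞) Ψ := Complex.ofRealCLM.contDiff.comp hΦ
    have hcont : Continuous (iteratedFDeriv ℝ n Ψ) :=
      hΨs.continuous_iteratedFDeriv (by exact_mod_cast le_top)
    obtain ⟨M, hM⟩ := ((isCompact_Icc (a := (0 : ℝ)) (b := 1)).prod
      (isCompact_closedBall (0 : Eu d) (|R| + 1))).exists_bound_of_continuousOn hcont.continuousOn
    have hM0 : 0 ≤ M := (norm_nonneg _).trans (hM (0, 0) ⟨by simp, by simp; positivity⟩)
    refine ⟨(|R| + 1) ^ k * M, fun e he' => ?_⟩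
    refine SchwartzMap.seminorm_le_bound ℝ k n _ (by positivity) fun η => ?_
    by_cases hη : ‖η‖ ≤ |R| + 1
    · have h1 : ‖iteratedFDeriv ℝ n (τ e) η‖ ≤ ‖iteratedFDeriv ℝ n Ψ (e, η)‖ := by
        have e1 : (⇑(τ e)) = (fun z => Ψ ((e, 0) + z)) ∘ (ContinuousLinearMap.inr ℝ ℝ (Eu d)) := by
          funext z
          simp [hτ, hΨ]
        have h2 : ContDiff ℝ (⊤ : ℕ∞) (fun z : ℝ × Eu d => Ψ ((e, 0) + z)) := by fun_prop
        rw [e1, ContinuousLinearMap.iteratedFDeriv_comp_right _ h2 η (i := n)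
          (by exact_mod_cast le_top)]
        refine (ContinuousMultilinearMap.norm_compContinuousLinearMap_le _ _).trans ?_
        rw [iteratedFDeriv_comp_add_left]
        simp only [ContinuousLinearMap.inr_apply, Prod.mk_add_mk, add_zero, zero_add]
        refine mul_le_of_le_one_right (norm_nonneg _) ?_
        refine Finset.prod_le_one (fun _ _ => norm_nonneg _) fun _ _ => ?_
        exact ContinuousLinearMap.norm_inr_le_one ℝ ℝ (Eu d)
      have h2 := h1.trans (hM _ ⟨he', by simpa using hη⟩)
      gcongr
    · have h0 : iteratedFDeriv ℝ n (τ e) η = 0 := by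
        have hz : (⇑(τ e)) =ᶠ[𝓝 η] fun _ => 0 := by
          have : {z : Eu d | |R| + 1 < ‖z‖} ∈ 𝓝 η :=
            (isOpen_lt continuous_const continuous_norm).mem_nhds (not_le.1 hη)
          filter_upwards [this] with z hz
          rw [hτ, hR e z (by
            have hz' : |R| + 1 < ‖z‖ := hz
            linarith [le_abs_self R])]
          simp
        rw [(Filter.EventuallyEq.iteratedFDeriv hz (𝕜 := ℝ) n).eq_of_nhds]
        simp [iteratedFDeriv_fun_zero]
      rw [h0]
      simp
      positivity
  obtain ⟨C, hC0, hC⟩ := exists_lintegral_le_kerSeminorm d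
  have hq : Continuous (fun f : Sw d => kerSeminorm d (𝓕⁻ f)) := by
    have h1 : Continuous (kerSeminorm d) := by
      unfold kerSeminorm
      refine Seminorm.continuous_finsetSup fun m _ => ?_
      exact (schwartz_withSeminorms ℝ (Eu d) ℂ).continuous_seminorm m
    exact h1.comp (FourierTransform.fourierInvCLM ℝ (Sw d)).continuous
  obtain ⟨s, C', -, hC'⟩ := Seminorm.bound_of_continuous (schwartz_withSeminorms ℝ (Eu d) ℂ)
    ((kerSeminorm d).comp (FourierTransform.fourierInvCLM ℝ (Sw d)).toLinearMap) hq
  choose M hM using hbdd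
  set S : ℝ := ∑ m ∈ s, |M m.1 m.2| with hS
  have hsup : ∀ e ∈ Icc (0 : ℝ) 1, kerSeminorm d (𝓕⁻ (τ e)) ≤ C' * S := by
    intro e he'
    have h1 := hC' (τ e)
    refine le_trans h1 ?_
    rw [smul_apply, NNReal.smul_def, smul_eq_mul]
    gcongr
    refine Seminorm.finset_sup_apply_le (Finset.sum_nonneg fun _ _ => abs_nonneg _) fun m hm => ?_
    refine (hM m.1 m.2 e he').trans ((le_abs_self _).trans ?_)
    exact Finset.single_le_sum (f := fun m : ℕ × ℕ => |M m.1 m.2|) (fun _ _ => abs_nonneg _) hm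
  refine ⟨C * (C' * S) + 1, by positivity, fun e he' ρ hρ => ?_⟩
  have hle : ENNReal.ofReal (C * kerSeminorm d (𝓕⁻ (τ e))) ≤ ENNReal.ofReal (C * (C' * S) + 1) := by
    refine ENNReal.ofReal_le_ofReal ?_
    have := mul_le_mul_of_nonneg_left (hsup e he') hC0
    linarith
  refine good_of_kernel (K := 𝓕⁻ (τ e)) hρ (by positivity) (fun ξ => ?_) (fun ξ => ?_)
    ((hC _).1.trans hle) ((hC _).2.trans hle)
  · rw [smul_neg, he]
  · rw [FourierTransform.fourier_fourierInv_eq, hτ]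

section Good

variable {d : ℕ}

lemma Good.temperate {w A ρ : ℝ} {σ : Eu d → ℝ} (h : Good w A ρ σ) : σ.HasTemperateGrowth := by
  obtain ⟨κ, hκ, -⟩ := h.ker
  have e : σ = fun ξ => Complex.reCLM ((𝓕 κ : Sw d) ξ) := by
    funext ξ; rw [hκ ξ]; simp
  rw [e]
  exact Function.HasTemperateGrowth.comp (Complex.reCLM.hasTemperateGrowth)
    (SchwartzMap.hasTemperateGrowth _)

lemma Good.mono {w A B ρ : ℝ} {σ : Eu d → ℝ} (h : Good w A ρ σ) (hAB : A ≤ B) (hρ : 0 ≤ ρ) :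
    Good w B ρ σ := by
  obtain ⟨hA, he, κ, hκ, h1, h2⟩ := h
  refine ⟨hA.trans hAB, he, κ, hκ, h1.trans (ENNReal.ofReal_le_ofReal hAB), fun t =>
    (h2 t).trans (ENNReal.ofReal_le_ofReal ?_)⟩
  gcongr

lemma Good.weaken {w w' A ρ : ℝ} {σ : Eu d → ℝ} (h : Good w A ρ σ) (hw : w' ≤ w) (hρ : 0 ≤ ρ) :
    Good w' A ρ σ := by
  obtain ⟨hA, he, κ, hκ, h1, h2⟩ := h
  refine ⟨hA, he, κ, hκ, le_trans (lintegral_mono fun u => ?_) h1, h2⟩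
  gcongr
  have : 0 ≤ ρ * ‖u‖ := by positivity
  linarith

lemma Good.rescale {w A ρ ρ' : ℝ} {σ : Eu d → ℝ} (h : Good w A ρ σ) (hw : 0 ≤ w) (hρ : 0 < ρ)
    (hle : ρ ≤ ρ') : Good w (A * (ρ' / ρ) ^ w) ρ' σ := by
  obtain ⟨hA, he, κ, hκ, h1, h2⟩ := h
  have hr : 1 ≤ ρ' / ρ := (one_le_div hρ).2 hle
  have hr0 : 0 ≤ ρ' / ρ := zero_le_one.trans hr
  have hρ' : 0 < ρ' := hρ.trans_le hle
  refine ⟨by positivity, he, κ, hκ, ?_, fun t => (h2 t).trans (ENNReal.ofReal_le_ofReal ?_)⟩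
  · calc ∫⁻ u, ‖κ u‖ₑ * ENNReal.ofReal ((1 + ρ' * ‖u‖) ^ w)
        ≤ ∫⁻ u, (‖κ u‖ₑ * ENNReal.ofReal ((1 + ρ * ‖u‖) ^ w)) *
            ENNReal.ofReal ((ρ' / ρ) ^ w) := by
          refine lintegral_mono fun u => ?_
          rw [mul_assoc, ← ENNReal.ofReal_mul (by positivity), ← Real.mul_rpow (by positivity) hr0]
          gcongr
          have e : ρ' * ‖u‖ = ρ * ‖u‖ * (ρ' / ρ) := by field_simp
          rw [e, add_mul]
          linarith
      _ ≤ _ := by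
          rw [lintegral_mul_const' _ _ ENNReal.ofReal_ne_top, ENNReal.ofReal_mul hA]
          gcongr
  · have h3 : 1 ≤ (ρ' / ρ) ^ w := Real.one_le_rpow hr hw
    have h4 : A ≤ A * (ρ' / ρ) ^ w := le_mul_of_one_le_right hA h3
    gcongr

lemma Good.downscale {w A ρ ρ' : ℝ} {σ : Eu d → ℝ} (h : Good w A ρ σ) (hw : 0 ≤ w) (hρ' : 0 < ρ')
    (hle : ρ' ≤ ρ) : Good w (A * (ρ / ρ')) ρ' σ := by
  obtain ⟨hA, he, κ, hκ, h1, h2⟩ := h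
  have hr : 1 ≤ ρ / ρ' := (one_le_div hρ').2 hle
  have h4 : A ≤ A * (ρ / ρ') := le_mul_of_one_le_right hA hr
  refine ⟨hA.trans h4, he, κ, hκ, ?_, fun t => (h2 t).trans (ENNReal.ofReal_le_ofReal ?_)⟩
  · refine le_trans (lintegral_mono fun u => ?_) (h1.trans (ENNReal.ofReal_le_ofReal h4))
    gcongr
  · refine le_of_eq ?_
    field_simp

lemma Good.const_mul {w A ρ : ℝ} {σ : Eu d → ℝ} (h : Good w A ρ σ) (c : ℝ) :
    Good w (|c| * A) ρ (fun ξ => c * σ ξ) := by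
  obtain ⟨hA, he, κ, hκ, h1, h2⟩ := h
  have hc : ∀ z : ℂ, ‖(c : ℂ) * z‖ₑ = ENNReal.ofReal |c| * ‖z‖ₑ := fun z => by
    rw [enorm_mul, ← ofReal_norm (c : ℂ)]; simp
  refine ⟨by positivity, fun ξ => by rw [he], c • κ, fun ξ => ?_, ?_, fun t => ?_⟩
  · rw [fourier_smul_apply, hκ]; push_cast; ring
  · simp only [smul_apply, Complex.real_smul, hc, mul_assoc]
    rw [lintegral_const_mul' _ _ ENNReal.ofReal_ne_top, ENNReal.ofReal_mul (abs_nonneg _)]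
    gcongr
  · simp only [smul_apply, Complex.real_smul, ← mul_sub, hc]
    rw [lintegral_const_mul' _ _ ENNReal.ofReal_ne_top, mul_assoc |c|,
      ENNReal.ofReal_mul (abs_nonneg _)]
    gcongr
    exact h2 t

lemma Good.add {w A B ρ : ℝ} {σ τ : Eu d → ℝ} (h : Good w A ρ σ) (h' : Good w B ρ τ)
    (hρ : 0 ≤ ρ) : Good w (A + B) ρ (fun ξ => σ ξ + τ ξ) := by
  obtain ⟨hA, he, κ, hκ, h1, h2⟩ := h
  obtain ⟨hB, he', κ', hκ', h1', h2'⟩ := h'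
  have m1 : Measurable κ := κ.continuous.measurable
  have m2 : Measurable κ' := κ'.continuous.measurable
  refine ⟨by positivity, fun ξ => by rw [he, he'], κ + κ', fun ξ => ?_, ?_, fun t => ?_⟩
  · rw [fourier_add_apply, hκ, hκ']; push_cast; rfl
  · calc ∫⁻ u, ‖(κ + κ') u‖ₑ * ENNReal.ofReal ((1 + ρ * ‖u‖) ^ w)
        ≤ ∫⁻ u, (‖κ u‖ₑ * ENNReal.ofReal ((1 + ρ * ‖u‖) ^ w) +
            ‖κ' u‖ₑ * ENNReal.ofReal ((1 + ρ * ‖u‖) ^ w)) := by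
          refine lintegral_mono fun u => ?_
          rw [← add_mul]
          gcongr
          exact enorm_add_le _ _
      _ ≤ _ := by
          rw [lintegral_add_left (by fun_prop), ENNReal.ofReal_add hA hB]
          gcongr
  · calc ∫⁻ u, ‖(κ + κ') (u + t) - (κ + κ') u‖ₑ
        ≤ ∫⁻ u, (‖κ (u + t) - κ u‖ₑ + ‖κ' (u + t) - κ' u‖ₑ) := by
          refine lintegral_mono fun u => ?_
          have e : (κ + κ') (u + t) - (κ + κ') u = (κ (u + t) - κ u) + (κ' (u + t) - κ' u) := by
            simp only [add_apply]; ring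
          rw [e]
          exact enorm_add_le _ _
      _ ≤ _ := by
          rw [lintegral_add_left (by fun_prop), add_mul,
            ENNReal.ofReal_add (by positivity) (by positivity)]
          gcongr
          · exact h2 t
          · exact h2' t

lemma good_zero (w ρ : ℝ) : Good w 0 ρ (fun _ : Eu d => 0) :=
  ⟨le_rfl, fun _ => rfl, 0, fun ξ => by
    have : 𝓕 (0 : Sw d) = 0 := map_zero (FourierTransform.fourierCLM ℂ (Sw d))
    rw [this]; simp, by simp, by simp⟩

lemma Good.sum {ι : Type*} (J : Finset ι) {w ρ : ℝ} {A : ι → ℝ} {σ : ι → Eu d → ℝ}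
    (h : ∀ j ∈ J, Good w (A j) ρ (σ j)) (hρ : 0 ≤ ρ) :
    Good w (∑ j ∈ J, A j) ρ (fun ξ => ∑ j ∈ J, σ j ξ) := by
  classical
  induction J using Finset.induction_on with
  | empty => simpa using good_zero w ρ
  | insert j J hj ih =>
    simp only [Finset.sum_insert hj]
    exact (h j (by simp)).add (ih fun i hi => h i (by simp [hi])) hρ

lemma IsKernel.even {κ : Sw d} {σ : Eu d → ℝ} (h : IsKernel κ σ) (he : ∀ ξ, σ (-ξ) = σ ξ)
    (x : Eu d) : κ (-x) = κ x := by
  have h0 : ∀ z, κ z = ∫ v, Real.fourierChar (inner ℝ v z) • (σ v : ℂ) := fun z => by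
    have h1 : κ z = 𝓕⁻ (𝓕 κ : Sw d) z := by rw [FourierTransform.fourierInv_fourier_eq]
    rw [h1, SchwartzMap.fourierInv_coe, Real.fourierInv_eq]
    exact integral_congr_ae (ae_of_all _ fun v => by simp only [h v])
  rw [h0, h0, ← integral_neg_eq_self]
  simp [he]

/-- The kernel bounds for a good symbol. -/
lemma Good.exists_kernel {w δ A ρ : ℝ} {σ : Eu d → ℝ} (h : Good w A ρ σ)
    (hδw : δ ≤ w) (hρ : 0 < ρ) : ∃ κ : Sw d, IsKernel κ σ ∧ (∀ x, κ (-x) = κ x) ∧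
      ∫⁻ u, ‖κ u‖ₑ * ENNReal.ofReal ((1 + ρ * ‖u‖) ^ w) ≤ ENNReal.ofReal A ∧
      ScaledKernel δ ρ (ENNReal.ofReal A) (fun x y => κ (x - y)) := by
  obtain ⟨hA, he, κ, hκ, h1, h2⟩ := h
  have hev := hκ.even he
  have hm : Measurable κ := κ.continuous.measurable
  have hrow : ∀ x, ∫⁻ y, ‖κ (x - y)‖ₑ * wt δ ρ x y ≤ ENNReal.ofReal A := by
    intro x
    calc ∫⁻ y, ‖κ (x - y)‖ₑ * wt δ ρ x y
        = ∫⁻ y, (fun u => ‖κ u‖ₑ * ENNReal.ofReal ((1 + ρ * ‖u‖) ^ δ)) (x - y) := by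
          refine lintegral_congr fun y => ?_
          rw [wt, dist_eq_norm]
      _ = ∫⁻ u, ‖κ u‖ₑ * ENNReal.ofReal ((1 + ρ * ‖u‖) ^ δ) :=
          lintegral_sub_left_eq_self (fun u => ‖κ u‖ₑ * ENNReal.ofReal ((1 + ρ * ‖u‖) ^ δ)) x
      _ ≤ _ := by
          refine le_trans (lintegral_mono fun u => ?_) h1
          gcongr
          have : 0 ≤ ρ * ‖u‖ := by positivity
          linarith
  have hlip : ∀ x x', ∫⁻ y, ‖κ (x - y) - κ (x' - y)‖ₑ ≤
      ENNReal.ofReal A * ENNReal.ofReal (ρ * dist x x') := by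
    intro x x'
    calc ∫⁻ y, ‖κ (x - y) - κ (x' - y)‖ₑ
        = ∫⁻ y, (fun u => ‖κ (u + (x - x')) - κ u‖ₑ) (x' - y) := by
          refine lintegral_congr fun y => ?_
          simp only
          congr 3
          abel
      _ = ∫⁻ u, ‖κ (u + (x - x')) - κ u‖ₑ :=
          lintegral_sub_left_eq_self (fun u => ‖κ (u + (x - x')) - κ u‖ₑ) x'
      _ ≤ _ := by
          rw [← ENNReal.ofReal_mul hA, dist_eq_norm]
          exact h2 _
  have hsw : ∀ x y, κ (x - y) = κ (y - x) := fun x y => by rw [← hev, neg_sub]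
  refine ⟨κ, hκ, hev, h1, ?_, ?_, ?_, hrow, ?_, hlip⟩
  · exact hm.comp (measurable_fst.sub measurable_snd)
  · exact ⟨SchwartzMap.seminorm ℝ 0 0 κ, fun x y => SchwartzMap.norm_le_seminorm ℝ κ _⟩
  · intro y
    simp only [hsw _ y, wt_comm _ _ _ y]
    exact hrow y
  · intro y y'
    simp only [hsw _ y, hsw _ y']
    exact hlip y y'

lemma Good.abs_le {w A ρ : ℝ} {σ : Eu d → ℝ} (h : Good w A ρ σ) (hw : 0 ≤ w) (hρ : 0 ≤ ρ)
    (ξ : Eu d) : |σ ξ| ≤ A := by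
  obtain ⟨hA, he, κ, hκ, h1, h2⟩ := h
  have h3 : ∫⁻ u, ‖κ u‖ₑ ≤ ENNReal.ofReal A := by
    refine le_trans (lintegral_mono fun u => ?_) h1
    refine le_mul_of_one_le_right zero_le ?_
    rw [ENNReal.one_le_ofReal]
    exact Real.one_le_rpow (by have : 0 ≤ ρ * ‖u‖ := by positivity
                               linarith) hw
  have h4 : ‖(σ ξ : ℂ)‖ ≤ ∫ u, ‖κ u‖ := by
    rw [← hκ ξ, SchwartzMap.fourier_coe, Real.fourier_eq]
    refine (norm_integral_le_integral_norm _).trans_eq ?_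
    simp
  have h5 : ∫ u, ‖κ u‖ ≤ A := by
    rw [integral_norm_eq_lintegral_enorm κ.continuous.aestronglyMeasurable]
    exact ENNReal.toReal_le_of_le_ofReal hA h3
  simpa using h4.trans h5

end Good

section Symbols

variable {d : ℕ}

/-- A smooth radial cutoff, equal to `1` on the unit ball and supported in the ball of radius
`2`. -/
def phi (d : ℕ) (η : Eu d) : ℝ :=
  (ContDiffBump.mk 1 2 one_pos one_lt_two : ContDiffBump (0 : Eu d)) η

lemma contDiff_phi : ContDiff ℝ (⊤ : ℕ∞) (phi d) :=
  (ContDiffBump.mk 1 2 one_pos one_lt_two : ContDiffBump (0 : Eu d)).contDiff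

lemma phi_neg (η : Eu d) : phi d (-η) = phi d η := ContDiffBump.neg _ _

lemma phi_eq_one {η : Eu d} (h : ‖η‖ ≤ 1) : phi d η = 1 :=
  ContDiffBump.one_of_mem_closedBall _ (by simpa using h)

lemma phi_eq_zero {η : Eu d} (h : 2 ≤ ‖η‖) : phi d η = 0 :=
  ContDiffBump.zero_of_le_dist _ (by simpa using h)

lemma phi_nonneg (η : Eu d) : 0 ≤ phi d η := ContDiffBump.nonneg _

lemma phi_le_one (η : Eu d) : phi d η ≤ 1 := ContDiffBump.le_one _

/-- The cutoff to frequencies below `2 ^ n`. -/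
def chi (n : ℤ) (ξ : Eu d) : ℝ := phi d (((2 : ℝ) ^ n)⁻¹ • ξ)

lemma norm_inv_zpow_smul (n : ℤ) (ξ : Eu d) :
    ‖((2 : ℝ) ^ n)⁻¹ • ξ‖ = ‖ξ‖ / 2 ^ n := by
  rw [norm_smul, norm_inv, Real.norm_eq_abs, abs_of_pos (by positivity)]
  field_simp

lemma chi_eq_one {n : ℤ} {ξ : Eu d} (h : ‖ξ‖ ≤ 2 ^ n) : chi n ξ = 1 :=
  phi_eq_one (by rw [norm_inv_zpow_smul]; exact (div_le_one (by positivity)).2 h)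

lemma chi_eq_zero {n : ℤ} {ξ : Eu d} (h : 2 ^ (n + 1) ≤ ‖ξ‖) : chi n ξ = 0 := by
  refine phi_eq_zero ?_
  rw [norm_inv_zpow_smul, le_div_iff₀ (by positivity)]
  rwa [zpow_add_one₀ two_ne_zero, mul_comm] at h

lemma chi_neg (n : ℤ) (ξ : Eu d) : chi n (-ξ) = chi n ξ := by
  rw [chi, chi, smul_neg, phi_neg]

/-- The Littlewood-Paley cutoff to frequencies between `2 ^ (k - b)` and `2 ^ (k + a)`. -/
def ann (a b k : ℕ) (ξ : Eu d) : ℝ :=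
  if k = 0 then chi a ξ else chi (k + a) ξ - chi (k - b) ξ

/-- The symbol of the Bessel potential. -/
def jap (r : ℝ) (ξ : Eu d) : ℝ := (1 + 4 * Real.pi ^ 2 * ‖ξ‖ ^ 2) ^ (r / 2)

/-- The normalised, frequency localised symbol of the Bessel potential of order `r`. -/
def band (r : ℝ) (a b k : ℕ) (ξ : Eu d) : ℝ := ((2 : ℝ) ^ k) ^ (-r) * jap r ξ * ann a b k ξ

/-- The normalised symbol of the Bessel potential, restricted to low frequencies. -/
def low (r : ℝ) (n : ℕ) (ξ : Eu d) : ℝ := ((2 : ℝ) ^ n) ^ (-r) * jap r ξ * chi n ξ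

lemma jap_base_pos (ξ : Eu d) : 0 < 1 + 4 * Real.pi ^ 2 * ‖ξ‖ ^ 2 := by positivity

lemma jap_pos (r : ℝ) (ξ : Eu d) : 0 < jap r ξ := Real.rpow_pos_of_pos (jap_base_pos ξ) _

lemma jap_neg (r : ℝ) (ξ : Eu d) : jap r (-ξ) = jap r ξ := by simp [jap]

lemma jap_add (r t : ℝ) (ξ : Eu d) : jap (r + t) ξ = jap r ξ * jap t ξ := by
  rw [jap, jap, jap, ← Real.rpow_add (jap_base_pos ξ), add_div]

lemma jap_zero (ξ : Eu d) : jap 0 ξ = 1 := by simp [jap]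

lemma jap_temperate (r : ℝ) : (jap r : Eu d → ℝ).HasTemperateGrowth := by
  have h := Function.hasTemperateGrowth_one_add_norm_sq_rpow (Eu d) (r / 2)
  have h2 := h.comp ((2 * Real.pi) • ContinuousLinearMap.id ℝ (Eu d)).hasTemperateGrowth
  have e : (jap r : Eu d → ℝ) = (fun x : Eu d => (1 + ‖x‖ ^ 2) ^ (r / 2)) ∘
      ((2 * Real.pi) • ContinuousLinearMap.id ℝ (Eu d)) := by
    funext ξ
    simp only [jap, Function.comp, smul_apply, ContinuousLinearMap.id_apply,
      norm_smul, mul_pow]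
    congr 3
    simp [mul_pow, sq_abs]
    ring
  rw [e]
  exact h2

/-- Uniform bounds for annular symbols. -/
theorem exists_good_ann (r : ℝ) (a b : ℕ) {θ : Eu d → ℝ} (hθ : ∀ η, θ (-η) = θ η)
    (hs : ∀ η, η ≠ 0 → ContDiffAt ℝ (⊤ : ℕ∞) θ η) :
    ∃ A : ℝ, 0 < A ∧ ∀ k : ℕ, 1 ≤ k →
      Good 2 A (2 ^ k) (fun ξ : Eu d => ((2 : ℝ) ^ k) ^ (-r) * jap r ξ * ann a b k ξ *
        θ (((2 : ℝ) ^ k)⁻¹ • ξ)) := by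
  set P : Eu d → ℝ := fun η => phi d (((2 : ℝ) ^ a)⁻¹ • η) - phi d ((2 : ℝ) ^ b • η) with hP
  set Φ : ℝ × Eu d → ℝ := fun z =>
    (z.1 ^ 2 + 4 * Real.pi ^ 2 * ‖z.2‖ ^ 2) ^ (r / 2) * P z.2 * θ z.2 with hΦ
  have hPs : ContDiff ℝ (⊤ : ℕ∞) P :=
    (contDiff_phi.comp (contDiff_const_smul _)).sub (contDiff_phi.comp (contDiff_const_smul _))
  have hPR : ∀ η, 2 * (2 : ℝ) ^ a < ‖η‖ → P η = 0 := by
    intro η h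
    have h1 : phi d (((2 : ℝ) ^ a)⁻¹ • η) = 0 := by
      refine phi_eq_zero ?_
      rw [norm_smul, norm_inv, norm_pow, Real.norm_ofNat, inv_mul_eq_div,
        le_div_iff₀ (by positivity)]
      exact h.le
    have h2 : phi d ((2 : ℝ) ^ b • η) = 0 := by
      refine phi_eq_zero ?_
      rw [norm_smul, norm_pow, Real.norm_ofNat]
      have h3 : (1 : ℝ) ≤ 2 ^ a := one_le_pow₀ (by norm_num)
      have h4 : (1 : ℝ) ≤ 2 ^ b := one_le_pow₀ (by norm_num)
      nlinarith
    rw [hP]; simp [h1, h2]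
  have hP0 : ∀ η, ‖η‖ ≤ ((2 : ℝ) ^ b)⁻¹ → P η = 0 := by
    intro η h
    have h3 : (1 : ℝ) ≤ 2 ^ a := one_le_pow₀ (by norm_num)
    have h4 : (1 : ℝ) ≤ 2 ^ b := one_le_pow₀ (by norm_num)
    have h1 : phi d (((2 : ℝ) ^ a)⁻¹ • η) = 1 := by
      refine phi_eq_one ?_
      rw [norm_smul, norm_inv, norm_pow, Real.norm_ofNat, inv_mul_eq_div,
        div_le_one (by positivity)]
      exact h.trans ((inv_le_one_of_one_le₀ h4).trans h3)
    have h2 : phi d ((2 : ℝ) ^ b • η) = 1 := by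
      refine phi_eq_one ?_
      rw [norm_smul, norm_pow, Real.norm_ofNat]
      calc (2 : ℝ) ^ b * ‖η‖ ≤ 2 ^ b * (2 ^ b)⁻¹ := by gcongr
        _ = 1 := mul_inv_cancel₀ (by positivity)
    rw [hP]; simp [h1, h2]
  have hΦs : ContDiff ℝ (⊤ : ℕ∞) Φ := by
    rw [contDiff_iff_contDiffAt]
    rintro ⟨e, η⟩
    by_cases hη : η = 0
    · have hz : Φ =ᶠ[𝓝 (e, η)] fun _ => 0 := by
        have : {z : ℝ × Eu d | ‖z.2‖ < ((2 : ℝ) ^ b)⁻¹} ∈ 𝓝 (e, η) :=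
          (isOpen_lt (by fun_prop) continuous_const).mem_nhds (by
            simp only [mem_ofPred_eq, hη, norm_zero]; positivity)
        filter_upwards [this] with z hz
        have hz' : ‖z.2‖ < ((2 : ℝ) ^ b)⁻¹ := hz
        rw [hΦ]; simp [hP0 z.2 hz'.le]
      exact contDiffAt_const.congr_of_eventuallyEq hz
    · have hpos : 0 < ‖η‖ := norm_pos_iff.2 hη
      have h1 : ContDiffAt ℝ (⊤ : ℕ∞)
          (fun z : ℝ × Eu d => z.1 ^ 2 + 4 * Real.pi ^ 2 * ‖z.2‖ ^ 2) (e, η) :=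
        (contDiffAt_fst.pow 2).add (contDiffAt_const.mul (contDiffAt_snd.norm_sq ℝ))
      have h2 := h1.rpow_const_of_ne (p := r / 2) (by simp only; positivity)
      exact (h2.mul (hPs.contDiffAt.comp (e, η) contDiffAt_snd)).mul
        ((hs η hη).comp (e, η) contDiffAt_snd)
  obtain ⟨A, hA, hg⟩ := exists_good hΦs (R := 2 * 2 ^ a)
    (fun e η h => by rw [hΦ]; simp [hPR η h])
    (fun e η => by
      rw [hΦ, hP]; simp only [norm_neg, smul_neg, phi_neg, hθ])
  refine ⟨A, hA, fun k hk => ?_⟩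
  have hk0 : (0 : ℝ) < 2 ^ k := by positivity
  have h := hg ((2 : ℝ) ^ k)⁻¹ ⟨by positivity, inv_le_one_of_one_le₀ (one_le_pow₀ (by norm_num))⟩
    (2 ^ k) hk0
  have e : (fun ξ : Eu d => Φ (((2 : ℝ) ^ k)⁻¹, ((2 : ℝ) ^ k)⁻¹ • ξ)) =
      fun ξ : Eu d => ((2 : ℝ) ^ k) ^ (-r) * jap r ξ * ann a b k ξ * θ (((2 : ℝ) ^ k)⁻¹ • ξ) := by
    funext ξ
    have e1 : (((2 : ℝ) ^ k)⁻¹) ^ 2 + 4 * Real.pi ^ 2 * ‖((2 : ℝ) ^ k)⁻¹ • ξ‖ ^ 2 =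
        (((2 : ℝ) ^ k) ^ 2)⁻¹ * (1 + 4 * Real.pi ^ 2 * ‖ξ‖ ^ 2) := by
      rw [norm_smul, norm_inv, norm_pow, Real.norm_ofNat]
      field_simp
    have e2 : ((((2 : ℝ) ^ k) ^ 2)⁻¹) ^ (r / 2) = ((2 : ℝ) ^ k) ^ (-r) := by
      rw [← Real.rpow_natCast (2 ^ k) 2, ← Real.rpow_neg hk0.le, ← Real.rpow_mul hk0.le]
      congr 1
      push_cast; ring
    have e3 : P (((2 : ℝ) ^ k)⁻¹ • ξ) = ann a b k ξ := by
      rw [hP, ann, if_neg (by lia)]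
      simp only [chi, smul_smul]
      congr 3
      · rw [zpow_add₀ two_ne_zero, mul_inv, zpow_natCast, zpow_natCast, mul_comm]
      · rw [zpow_sub₀ two_ne_zero, zpow_natCast, zpow_natCast]; field_simp
    simp only [hΦ]
    rw [e1, e3, Real.mul_rpow (by positivity) (jap_base_pos ξ).le, e2]
    rfl
  rw [← e]
  exact h

theorem exists_good_chi (d : ℕ) : ∃ A : ℝ, 0 < A ∧ ∀ n : ℤ, Good 2 A (2 ^ n) (chi n : Eu d → ℝ) := by
  obtain ⟨A, hA, hg⟩ := exists_good (d := d) (Φ := fun z => phi d z.2)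
    (contDiff_phi.comp contDiff_snd) (R := 2) (fun e η h => phi_eq_zero h.le)
    (fun e η => phi_neg η)
  exact ⟨A, hA, fun n => hg 0 ⟨le_rfl, zero_le_one⟩ (2 ^ n) (by positivity)⟩

/-- Low frequency symbols. -/
theorem exists_good_base (r : ℝ) (a : ℕ) {θ : Eu d → ℝ} (hθ : ∀ η, θ (-η) = θ η)
    (hs : ContDiff ℝ (⊤ : ℕ∞) θ) :
    ∃ A : ℝ, 0 < A ∧ Good 2 A 1 (fun ξ : Eu d => jap r ξ * chi a ξ * θ ξ) := by
  have hj : ContDiff ℝ (⊤ : ℕ∞) (jap r : Eu d → ℝ) := (jap_temperate r).1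
  have hc : ContDiff ℝ (⊤ : ℕ∞) (chi a : Eu d → ℝ) :=
    contDiff_phi.comp (contDiff_const_smul _)
  obtain ⟨A, hA, hg⟩ := exists_good (d := d) (Φ := fun z => jap r z.2 * chi a z.2 * θ z.2)
    (((hj.mul hc).mul hs).comp contDiff_snd) (R := 2 ^ (a + 1))
    (fun e η h => by
      have h' : (2 : ℝ) ^ ((a : ℤ) + 1) ≤ ‖η‖ := by
        refine le_trans (le_of_eq ?_) h.le
        exact_mod_cast zpow_natCast (2 : ℝ) (a + 1)
      simp [chi_eq_zero h'])
    (fun e η => by simp only [jap_neg, chi_neg, hθ])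
  refine ⟨A, hA, ?_⟩
  simpa using hg 0 ⟨le_rfl, zero_le_one⟩ 1 one_pos

theorem exists_good_band (d : ℕ) (r : ℝ) (a b : ℕ) : ∃ A : ℝ, 0 < A ∧ ∀ k : ℕ,
    Good 2 A (2 ^ k) (band r a b k : Eu d → ℝ) := by
  obtain ⟨A, hA, hg⟩ := exists_good_ann (d := d) r a b (θ := fun _ => 1) (fun _ => rfl)
    (fun _ _ => contDiffAt_const)
  obtain ⟨B, hB, hg'⟩ := exists_good_base (d := d) r a (θ := fun _ => 1) (fun _ => rfl)
    contDiff_const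
  refine ⟨max A B, lt_max_of_lt_left hA, fun k => ?_⟩
  rcases Nat.eq_zero_or_pos k with rfl | hk
  · have h := hg'.mono (le_max_right A B) zero_le_one
    have e : (band r a b 0 : Eu d → ℝ) = fun ξ => jap r ξ * chi a ξ * 1 := by
      funext ξ; simp [band, ann]
    rw [e, pow_zero]
    exact h
  · have h := (hg k hk).mono (le_max_left A B) (by positivity)
    have e : (band r a b k : Eu d → ℝ) = fun ξ => ((2 : ℝ) ^ k) ^ (-r) * jap r ξ * ann a b k ξ * 1 := by
      funext ξ; simp [band]
    rw [e]
    exact h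

lemma ann_support {a b k : ℕ} (hk : 1 ≤ k) {ξ : Eu d} (h : ann a b k ξ ≠ 0) :
    (2 : ℝ) ^ k ≤ 2 ^ b * ‖ξ‖ ∧ ‖ξ‖ ≤ 2 ^ (a + 1) * 2 ^ k := by
  rw [ann, if_neg (by lia)] at h
  have e1 : (2 : ℝ) ^ ((k : ℤ) - b) = 2 ^ k / 2 ^ b := by
    rw [zpow_sub₀ two_ne_zero, zpow_natCast, zpow_natCast]
  have e2 : (2 : ℝ) ^ ((k : ℤ) + a + 1) = 2 ^ (a + 1) * 2 ^ k := by
    rw [← pow_add, ← zpow_natCast]; congr 1; push_cast; ring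
  have h1 : (1 : ℝ) ≤ 2 ^ a := one_le_pow₀ (by norm_num)
  have h2 : (1 : ℝ) ≤ 2 ^ b := one_le_pow₀ (by norm_num)
  have hk0 : (0 : ℝ) < 2 ^ k := by positivity
  constructor
  · by_contra hc
    push Not at hc
    refine h ?_
    have h3 : ‖ξ‖ ≤ 2 ^ ((k : ℤ) - b) := by
      rw [e1, le_div_iff₀ (by positivity), mul_comm]; exact hc.le
    have h4 : ‖ξ‖ ≤ 2 ^ ((k : ℤ) + a) :=
      h3.trans (zpow_le_zpow_right₀ (by norm_num) (by lia))
    rw [chi_eq_one h3, chi_eq_one h4, sub_self]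
  · by_contra hc
    push Not at hc
    refine h ?_
    have h3 : 2 ^ ((k : ℤ) + a + 1) ≤ ‖ξ‖ := by rw [e2]; exact hc.le
    have h4 : 2 ^ ((k : ℤ) - b + 1) ≤ ‖ξ‖ :=
      (zpow_le_zpow_right₀ (by norm_num) (by lia)).trans h3
    rw [chi_eq_zero h3, chi_eq_zero h4, sub_self]

lemma sum_sq_le_of_support {A : ℝ} {a b : ℕ} {σ : ℕ → Eu d → ℝ} (hσ : ∀ k ξ, |σ k ξ| ≤ A)
    (h : ∀ k ξ, 1 ≤ k → σ k ξ ≠ 0 → (2 : ℝ) ^ k ≤ 2 ^ b * ‖ξ‖ ∧ ‖ξ‖ ≤ 2 ^ (a + 1) * 2 ^ k)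
    (J : Finset ℕ) (ξ : Eu d) : ∑ k ∈ J, σ k ξ ^ 2 ≤ (a + b + 3) * A ^ 2 := by
  classical
  set I := J.filter (fun k => 1 ≤ k ∧ σ k ξ ≠ 0) with hI
  have hsq : ∀ k, σ k ξ ^ 2 ≤ A ^ 2 := fun k => by
    rw [← sq_abs]; exact pow_le_pow_left₀ (abs_nonneg _) (hσ k ξ) 2
  have hcard : I.card ≤ a + b + 2 := by
    rcases I.eq_empty_or_nonempty with h0 | hne
    · simp [h0]
    · set k0 := I.min' hne
      have hk0 : k0 ∈ I := Finset.min'_mem _ _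
      have hsub : I ⊆ Finset.Icc k0 (k0 + (a + b + 1)) := by
        intro k hk
        rw [Finset.mem_Icc]
        refine ⟨Finset.min'_le _ _ hk, ?_⟩
        have h1 := (h k ξ (Finset.mem_filter.1 hk).2.1 (Finset.mem_filter.1 hk).2.2).1
        have h2 := (h k0 ξ (Finset.mem_filter.1 hk0).2.1 (Finset.mem_filter.1 hk0).2.2).2
        have h3 : (2 : ℝ) ^ k ≤ 2 ^ (k0 + (a + b + 1)) := by
          calc (2 : ℝ) ^ k ≤ 2 ^ b * ‖ξ‖ := h1
            _ ≤ 2 ^ b * (2 ^ (a + 1) * 2 ^ k0) := by gcongr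
            _ = _ := by rw [← pow_add, ← pow_add]; congr 1; ring
        exact (pow_le_pow_iff_right₀ (by norm_num : (1 : ℝ) < 2)).1 h3
      refine (Finset.card_le_card hsub).trans ?_
      simp
      lia
  have hJ : ∑ k ∈ J, σ k ξ ^ 2 ≤ ∑ k ∈ insert 0 I, σ k ξ ^ 2 := by
    rw [← Finset.sum_filter_ne_zero]
    refine Finset.sum_le_sum_of_subset_of_nonneg (fun k hk => ?_) fun _ _ _ => sq_nonneg _
    obtain ⟨hk, h0⟩ := Finset.mem_filter.1 hk
    rw [Finset.mem_insert]
    by_cases hk0 : k = 0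
    · exact Or.inl hk0
    · exact Or.inr (Finset.mem_filter.2 ⟨hk, by lia, fun hz => h0 (by simp [hz])⟩)
  calc ∑ k ∈ J, σ k ξ ^ 2 ≤ ∑ k ∈ insert 0 I, σ k ξ ^ 2 := hJ
    _ ≤ (insert 0 I).card • A ^ 2 := Finset.sum_le_card_nsmul _ _ _ fun k _ => hsq k
    _ ≤ (a + b + 3) * A ^ 2 := by
      rw [nsmul_eq_mul]
      gcongr
      have h1 := (Finset.card_insert_le 0 I).trans (Nat.succ_le_succ hcard)
      exact_mod_cast h1

theorem exists_sum_band_sq_le (d : ℕ) (r : ℝ) (a b : ℕ) : ∃ C : ℝ, 0 < C ∧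
    ∀ (J : Finset ℕ) (ξ : Eu d), ∑ k ∈ J, band r a b k ξ ^ 2 ≤ C := by
  obtain ⟨A, hA, hg⟩ := exists_good_band d r a b
  refine ⟨(a + b + 3) * A ^ 2, by positivity, fun J ξ => ?_⟩
  refine sum_sq_le_of_support (fun k ξ => (hg k).abs_le (by norm_num) (by positivity) ξ)
    (fun k ξ hk h => ann_support hk (right_ne_zero_of_mul h)) J ξ

lemma sum_ann (n : ℕ) (ξ : Eu d) : ∑ j ∈ Finset.range (n + 1), ann 0 1 j ξ = chi n ξ := by
  induction n with
  | zero => simp [ann]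
  | succ n ih =>
    rw [Finset.sum_range_succ, ih, ann, if_neg (by lia)]
    push_cast
    simp

lemma low_eq_sum (r : ℝ) (n : ℕ) (ξ : Eu d) : low r n ξ =
    ∑ j ∈ Finset.range (n + 1), ((2 : ℝ) ^ (-r)) ^ (n - j) * band r 0 1 j ξ := by
  rw [low, ← sum_ann, Finset.mul_sum]
  refine Finset.sum_congr rfl fun j hj => ?_
  have hj' : j ≤ n := by simpa [Nat.lt_succ_iff] using hj
  have e : ((2 : ℝ) ^ n) ^ (-r) = ((2 : ℝ) ^ (-r)) ^ (n - j) * ((2 : ℝ) ^ j) ^ (-r) := by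
    rw [← Real.rpow_natCast, ← Real.rpow_natCast, ← Real.rpow_natCast, ← Real.rpow_mul (by norm_num),
      ← Real.rpow_mul (by norm_num), ← Real.rpow_mul (by norm_num), ← Real.rpow_add (by norm_num),
      Nat.cast_sub hj']
    congr 1
    ring
  rw [band, e]
  ring

lemma sum_geom_sub_le {q : ℝ} (h0 : 0 ≤ q) (h1 : q < 1) (n : ℕ) :
    ∑ j ∈ Finset.range (n + 1), q ^ (n - j) ≤ (1 - q)⁻¹ := by
  have h2 : ∑ j ∈ Finset.range (n + 1), q ^ (n - j) = ∑ j ∈ Finset.range (n + 1), q ^ j :=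
    Finset.sum_flip (fun j => q ^ j)
  have h3 := mul_neg_geom_sum q (n + 1)
  rw [h2, ← mul_le_mul_iff_right₀ (sub_pos.2 h1), h3, mul_inv_cancel₀ (sub_pos.2 h1).ne']
  linarith [pow_nonneg h0 (n + 1)]

lemma two_rpow_neg_lt_one {s : ℝ} (hs : 0 < s) : (2 : ℝ) ^ (-s) < 1 :=
  Real.rpow_lt_one_of_one_lt_of_neg (by norm_num) (by linarith)

/-- Discrete Young inequality for a geometric sequence. -/
lemma sum_sq_geom_conv_le {q : ℝ} (h0 : 0 ≤ q) (h1 : q < 1) (b : ℕ → ℝ) (N : ℕ) :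
    ∑ n ∈ Finset.range N, (∑ j ∈ Finset.range (n + 1), q ^ (n - j) * b j) ^ 2 ≤
      (1 - q)⁻¹ ^ 2 * ∑ j ∈ Finset.range N, b j ^ 2 := by
  have hpos : 0 ≤ (1 - q)⁻¹ := inv_nonneg.2 (sub_pos.2 h1).le
  have hcs : ∀ n, (∑ j ∈ Finset.range (n + 1), q ^ (n - j) * b j) ^ 2 ≤
      (1 - q)⁻¹ * ∑ j ∈ Finset.range (n + 1), q ^ (n - j) * b j ^ 2 := by
    intro n
    have h2 := Finset.sum_sq_le_sum_mul_sum_of_sq_le_mul (Finset.range (n + 1))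
      (r := fun j => q ^ (n - j) * b j) (f := fun j => q ^ (n - j))
      (g := fun j => q ^ (n - j) * b j ^ 2) (fun j _ => pow_nonneg h0 _)
      (fun j _ => mul_nonneg (pow_nonneg h0 _) (sq_nonneg _)) (fun j _ => le_of_eq (by ring))
    refine h2.trans ?_
    gcongr
    exact sum_geom_sub_le h0 h1 n
  calc ∑ n ∈ Finset.range N, (∑ j ∈ Finset.range (n + 1), q ^ (n - j) * b j) ^ 2
      ≤ ∑ n ∈ Finset.range N, (1 - q)⁻¹ * ∑ j ∈ Finset.range (n + 1), q ^ (n - j) * b j ^ 2 :=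
        Finset.sum_le_sum fun n _ => hcs n
    _ = (1 - q)⁻¹ * ∑ j ∈ Finset.range N, ∑ n ∈ Finset.Ico j N, q ^ (n - j) * b j ^ 2 := by
        rw [← Finset.mul_sum]
        congr 1
        refine Finset.sum_comm' fun n j => ?_
        simp only [Finset.mem_range, Finset.mem_Ico]
        lia
    _ ≤ (1 - q)⁻¹ * ∑ j ∈ Finset.range N, (1 - q)⁻¹ * b j ^ 2 := by
        gcongr with j hj
        rw [← Finset.sum_mul]
        gcongr
        rw [Finset.sum_Ico_eq_sum_range]
        simp only [Nat.add_sub_cancel_left]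
        have h3 := mul_neg_geom_sum q (N - j)
        rw [← mul_le_mul_iff_right₀ (sub_pos.2 h1), h3, mul_inv_cancel₀ (sub_pos.2 h1).ne']
        linarith [pow_nonneg h0 (N - j)]
    _ = _ := by rw [← Finset.mul_sum]; ring

theorem exists_sum_low_sq_le (d : ℕ) {s : ℝ} (hs : 0 < s) : ∃ C : ℝ, 0 < C ∧
    ∀ (J : Finset ℕ) (ξ : Eu d), ∑ k ∈ J, low s k ξ ^ 2 ≤ C := by
  obtain ⟨C, hC, h⟩ := exists_sum_band_sq_le d s 0 1
  have hq := two_rpow_neg_lt_one hs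
  have hq0 : (0 : ℝ) ≤ 2 ^ (-s) := by positivity
  have hpos := inv_pos.2 (sub_pos.2 hq)
  refine ⟨(1 - 2 ^ (-s))⁻¹ ^ 2 * C, by positivity, fun J ξ => ?_⟩
  have hJ : J ⊆ Finset.range (J.sup id + 1) := fun k hk => by
    rw [Finset.mem_range, Nat.lt_succ_iff]
    exact Finset.le_sup (f := id) hk
  refine (Finset.sum_le_sum_of_subset_of_nonneg hJ fun _ _ _ => sq_nonneg _).trans ?_
  simp only [low_eq_sum]
  refine (sum_sq_geom_conv_le hq0 hq _ _).trans ?_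
  gcongr
  exact h _ ξ

theorem exists_good_low (d : ℕ) {s δ : ℝ} (hδ : 0 ≤ δ) (hδs : δ < s) (hδ2 : δ ≤ 2) :
    ∃ A : ℝ, 0 < A ∧ ∀ n : ℕ, Good δ A (2 ^ n) (low s n : Eu d → ℝ) := by
  obtain ⟨A, hA, hg⟩ := exists_good_band d s 0 1
  have hq := two_rpow_neg_lt_one (sub_pos.2 hδs)
  have hq0 : (0 : ℝ) ≤ 2 ^ (-(s - δ)) := by positivity
  have hpos := inv_pos.2 (sub_pos.2 hq)
  refine ⟨A * (1 - 2 ^ (-(s - δ)))⁻¹, by positivity, fun n => ?_⟩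
  have h1 : ∀ j ∈ Finset.range (n + 1), Good δ (A * (2 ^ (-(s - δ))) ^ (n - j)) (2 ^ n)
      (fun ξ : Eu d => ((2 : ℝ) ^ (-s)) ^ (n - j) * band s 0 1 j ξ) := by
    intro j hj
    have hj' : j ≤ n := by simpa [Nat.lt_succ_iff] using hj
    have h2 := (((hg j).weaken hδ2 (by positivity)).rescale hδ (by positivity)
      (pow_le_pow_right₀ (by norm_num : (1 : ℝ) ≤ 2) hj')).const_mul (((2 : ℝ) ^ (-s)) ^ (n - j))
    refine h2.mono (le_of_eq ?_) (by positivity)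
    rw [abs_of_nonneg (by positivity), div_eq_mul_inv, ← pow_sub₀ _ two_ne_zero hj', ← Real.rpow_natCast, ← Real.rpow_natCast,
      ← Real.rpow_natCast, ← Real.rpow_mul (by norm_num), ← Real.rpow_mul (by norm_num),
      ← Real.rpow_mul (by norm_num), mul_left_comm, ← Real.rpow_add (by norm_num)]
    congr 2
    ring
  have h3 := Good.sum (Finset.range (n + 1)) h1 (by positivity)
  have e : (low s n : Eu d → ℝ) = fun ξ =>
      ∑ j ∈ Finset.range (n + 1), ((2 : ℝ) ^ (-s)) ^ (n - j) * band s 0 1 j ξ := by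
    funext ξ; exact low_eq_sum s n ξ
  rw [e]
  refine h3.mono ?_ (by positivity)
  rw [← Finset.mul_sum]
  gcongr
  exact sum_geom_sub_le hq0 hq n

end Symbols

section Gaussian

variable {d : ℕ}

/-- A Schwartz function on the line which agrees with `exp (-r)` for `0 ≤ r`. -/
theorem exists_schwartz_exp_neg : ∃ F : SchwartzMap ℝ ℝ, ∀ r, 0 ≤ r → F r = Real.exp (-r) := by
  set f : ℝ → ℝ := fun r => Real.exp (-r) * Real.smoothTransition (r + 1) with hf
  have hs : ContDiff ℝ (⊤ : ℕ∞) f :=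
    (Real.contDiff_exp.comp contDiff_neg).mul
      (Real.smoothTransition.contDiff.comp (contDiff_id.add contDiff_const))
  have hd : ∀ k n : ℕ, ∃ C, ∀ x, ‖x‖ ^ k * ‖iteratedFDeriv ℝ n f x‖ ≤ C := by
    intro k n
    have hc : Continuous fun x => ‖x‖ ^ k * ‖iteratedFDeriv ℝ n f x‖ :=
      (continuous_norm.pow k).mul (hs.continuous_iteratedFDeriv
        (by exact_mod_cast le_top)).norm
    obtain ⟨C, hC⟩ := (isCompact_Icc (a := (-1 : ℝ)) (b := 0)).exists_bound_of_continuousOn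
      hc.continuousOn
    refine ⟨max C (k.factorial), fun x => ?_⟩
    rcases lt_or_ge x (-1) with h1 | h1
    · have hz : f =ᶠ[𝓝 x] fun _ => 0 := by
        filter_upwards [Iio_mem_nhds h1] with y hy
        simp only [hf]
        rw [Real.smoothTransition.zero_of_nonpos (by linarith [mem_Iio.1 hy]), mul_zero]
      rw [(Filter.EventuallyEq.iteratedFDeriv hz (𝕜 := ℝ) n).eq_of_nhds, iteratedFDeriv_fun_zero]
      simp
    rcases le_or_gt x 0 with h2 | h2
    · exact ((le_abs_self _).trans (hC x ⟨h1, h2⟩)).trans (le_max_left _ _)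
    · have hz : f =ᶠ[𝓝 x] fun y => Real.exp (-1 * y) := by
        filter_upwards [Ioi_mem_nhds h2] with y hy
        simp only [hf]
        rw [Real.smoothTransition.one_of_one_le (by linarith [mem_Ioi.1 hy]), mul_one, neg_one_mul]
      rw [(Filter.EventuallyEq.iteratedFDeriv hz (𝕜 := ℝ) n).eq_of_nhds,
        norm_iteratedFDeriv_eq_norm_iteratedDeriv, iteratedDeriv_exp_const_mul]
      refine le_trans ?_ (le_max_right _ _)
      rw [norm_mul, norm_pow, norm_neg, norm_one, one_pow, one_mul, Real.norm_of_nonneg h2.le,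
        Real.norm_of_nonneg (Real.exp_pos _).le, neg_one_mul, Real.exp_neg, ← div_eq_mul_inv,
        div_le_iff₀ (Real.exp_pos _)]
      have := Real.pow_div_factorial_le_exp x h2.le k
      rwa [div_le_iff₀ (by positivity), mul_comm] at this
  refine ⟨⟨f, hs, hd⟩, fun r hr => ?_⟩
  change f r = _
  simp only [hf]
  rw [Real.smoothTransition.one_of_one_le (by linarith), mul_one]

/-- The Gaussian symbol. -/
def gs (t : ℝ) (ξ : Eu d) : ℝ := Real.exp (-(t * ‖ξ‖ ^ 2))

theorem exists_schwartz_gs {t : ℝ} (ht : 0 < t) :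
    ∃ F : SchwartzMap (Eu d) ℝ, ∀ ξ, F ξ = gs t ξ := by
  obtain ⟨F, hF⟩ := exists_schwartz_exp_neg
  have hg : (fun x : Eu d => t * ‖x‖ ^ 2).HasTemperateGrowth := by
    have h1 := Function.hasTemperateGrowth_norm_sq (H := Eu d)
    exact (Function.HasTemperateGrowth.const t).mul h1
  refine ⟨SchwartzMap.compCLM ℝ hg ⟨1, 1 + t⁻¹, fun x => ?_⟩ F, fun ξ => ?_⟩
  · rw [pow_one, Real.norm_of_nonneg (by positivity)]
    have h1 : ‖x‖ ≤ 1 + ‖x‖ ^ 2 := by nlinarith [sq_nonneg (‖x‖ - 1)]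
    have h2 : t⁻¹ * (t * ‖x‖ ^ 2) = ‖x‖ ^ 2 := by field_simp
    have h3 : 0 ≤ t⁻¹ := by positivity
    have h4 : 0 ≤ t * ‖x‖ ^ 2 := by positivity
    nlinarith
  · rw [SchwartzMap.compCLM_apply, Function.comp_apply, hF _ (by positivity), gs]

lemma gs_temperate {t : ℝ} (ht : 0 < t) : (gs t : Eu d → ℝ).HasTemperateGrowth := by
  obtain ⟨F, hF⟩ := exists_schwartz_gs (d := d) ht
  have : (gs t : Eu d → ℝ) = F := funext fun ξ => (hF ξ).symm
  rw [this]
  exact F.hasTemperateGrowth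

lemma gs_pos (t : ℝ) (ξ : Eu d) : 0 < gs t ξ := Real.exp_pos _

lemma gs_le_one {t : ℝ} (ht : 0 ≤ t) (ξ : Eu d) : gs t ξ ≤ 1 :=
  Real.exp_le_one_iff.2 (neg_nonpos.2 (by positivity))

lemma gs_mul (s t : ℝ) (ξ : Eu d) : gs s ξ * gs t ξ = gs (s + t) ξ := by
  rw [gs, gs, gs, ← Real.exp_add]; congr 1; ring

lemma gs_smul (t c : ℝ) (ξ : Eu d) : gs t (c • ξ) = gs (t * c ^ 2) ξ := by
  rw [gs, gs, norm_smul, mul_pow, Real.norm_eq_abs, sq_abs, mul_assoc]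

/-- The convolution kernel with Gaussian symbol. -/
def gk (t : ℝ) (x : Eu d) : ℝ := (Real.pi / t) ^ ((d : ℝ) / 2) * Real.exp (-(Real.pi ^ 2 * ‖x‖ ^ 2 / t))

lemma gk_nonneg {t : ℝ} (ht : 0 < t) (x : Eu d) : 0 ≤ gk t x := by
  unfold gk; positivity

theorem exists_isKernel_gs {t : ℝ} (ht : 0 < t) :
    ∃ κ : Sw d, IsKernel κ (gs t) ∧ ∀ x, κ x = (gk t x : ℝ) := by
  obtain ⟨F, hF⟩ := exists_schwartz_gs (d := d) (t := Real.pi ^ 2 / t) (by positivity)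
  set c : ℝ := (Real.pi / t) ^ ((d : ℝ) / 2) with hc
  set κ : Sw d := SchwartzMap.postcompCLM (c • Complex.ofRealCLM) F with hκ
  have hκx : ∀ x, κ x = (gk t x : ℝ) := by
    intro x
    rw [hκ, SchwartzMap.postcompCLM_apply, hF, gs, gk]
    simp only [smul_apply, Complex.ofRealCLM_apply, Complex.real_smul, ← Complex.ofReal_mul]
    congr 4
    ring
  refine ⟨κ, fun ξ => ?_, hκx⟩
  have hb : 0 < ((Real.pi ^ 2 / t : ℝ) : ℂ).re := by
    rw [Complex.ofReal_re]; positivity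
  have h := fourier_gaussian_innerProductSpace hb ξ
  have e : (⇑κ : Eu d → ℂ) = c • fun v : Eu d => Complex.exp (-((Real.pi ^ 2 / t : ℝ) : ℂ) * ‖v‖ ^ 2) := by
    funext x
    rw [hκx, gk]
    simp only [Pi.smul_apply, Complex.real_smul]
    push_cast
    congr 2
    ring
  rw [SchwartzMap.fourier_coe, e]
  have h5 : 𝓕 (c • fun v : Eu d => Complex.exp (-((Real.pi ^ 2 / t : ℝ) : ℂ) * ‖v‖ ^ 2)) ξ =
      (c : ℂ) * 𝓕 (fun v : Eu d => Complex.exp (-((Real.pi ^ 2 / t : ℝ) : ℂ) * ‖v‖ ^ 2)) ξ := by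
    rw [Real.fourier_eq, Real.fourier_eq, ← integral_const_mul]
    refine integral_congr_ae (Eventually.of_forall fun v => ?_)
    simp only [Pi.smul_apply, Complex.real_smul, Circle.smul_def, smul_eq_mul]
    ring
  rw [h5, h, ← mul_assoc]
  have h6 : (Real.pi : ℂ) / ((Real.pi ^ 2 / t : ℝ) : ℂ) = ((t / Real.pi : ℝ) : ℂ) := by
    rw [← Complex.ofReal_div]
    congr 1
    field_simp
  have h7 : ((Module.finrank ℝ (Eu d) : ℂ) / 2) = (((d : ℝ) / 2 : ℝ) : ℂ) := by
    simp
  rw [h6, h7, ← Complex.ofReal_cpow (by positivity), ← Complex.ofReal_mul, hc,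
    ← Real.mul_rpow (by positivity) (by positivity)]
  have h8 : Real.pi / t * (t / Real.pi) = 1 := by field_simp
  rw [h8, Real.one_rpow, Complex.ofReal_one, one_mul, gs]
  push_cast
  congr 1
  have : (t : ℂ) ≠ 0 := by exact_mod_cast ht.ne'
  field_simp

lemma gk_le {t : ℝ} (ht : 0 < t) (x : Eu d) :
    gk (t / 3) x ≤ (3 : ℝ) ^ ((d : ℝ) / 2) * gk t x := by
  rw [gk, gk, ← mul_assoc, ← Real.mul_rpow (by norm_num) (by positivity)]
  have e : Real.pi / (t / 3) = 3 * (Real.pi / t) := by field_simp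
  rw [e]
  gcongr
  linarith

lemma integral_gk {t : ℝ} (ht : 0 < t) :
    Integrable (gk t : Eu d → ℝ) ∧ ∫ x : Eu d, gk t x = 1 := by
  obtain ⟨κ, h1, h2⟩ := exists_isKernel_gs (d := d) ht
  have h3 := h1 0
  rw [SchwartzMap.fourier_coe, Real.fourier_eq] at h3
  have h4 : Integrable fun x : Eu d => ((gk t x : ℝ) : ℂ) :=
    κ.integrable.congr (Eventually.of_forall h2)
  refine ⟨by simpa using h4.re, ?_⟩
  simp only [inner_zero_right, neg_zero, AddChar.map_zero_eq_one, one_smul, h2, gs] at h3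
  rw [integral_complex_ofReal] at h3
  norm_num at h3
  exact_mod_cast h3

end Gaussian

section Variance

variable {α : Type*} [MeasurableSpace α] {μ : Measure α} {q : α → ℝ}

lemma integrable_density_mul {F : Type*} [NormedAddCommGroup F] [NormedSpace ℝ F]
    (hq : Integrable q μ) {X : α → F} (hX : AEStronglyMeasurable X μ) {M : ℝ}
    (hM : ∀ y, ‖X y‖ ≤ M) : Integrable (fun y => q y • X y) μ :=
  hq.smul_bdd M hX (Eventually.of_forall hM)

lemma re_conj_mul_sub_eq (c X m : ℂ) : (starRingEnd ℂ c * (X - m)).re =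
    c.re * (X.re - m.re) + c.im * (X.im - m.im) := by
  simp

lemma integral_density_re_conj_mul_sub (hq : Integrable q μ) (h1 : ∫ y, q y ∂μ = 1) {X : α → ℂ}
    (hX : AEStronglyMeasurable X μ) {M : ℝ} (hM : ∀ y, ‖X y‖ ≤ M) (c : ℂ) :
    Integrable (fun y => q y • (starRingEnd ℂ c * (X y - ∫ y, q y • X y ∂μ)).re) μ ∧
    ∫ y, q y • (starRingEnd ℂ c * (X y - ∫ y, q y • X y ∂μ)).re ∂μ = 0 := by
  set m := ∫ y, q y • X y ∂μ with hm
  have i1 := integrable_density_mul hq hX hM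
  have i2 : Integrable (fun y => starRingEnd ℂ c * (q y • X y - q y • m)) μ :=
    (i1.sub (hq.smul_const m)).const_mul _
  have e : ∀ y, q y • (starRingEnd ℂ c * (X y - m)).re =
      RCLike.re (starRingEnd ℂ c * (q y • X y - q y • m)) := by
    intro y
    rw [← smul_sub, mul_smul_comm]
    simp
  simp only [e]
  refine ⟨i2.re, ?_⟩
  rw [integral_re i2, integral_const_mul, integral_sub i1 (hq.smul_const m), integral_smul_const,
    h1, one_smul, ← hm, sub_self, mul_zero]
  simp

/-- Jensen's inequality for the square of the norm of a complex function. -/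
lemma norm_sq_integral_density_le (hq : Integrable q μ) (h0 : ∀ y, 0 ≤ q y)
    (h1 : ∫ y, q y ∂μ = 1) {X : α → ℂ} (hX : AEStronglyMeasurable X μ) {M : ℝ}
    (hM : ∀ y, ‖X y‖ ≤ M) :
    ‖∫ y, q y • X y ∂μ‖ ^ 2 ≤ ∫ y, q y • ‖X y‖ ^ 2 ∂μ := by
  obtain ⟨i1, e1⟩ := integral_density_re_conj_mul_sub hq h1 hX hM (∫ y, q y • X y ∂μ)
  set m := ∫ y, q y • X y ∂μ with hm
  have i2 : Integrable (fun y => q y • ‖X y‖ ^ 2) μ :=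
    integrable_density_mul hq (hX.norm.pow 2) (M := M ^ 2) fun y => by
      rw [norm_pow, norm_norm]; gcongr; exact hM y
  calc ‖m‖ ^ 2 = ∫ y, (q y • ‖m‖ ^ 2 + 2 * (q y • (starRingEnd ℂ m * (X y - m)).re)) ∂μ := by
        rw [integral_add (hq.smul_const _) (i1.const_mul 2), integral_const_mul, e1,
          integral_smul_const, h1]
        simp
    _ ≤ _ := by
        refine integral_mono ((hq.smul_const _).add (i1.const_mul 2)) i2 fun y => ?_
        simp only [smul_eq_mul, re_conj_mul_sub_eq, Complex.sq_norm, Complex.normSq_apply]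
        nlinarith [mul_nonneg (h0 y) (sq_nonneg ((X y).re - m.re)),
          mul_nonneg (h0 y) (sq_nonneg ((X y).im - m.im))]

lemma variance_pointwise {G : ℝ} {U V a b : ℂ} (hU : ‖U‖ ≤ G) (hb : ‖b‖ ≤ G) :
    ‖a‖ ^ 2 / 2 * ‖U - b‖ ^ 2 + (‖a‖ ^ 2 * ‖b‖ ^ 2 + 8 * G ^ 2 * ‖a‖ ^ 2) +
      ((2 * ‖b‖ ^ 2 + 16 * G ^ 2) * (starRingEnd ℂ a * (V - a)).re +
        2 * ‖a‖ ^ 2 * (starRingEnd ℂ b * (U - b)).re) ≤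
      ‖U‖ ^ 2 * ‖V‖ ^ 2 + 8 * G ^ 2 * ‖V‖ ^ 2 := by
  have hG : 0 ≤ G := (norm_nonneg _).trans hU
  set r := (starRingEnd ℂ a * (V - a)).re with hr
  have h1 : ‖V‖ ^ 2 = ‖a‖ ^ 2 + 2 * r + ‖V - a‖ ^ 2 := by
    simp only [hr, re_conj_mul_sub_eq, Complex.sq_norm, Complex.normSq_apply, Complex.sub_re,
      Complex.sub_im]
    ring
  have h2 : ‖U‖ ^ 2 = ‖b‖ ^ 2 + 2 * (starRingEnd ℂ b * (U - b)).re + ‖U - b‖ ^ 2 := by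
    simp only [re_conj_mul_sub_eq, Complex.sq_norm, Complex.normSq_apply, Complex.sub_re,
      Complex.sub_im]
    ring
  have h3 : |r| ≤ ‖a‖ * ‖V - a‖ := by
    refine (Complex.abs_re_le_norm _).trans_eq ?_
    rw [norm_mul, RCLike.norm_conj]
  have h4 : |‖U‖ ^ 2 - ‖b‖ ^ 2| ≤ ‖U - b‖ * (2 * G) := by
    have : ‖U‖ ^ 2 - ‖b‖ ^ 2 = (‖U‖ - ‖b‖) * (‖U‖ + ‖b‖) := by ring
    rw [this, abs_mul, abs_of_nonneg (a := ‖U‖ + ‖b‖) (by positivity)]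
    gcongr
    · exact abs_norm_sub_norm_le U b
    · linarith
  have h5 : -(‖a‖ * ‖V - a‖ * (‖U - b‖ * (2 * G))) ≤ r * (‖U‖ ^ 2 - ‖b‖ ^ 2) := by
    refine (abs_le.1 ?_).1
    rw [abs_mul]
    gcongr
  have h6 : 0 ≤ ‖U‖ ^ 2 * ‖V - a‖ ^ 2 := by positivity
  have h7 := sq_nonneg (‖a‖ * ‖U - b‖ - 4 * G * ‖V - a‖)
  rw [h1]
  have h8 : ‖U‖ ^ 2 * (‖a‖ ^ 2 + 2 * r + ‖V - a‖ ^ 2) =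
    ‖a‖ ^ 2 * ‖U‖ ^ 2 + 2 * (r * (‖U‖ ^ 2 - ‖b‖ ^ 2)) + 2 * ‖b‖ ^ 2 * r + ‖U‖ ^ 2 * ‖V - a‖ ^ 2 := by
    ring
  have h9 : ‖a‖ ^ 2 * ‖U‖ ^ 2 = ‖a‖ ^ 2 * ‖b‖ ^ 2 +
      2 * ‖a‖ ^ 2 * (starRingEnd ℂ b * (U - b)).re + ‖a‖ ^ 2 * ‖U - b‖ ^ 2 := by
    rw [h2]; ring
  rw [h8, h9]
  nlinarith

/-- Averaging against a probability density loses a variance term. -/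
lemma variance_density (hq : Integrable q μ) (h0 : ∀ y, 0 ≤ q y) (h1 : ∫ y, q y ∂μ = 1)
    {u v : α → ℂ} (hu : AEStronglyMeasurable u μ) (hv : AEStronglyMeasurable v μ) {G M : ℝ}
    (hG : ∀ y, ‖u y‖ ≤ G) (hM : ∀ y, ‖v y‖ ≤ M) :
    ‖∫ y, q y • v y ∂μ‖ ^ 2 / 2 * (∫ y, q y • ‖u y - ∫ y, q y • u y ∂μ‖ ^ 2 ∂μ) +
      (‖∫ y, q y • v y ∂μ‖ ^ 2 * ‖∫ y, q y • u y ∂μ‖ ^ 2 + 8 * G ^ 2 * ‖∫ y, q y • v y ∂μ‖ ^ 2) ≤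
    ∫ y, q y • (‖u y‖ ^ 2 * ‖v y‖ ^ 2 + 8 * G ^ 2 * ‖v y‖ ^ 2) ∂μ := by
  obtain ⟨i1, e1⟩ := integral_density_re_conj_mul_sub hq h1 hv hM (∫ y, q y • v y ∂μ)
  obtain ⟨i2, e2⟩ := integral_density_re_conj_mul_sub hq h1 hu hG (∫ y, q y • u y ∂μ)
  have hb : ‖∫ y, q y • u y ∂μ‖ ≤ G := by
    calc ‖∫ y, q y • u y ∂μ‖ ≤ ∫ y, q y * G ∂μ := by
          refine norm_integral_le_of_norm_le (hq.mul_const G) (Eventually.of_forall fun y => ?_)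
          rw [norm_smul, Real.norm_of_nonneg (h0 y)]
          exact mul_le_mul_of_nonneg_left (hG y) (h0 y)
      _ = G := by rw [integral_mul_const, h1, one_mul]
  set a := ∫ y, q y • v y ∂μ with ha
  set b := ∫ y, q y • u y ∂μ with hb'
  have i3 : Integrable (fun y => q y • ‖u y - b‖ ^ 2) μ :=
    integrable_density_mul hq ((hu.sub aestronglyMeasurable_const).norm.pow 2) (M := (G + G) ^ 2)
      fun y => by
        rw [norm_pow, norm_norm]
        gcongr
        exact (norm_sub_le _ _).trans (add_le_add (hG y) hb)
  have i4 : Integrable (fun y => q y • (‖u y‖ ^ 2 * ‖v y‖ ^ 2 + 8 * G ^ 2 * ‖v y‖ ^ 2)) μ :=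
    integrable_density_mul hq (((hu.norm.pow 2).mul (hv.norm.pow 2)).add
      ((hv.norm.pow 2).const_mul _)) (M := G ^ 2 * M ^ 2 + 8 * G ^ 2 * M ^ 2) fun y => by
        rw [Real.norm_of_nonneg (by positivity)]
        have := hG y
        have := hM y
        gcongr
  have j1 : Integrable (fun y => ‖a‖ ^ 2 / 2 * (q y • ‖u y - b‖ ^ 2) +
      q y • (‖a‖ ^ 2 * ‖b‖ ^ 2 + 8 * G ^ 2 * ‖a‖ ^ 2)) μ :=
    (i3.const_mul _).add (hq.smul_const _)
  have j2 : Integrable (fun y =>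
      (2 * ‖b‖ ^ 2 + 16 * G ^ 2) * (q y • (starRingEnd ℂ a * (v y - a)).re) +
        2 * ‖a‖ ^ 2 * (q y • (starRingEnd ℂ b * (u y - b)).re)) μ :=
    (i1.const_mul _).add (i2.const_mul _)
  calc _ = ∫ y, (‖a‖ ^ 2 / 2 * (q y • ‖u y - b‖ ^ 2) +
        q y • (‖a‖ ^ 2 * ‖b‖ ^ 2 + 8 * G ^ 2 * ‖a‖ ^ 2) +
        ((2 * ‖b‖ ^ 2 + 16 * G ^ 2) * (q y • (starRingEnd ℂ a * (v y - a)).re) +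
        2 * ‖a‖ ^ 2 * (q y • (starRingEnd ℂ b * (u y - b)).re))) ∂μ := by
        rw [integral_add j1 j2, integral_add (i3.const_mul _) (hq.smul_const _),
          integral_add (i1.const_mul _) (i2.const_mul _), integral_const_mul, integral_const_mul,
          integral_const_mul, integral_smul_const, e1, e2, h1]
        simp
    _ ≤ _ := by
        refine integral_mono (j1.add j2) i4 fun y => ?_
        have := mul_le_mul_of_nonneg_left (variance_pointwise (V := v y) (a := a) (hG y) hb) (h0 y)
        simp only [smul_eq_mul]
        refine le_trans (le_of_eq ?_) this
        ring

end Variance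

section CarlesonGauss

variable {d : ℕ}

lemma exists_norm_le (f : Sw d) : ∃ M : ℝ, ∀ x, ‖f x‖ ≤ M :=
  ⟨‖f.toBoundedContinuousFunction‖, f.toBoundedContinuousFunction.norm_coe_le_norm⟩

lemma mult_gs_apply {t : ℝ} (ht : 0 < t) (u : Sw d) (z : Eu d) :
    mult (gs t) u z = ∫ y, gk t (z - y) • u y := by
  obtain ⟨κ, h1, h2⟩ := exists_isKernel_gs (d := d) ht
  rw [mult_apply_eq (gs_temperate ht) h1]
  simp only [h2, Complex.real_smul]

lemma integrable_gk_sub {t : ℝ} (ht : 0 < t) (z : Eu d) : Integrable fun y => gk t (z - y) :=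
  (integral_gk ht).1.comp_sub_left z

lemma integral_gk_sub {t : ℝ} (ht : 0 < t) (z : Eu d) : ∫ y, gk t (z - y) = 1 := by
  rw [integral_sub_left_eq_self (fun x => gk t x) volume z, (integral_gk ht).2]

lemma norm_mult_gs_le {t : ℝ} (ht : 0 < t) {u : Sw d} {G : ℝ} (hG : ∀ x, ‖u x‖ ≤ G) (z : Eu d) :
    ‖mult (gs t) u z‖ ≤ G := by
  rw [mult_gs_apply ht]
  calc ‖∫ y, gk t (z - y) • u y‖ ≤ ∫ y, gk t (z - y) * G := by
        refine norm_integral_le_of_norm_le ((integrable_gk_sub ht z).mul_const G)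
          (Eventually.of_forall fun y => ?_)
        rw [norm_smul, Real.norm_of_nonneg (gk_nonneg ht _)]
        exact mul_le_mul_of_nonneg_left (hG y) (gk_nonneg ht _)
    _ = G := by rw [integral_mul_const, integral_gk_sub ht, one_mul]

/-- The energy which decreases along the heat flow. -/
def energy (G : ℝ) (u v : Sw d) : ℝ≥0∞ :=
  ∫⁻ x, ENNReal.ofReal (‖u x‖ ^ 2 * ‖v x‖ ^ 2 + 8 * G ^ 2 * ‖v x‖ ^ 2)

lemma gaussian_step_pointwise {t G : ℝ} (ht : 0 < t) {u v : Sw d} (hG : ∀ x, ‖u x‖ ≤ G)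
    (z : Eu d) :
    (2 * (3 : ℝ) ^ ((d : ℝ) / 2))⁻¹ *
        ‖(mult (gs (t / 3)) u z - mult (gs t) u z) * mult (gs t) v z‖ ^ 2 +
      (‖mult (gs t) u z‖ ^ 2 * ‖mult (gs t) v z‖ ^ 2 + 8 * G ^ 2 * ‖mult (gs t) v z‖ ^ 2) ≤
    ∫ y, gk t (z - y) • (‖u y‖ ^ 2 * ‖v y‖ ^ 2 + 8 * G ^ 2 * ‖v y‖ ^ 2) := by
  have ht3 : 0 < t / 3 := by positivity
  obtain ⟨M, hM⟩ := exists_norm_le v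
  have hu := u.continuous.aestronglyMeasurable (μ := volume)
  have hv := v.continuous.aestronglyMeasurable (μ := volume)
  have h1 := variance_density (integrable_gk_sub ht z) (fun y => gk_nonneg ht _)
    (integral_gk_sub ht z) hu hv hG hM
  rw [← mult_gs_apply ht, ← mult_gs_apply ht] at h1
  set a := mult (gs t) v z with ha
  set b := mult (gs t) u z with hb
  have hbG : ‖b‖ ≤ G := norm_mult_gs_le ht hG z
  have hbd : ∀ y, ‖u y - b‖ ≤ G + G := fun y => (norm_sub_le _ _).trans (add_le_add (hG y) hbG)
  have hub := hu.sub (aestronglyMeasurable_const (b := b))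
  have e : mult (gs (t / 3)) u z - b = ∫ y, gk (t / 3) (z - y) • (u y - b) := by
    simp only [smul_sub]
    rw [integral_sub (integrable_density_mul (integrable_gk_sub ht3 z) hu hG)
      ((integrable_gk_sub ht3 z).smul_const b), integral_smul_const, integral_gk_sub ht3, one_smul,
      ← mult_gs_apply ht3]
  have h2 : ‖mult (gs (t / 3)) u z - b‖ ^ 2 ≤
      (3 : ℝ) ^ ((d : ℝ) / 2) * ∫ y, gk t (z - y) • ‖u y - b‖ ^ 2 := by
    rw [e]
    refine (norm_sq_integral_density_le (integrable_gk_sub ht3 z) (fun y => gk_nonneg ht3 _)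
      (integral_gk_sub ht3 z) hub hbd).trans ?_
    rw [← integral_const_mul]
    have hb2 : ∀ y, ‖‖u y - b‖ ^ 2‖ ≤ (G + G) ^ 2 := fun y => by
      rw [norm_pow, norm_norm]; gcongr; exact hbd y
    refine integral_mono (integrable_density_mul (integrable_gk_sub ht3 z) (hub.norm.pow 2) hb2)
      ((integrable_density_mul (integrable_gk_sub ht z) (hub.norm.pow 2) hb2).const_mul _)
      fun y => ?_
    simp only [smul_eq_mul]
    rw [← mul_assoc]
    exact mul_le_mul_of_nonneg_right (gk_le ht _) (by positivity)
  rw [mul_comm (‖b‖ ^ 2)]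
  refine le_trans (add_le_add ?_ le_rfl) h1
  rw [norm_mul, mul_pow]
  calc (2 * (3 : ℝ) ^ ((d : ℝ) / 2))⁻¹ * (‖mult (gs (t / 3)) u z - b‖ ^ 2 * ‖a‖ ^ 2)
      ≤ (2 * (3 : ℝ) ^ ((d : ℝ) / 2))⁻¹ * (((3 : ℝ) ^ ((d : ℝ) / 2) *
        ∫ y, gk t (z - y) • ‖u y - b‖ ^ 2) * ‖a‖ ^ 2) := by gcongr
    _ = _ := by
        have : (3 : ℝ) ^ ((d : ℝ) / 2) ≠ 0 := by positivity
        field_simp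

lemma gaussian_step {t G : ℝ} (ht : 0 < t) {u v : Sw d} (hG : ∀ x, ‖u x‖ ≤ G) :
    energy G (mult (gs t) u) (mult (gs t) v) + ENNReal.ofReal (2 * (3 : ℝ) ^ ((d : ℝ) / 2))⁻¹ *
      sqNorm (fun z => (mult (gs (t / 3)) u z - mult (gs t) u z) * mult (gs t) v z) ≤
    energy G u v := by
  obtain ⟨M, hM⟩ := exists_norm_le v
  set φ : Eu d → ℝ := fun y => ‖u y‖ ^ 2 * ‖v y‖ ^ 2 + 8 * G ^ 2 * ‖v y‖ ^ 2 with hφ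
  have hφc : Continuous φ := by
    have := u.continuous
    have := v.continuous
    fun_prop
  have hφ0 : ∀ y, 0 ≤ φ y := fun y => by positivity
  have hφb : ∀ y, ‖φ y‖ ≤ G ^ 2 * M ^ 2 + 8 * G ^ 2 * M ^ 2 := fun y => by
    rw [Real.norm_of_nonneg (hφ0 y)]
    have := hG y
    have := hM y
    simp only [hφ]
    gcongr
  have hgc : Continuous (gk t : Eu d → ℝ) := by
    unfold gk
    fun_prop
  have hcw : Continuous fun z => (mult (gs (t / 3)) u z - mult (gs t) u z) * mult (gs t) v z :=
    ((mult (gs (t / 3)) u).continuous.sub (mult (gs t) u).continuous).mul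
      (mult (gs t) v).continuous
  have hm1 : Measurable fun z => ENNReal.ofReal (2 * (3 : ℝ) ^ ((d : ℝ) / 2))⁻¹ *
      ‖(mult (gs (t / 3)) u z - mult (gs t) u z) * mult (gs t) v z‖ₑ ^ 2 :=
    (hcw.enorm.measurable.pow_const 2).const_mul _
  rw [energy, sqNorm, ← lintegral_const_mul' _ _ ENNReal.ofReal_ne_top, ← lintegral_add_right _ hm1]
  calc _ ≤ ∫⁻ z, ∫⁻ y, ENNReal.ofReal (gk t (z - y)) * ENNReal.ofReal (φ y) := by
        refine lintegral_mono fun z => ?_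
        have h := gaussian_step_pointwise ht hG (v := v) z
        have h2 : ENNReal.ofReal (∫ y, gk t (z - y) • φ y) =
            ∫⁻ y, ENNReal.ofReal (gk t (z - y)) * ENNReal.ofReal (φ y) := by
          rw [ofReal_integral_eq_lintegral_ofReal
            (integrable_density_mul (integrable_gk_sub ht z) hφc.aestronglyMeasurable hφb)
            (Eventually.of_forall fun y => smul_nonneg (gk_nonneg ht _) (hφ0 y))]
          refine lintegral_congr fun y => ?_
          rw [smul_eq_mul, ENNReal.ofReal_mul (gk_nonneg ht _)]
        rw [← h2]
        refine le_trans (le_of_eq ?_) (ENNReal.ofReal_le_ofReal h)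
        have h3 : ∀ (c' P : ℝ) (w : ℂ), 0 ≤ c' → 0 ≤ P → ENNReal.ofReal P +
            ENNReal.ofReal c' * ‖w‖ₑ ^ 2 = ENNReal.ofReal (c' * ‖w‖ ^ 2 + P) := by
          intro c' P w hc' hP
          rw [ENNReal.ofReal_add (by positivity) hP, add_comm,
            ENNReal.ofReal_mul hc', ENNReal.ofReal_pow (norm_nonneg _), ofReal_norm]
        exact h3 _ _ _ (by positivity) (by positivity)
    _ = ∫⁻ y, ∫⁻ z, ENNReal.ofReal (gk t (z - y)) * ENNReal.ofReal (φ y) := by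
        refine lintegral_lintegral_swap (Measurable.aemeasurable ?_)
        have h3 : Measurable fun w : Eu d × Eu d => ENNReal.ofReal (gk t (w.1 - w.2)) :=
          (hgc.comp (continuous_fst.sub continuous_snd)).measurable.ennreal_ofReal
        have h4 : Measurable fun w : Eu d × Eu d => ENNReal.ofReal (φ w.2) :=
          (hφc.comp continuous_snd).measurable.ennreal_ofReal
        exact h3.mul h4
    _ = ∫⁻ y, ENNReal.ofReal (φ y) := by
        refine lintegral_congr fun y => ?_
        rw [lintegral_mul_const' _ _ ENNReal.ofReal_ne_top,
          lintegral_sub_right_eq_self (fun x => ENNReal.ofReal (gk t x)) y,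
          ← ofReal_integral_eq_lintegral_ofReal (integral_gk ht).1
            (Eventually.of_forall (gk_nonneg ht)), (integral_gk ht).2, ENNReal.ofReal_one, one_mul]

lemma inv_four_pow (m : ℕ) : ((4 : ℝ) ^ m)⁻¹ = 3 * ((4 : ℝ) ^ (m + 1))⁻¹ + ((4 : ℝ) ^ (m + 1))⁻¹ := by
  rw [pow_succ, mul_inv]; ring

lemma mult_gs_mult_gs {s t : ℝ} (hs : 0 < s) (ht : 0 < t) (u : Sw d) :
    mult (gs s) (mult (gs t) u) = mult (gs (s + t)) u := by
  rw [mult_mult (gs_temperate hs) (gs_temperate ht)]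
  simp only [gs_mul]

/-- Carleson's embedding for the heat semigroup. -/
lemma carleson_gauss {G : ℝ} {g : Sw d} (hG : ∀ x, ‖g x‖ ≤ G) (h : Sw d) (N : ℕ) :
    ∑ m ∈ Finset.range N, sqNorm (fun x =>
      mult (fun ξ => gs (2 * ((4 : ℝ) ^ (m + 1))⁻¹) ξ - gs ((4 : ℝ) ^ m)⁻¹ ξ) g x *
        mult (gs ((4 : ℝ) ^ m)⁻¹) h x) ≤
    ENNReal.ofReal (18 * (3 : ℝ) ^ ((d : ℝ) / 2) * G ^ 2) * sqNorm h := by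
  set c : ℝ := (2 * (3 : ℝ) ^ ((d : ℝ) / 2))⁻¹ with hc
  have hc0 : 0 < c := by positivity
  set X : ℕ → ℝ≥0∞ := fun m => sqNorm (fun x =>
      mult (fun ξ => gs (2 * ((4 : ℝ) ^ (m + 1))⁻¹) ξ - gs ((4 : ℝ) ^ m)⁻¹ ξ) g x *
        mult (gs ((4 : ℝ) ^ m)⁻¹) h x) with hX
  have key : ∀ N, ENNReal.ofReal c * ∑ m ∈ Finset.range N, X m ≤
      energy G (mult (gs ((4 : ℝ) ^ N)⁻¹) g) (mult (gs ((4 : ℝ) ^ N)⁻¹) h) := by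
    intro N
    induction N with
    | zero => simp
    | succ m ih =>
      have hp : (0 : ℝ) < ((4 : ℝ) ^ (m + 1))⁻¹ := by positivity
      have h3 : (0 : ℝ) < 3 * ((4 : ℝ) ^ (m + 1))⁻¹ := by positivity
      have hs := gaussian_step h3 (norm_mult_gs_le hp hG) (v := mult (gs ((4 : ℝ) ^ (m + 1))⁻¹) h)
      rw [mult_gs_mult_gs h3 hp, mult_gs_mult_gs h3 hp, mul_div_cancel_left₀ _ (by norm_num),
        mult_gs_mult_gs hp hp, ← inv_four_pow] at hs
      rw [Finset.sum_range_succ, mul_add]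
      refine le_trans (add_le_add ih (le_of_eq ?_)) hs
      congr 1
      simp only [hX]
      have h4 := (gs_temperate (d := d) (show (0 : ℝ) < 2 * ((4 : ℝ) ^ (m + 1))⁻¹ by positivity))
      have h5 := (gs_temperate (d := d) (show (0 : ℝ) < ((4 : ℝ) ^ m)⁻¹ by positivity))
      have e : mult (fun ξ => gs (2 * ((4 : ℝ) ^ (m + 1))⁻¹) ξ - gs ((4 : ℝ) ^ m)⁻¹ ξ) g =
          mult (gs (((4 : ℝ) ^ (m + 1))⁻¹ + ((4 : ℝ) ^ (m + 1))⁻¹)) g -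
            mult (gs ((4 : ℝ) ^ m)⁻¹) g := by
        rw [← two_mul]
        refine mult_eq_of_fourier (σ := fun ξ => gs (2 * ((4 : ℝ) ^ (m + 1))⁻¹) ξ -
          gs ((4 : ℝ) ^ m)⁻¹ ξ) (h4.sub h5) fun ξ => ?_
        rw [fourier_sub_apply, fourier_mult h4, fourier_mult h5]
        push_cast
        ring
      rw [e]
      rfl
  have hp : (0 : ℝ) < ((4 : ℝ) ^ N)⁻¹ := by positivity
  have h1 : energy G (mult (gs ((4 : ℝ) ^ N)⁻¹) g) (mult (gs ((4 : ℝ) ^ N)⁻¹) h) ≤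
      ENNReal.ofReal (9 * G ^ 2) * sqNorm h := by
    calc _ ≤ ∫⁻ x, ENNReal.ofReal (9 * G ^ 2) * ‖mult (gs ((4 : ℝ) ^ N)⁻¹) h x‖ₑ ^ 2 := by
          refine lintegral_mono fun x => ?_
          rw [← ofReal_norm, ← ENNReal.ofReal_pow (norm_nonneg _),
            ← ENNReal.ofReal_mul (by positivity)]
          refine ENNReal.ofReal_le_ofReal ?_
          have := norm_mult_gs_le hp hG x
          have h2 : ‖mult (gs ((4 : ℝ) ^ N)⁻¹) g x‖ ^ 2 ≤ G ^ 2 := by gcongr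
          nlinarith [sq_nonneg ‖mult (gs ((4 : ℝ) ^ N)⁻¹) h x‖]
      _ = ENNReal.ofReal (9 * G ^ 2) * sqNorm (mult (gs ((4 : ℝ) ^ N)⁻¹) h) :=
          lintegral_const_mul' _ _ ENNReal.ofReal_ne_top
      _ ≤ ENNReal.ofReal (9 * G ^ 2) * sqNorm h := by
          gcongr
          have := sqNorm_mult_le (gs_temperate hp) (C := 1) (fun ξ => by
            have h1 := gs_pos ((4 : ℝ) ^ N)⁻¹ ξ
            have h2 := gs_le_one hp.le ξ
            nlinarith) h
          simpa using this
  have h2 := (key N).trans h1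
  have h3 : ENNReal.ofReal c⁻¹ * (ENNReal.ofReal c * ∑ m ∈ Finset.range N, X m) =
      ∑ m ∈ Finset.range N, X m := by
    rw [← mul_assoc, ← ENNReal.ofReal_mul (by positivity), inv_mul_cancel₀ hc0.ne']
    simp
  calc ∑ m ∈ Finset.range N, X m = _ := h3.symm
    _ ≤ ENNReal.ofReal c⁻¹ * (ENNReal.ofReal (9 * G ^ 2) * sqNorm h) := by gcongr
    _ = _ := by
        rw [← mul_assoc, ← ENNReal.ofReal_mul (by positivity), hc, inv_inv]
        congr 2
        ring

end CarlesonGauss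

section Localization

variable {d : ℕ}

lemma sq_lintegral_mul_le {α : Type*} [MeasurableSpace α] {μ : Measure α} {k φ : α → ℝ≥0∞}
    (hk : AEMeasurable k μ) (hφ : AEMeasurable φ μ) :
    (∫⁻ y, k y * φ y ∂μ) ^ 2 ≤ (∫⁻ y, k y ∂μ) * ∫⁻ y, k y * φ y ^ 2 ∂μ := by
  have h2 : ∀ t : ℝ≥0∞, (t ^ (1 / 2 : ℝ)) ^ (2 : ℝ) = t := fun t => by
    rw [← ENNReal.rpow_mul]; norm_num
  have h3 : ∀ t : ℝ≥0∞, (t ^ (1 / 2 : ℝ)) ^ 2 = t := fun t => by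
    rw [← ENNReal.rpow_ofNat, h2]
  have h := ENNReal.lintegral_mul_le_Lp_mul_Lq μ Real.HolderConjugate.two_two
    (hk.pow_const (1 / 2 : ℝ)) ((hk.pow_const (1 / 2 : ℝ)).mul hφ)
  have e1 : ∫⁻ y, k y * φ y ∂μ = ∫⁻ y, ((fun y => k y ^ (1 / 2 : ℝ)) *
      ((fun y => k y ^ (1 / 2 : ℝ)) * φ)) y ∂μ := by
    refine lintegral_congr fun y => ?_
    simp only [Pi.mul_apply]
    rw [← mul_assoc, ← ENNReal.rpow_add_of_nonneg _ _ (by norm_num) (by norm_num)]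
    norm_num
  rw [e1]
  refine (ENNReal.pow_le_pow_left h).trans (le_of_eq ?_)
  rw [mul_pow, h3, h3]
  congr 1
  · exact lintegral_congr fun y => h2 _
  · refine lintegral_congr fun y => ?_
    rw [Pi.mul_apply, ENNReal.mul_rpow_of_nonneg _ _ (by norm_num), h2, ENNReal.rpow_ofNat]

lemma sqNorm_mult_good_le {w A ρ : ℝ} {σ : Eu d → ℝ} (h : Good w A ρ σ) (hw : 0 ≤ w)
    (hρ : 0 ≤ ρ) (f : Sw d) : sqNorm (mult σ f) ≤ ENNReal.ofReal (A ^ 2) * sqNorm f :=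
  sqNorm_mult_le h.temperate (fun ξ => by
    rw [← sq_abs]
    have := h.abs_le hw hρ ξ
    gcongr) f

/-- The `L¹` mass of the kernel of a good symbol. -/
lemma lintegral_enorm_le_of_weight {w A ρ : ℝ} {κ : Sw d} (hw : 0 ≤ w) (hρ : 0 ≤ ρ)
    (h : ∫⁻ u, ‖κ u‖ₑ * ENNReal.ofReal ((1 + ρ * ‖u‖) ^ w) ≤ ENNReal.ofReal A) :
    ∫⁻ u, ‖κ u‖ₑ ≤ ENNReal.ofReal A := by
  refine (lintegral_mono fun u => ?_).trans h
  have : (1 : ℝ≥0∞) ≤ ENNReal.ofReal ((1 + ρ * ‖u‖) ^ w) := by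
    rw [← ENNReal.ofReal_one]
    refine ENNReal.ofReal_le_ofReal (Real.one_le_rpow ?_ hw)
    have : 0 ≤ ρ * ‖u‖ := by positivity
    linarith
  calc ‖κ u‖ₑ = ‖κ u‖ₑ * 1 := (mul_one _).symm
    _ ≤ _ := by gcongr

lemma norm_mult_good_le {w A ρ : ℝ} {σ : Eu d → ℝ} (h : Good w A ρ σ) (hw : 0 ≤ w)
    (hρ : 0 ≤ ρ) {f : Sw d} {G : ℝ} (hG : ∀ x, ‖f x‖ ≤ G) (x : Eu d) : ‖mult σ f x‖ ≤ A * G := by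
  obtain ⟨κ, h1, h2, -⟩ := h.ker
  have h3 := lintegral_enorm_le_of_weight hw hρ h2
  have hG0 : 0 ≤ G := (norm_nonneg _).trans (hG 0)
  rw [mult_apply_eq h.temperate h1]
  have h4 : ‖∫ y, κ (x - y) * f y‖ₑ ≤ ENNReal.ofReal (A * G) := by
    calc _ ≤ ∫⁻ y, ‖κ (x - y) * f y‖ₑ := enorm_integral_le_lintegral_enorm _
      _ ≤ ∫⁻ y, ‖κ (x - y)‖ₑ * ENNReal.ofReal G := by
          refine lintegral_mono fun y => ?_
          rw [enorm_mul, ← ofReal_norm (f y)]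
          gcongr
          exact hG y
      _ = (∫⁻ y, ‖κ y‖ₑ) * ENNReal.ofReal G := by
          rw [lintegral_mul_const' _ _ ENNReal.ofReal_ne_top,
            lintegral_sub_left_eq_self (fun y => ‖κ y‖ₑ)]
      _ ≤ _ := by
          rw [ENNReal.ofReal_mul h.nonneg]
          gcongr
  rw [← ofReal_norm] at h4
  exact (ENNReal.ofReal_le_ofReal_iff (mul_nonneg h.nonneg hG0)).1 h4

lemma enorm_add_sq_le {q : ℝ} (hq0 : 0 < q) (hq1 : q < 1) (x y : ℂ) :
    ‖x + y‖ₑ ^ 2 ≤ ENNReal.ofReal q⁻¹ * ‖x‖ₑ ^ 2 + ENNReal.ofReal (1 - q)⁻¹ * ‖y‖ₑ ^ 2 := by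
  have h1 : 0 < 1 - q := by linarith
  simp only [← ofReal_norm, ← ENNReal.ofReal_pow (norm_nonneg _)]
  rw [← ENNReal.ofReal_mul (by positivity), ← ENNReal.ofReal_mul (by positivity),
    ← ENNReal.ofReal_add (by positivity) (by positivity)]
  refine ENNReal.ofReal_le_ofReal ?_
  calc ‖x + y‖ ^ 2 ≤ (‖x‖ + ‖y‖) ^ 2 := by gcongr; exact norm_add_le x y
    _ ≤ _ := by
      rw [← sub_nonneg]
      have : q⁻¹ * ‖x‖ ^ 2 + (1 - q)⁻¹ * ‖y‖ ^ 2 - (‖x‖ + ‖y‖) ^ 2 =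
          ((1 - q) * ‖x‖ - q * ‖y‖) ^ 2 / (q * (1 - q)) := by
        field_simp
        ring
      rw [this]
      positivity

lemma fourier_translate (v : Sw d) (u ξ : Eu d) :
    𝓕 (SchwartzMap.compSubConstCLM ℝ u v) ξ =
      Complex.exp (Complex.I * ((-(2 * Real.pi * inner ℝ u ξ) : ℝ) : ℂ)) * 𝓕 v ξ := by
  rw [SchwartzMap.fourier_coe, SchwartzMap.fourier_coe, Real.fourier_eq, Real.fourier_eq,
    ← integral_const_mul, ← integral_add_right_eq_self (fun x => Real.fourierChar (-inner ℝ x ξ) •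
      (SchwartzMap.compSubConstCLM ℝ u v) x) u]
  refine integral_congr_ae (Eventually.of_forall fun x => ?_)
  simp only [SchwartzMap.compSubConstCLM_apply, Circle.smul_def, Real.fourierChar_apply,
    smul_eq_mul, ← mul_assoc, ← Complex.exp_add, add_sub_cancel_right]
  congr 2
  rw [inner_add_left]
  push_cast
  ring

/-- The translation modulus of continuity in `L²`. -/
lemma sqNorm_sub_translate_le (v : Sw d) (u : Eu d) :
    ∫⁻ x, ‖v x - v (x - u)‖ₑ ^ 2 ≤
      ENNReal.ofReal (4 * Real.pi ^ 2 * ‖u‖ ^ 2) *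
        ∫⁻ ξ, ENNReal.ofReal (‖ξ‖ ^ 2) * ‖𝓕 v ξ‖ₑ ^ 2 := by
  have e : ∫⁻ x, ‖v x - v (x - u)‖ₑ ^ 2 = sqNorm (v - SchwartzMap.compSubConstCLM ℝ u v : Sw d) :=
    rfl
  rw [e, ← sqNorm_fourier, ← lintegral_const_mul' _ _ ENNReal.ofReal_ne_top]
  refine lintegral_mono fun ξ => ?_
  rw [fourier_sub_apply, fourier_translate, ← mul_assoc, ← ENNReal.ofReal_mul (by positivity),
    ← one_sub_mul, enorm_mul, mul_pow]
  gcongr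
  rw [← ofReal_norm, ← ENNReal.ofReal_pow (norm_nonneg _)]
  refine ENNReal.ofReal_le_ofReal ?_
  rw [norm_sub_rev]
  have h1 : ‖Complex.exp (Complex.I * ((-(2 * Real.pi * inner ℝ u ξ) : ℝ) : ℂ)) - 1‖ ≤
      2 * Real.pi * (‖u‖ * ‖ξ‖) := by
    refine Real.norm_exp_I_mul_ofReal_sub_one_le.trans ?_
    rw [norm_neg, norm_mul, Real.norm_of_nonneg (by positivity)]
    gcongr
    exact abs_real_inner_le_norm u ξ
  calc _ ≤ (2 * Real.pi * (‖u‖ * ‖ξ‖)) ^ 2 := by gcongr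
    _ = _ := by ring

/-- A frequency localized function times a slowly varying one is almost frequency localized. -/
lemma sqNorm_mult_mul_le {A ρ : ℝ} {σ : Eu d → ℝ} (h : Good 2 A ρ σ) (hρ : 0 < ρ) {w : Sw d}
    {G : ℝ} (hG : ∀ x, ‖w x‖ ≤ G) (v : Sw d) :
    sqNorm (fun x => mult σ w x * v x) ≤ ENNReal.ofReal (2 * A ^ 2) * sqNorm (fun x => w x * v x) +
      ENNReal.ofReal (8 * Real.pi ^ 2 * G ^ 2 * A ^ 2 * ρ⁻¹ ^ 2) *
        ∫⁻ ξ, ENNReal.ofReal (‖ξ‖ ^ 2) * ‖𝓕 v ξ‖ₑ ^ 2 := by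
  obtain ⟨κ, h1, h2, -⟩ := h.ker
  have hA := h.nonneg
  have hG0 : 0 ≤ G := (norm_nonneg _).trans (hG 0)
  have h3 := lintegral_enorm_le_of_weight zero_le_two hρ.le h2
  obtain ⟨M, hM⟩ := exists_norm_le v
  set r : Eu d → ℂ := fun x => ∫ y, κ (x - y) * (w y * (v x - v y)) with hr
  have hsplit : ∀ x, mult σ w x * v x = mult σ (prodS w v) x + r x := by
    intro x
    rw [mult_apply_eq h.temperate h1, mult_apply_eq h.temperate h1, hr, ← integral_mul_const,
      ← integral_add]
    · refine integral_congr_ae (Eventually.of_forall fun y => ?_)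
      simp only [prodS_apply]
      ring
    · exact (κ.integrable.comp_sub_left x).mul_bdd (c := G * M)
        (prodS w v).continuous.aestronglyMeasurable (Eventually.of_forall fun y => by
          rw [prodS_apply, norm_mul]
          have := hG y
          have := hM y
          gcongr)
    · refine (κ.integrable.comp_sub_left x).mul_bdd (c := G * (M + M)) (Continuous.aestronglyMeasurable
        (w.continuous.mul (continuous_const.sub v.continuous))) (Eventually.of_forall fun y => ?_)
      rw [norm_mul]
      have := hG y
      have := (norm_sub_le (v x) (v y)).trans (add_le_add (hM x) (hM y))
      gcongr
  have hrx : ∀ x, ‖r x‖ₑ ≤ ENNReal.ofReal G * ∫⁻ u, ‖κ u‖ₑ * ‖v x - v (x - u)‖ₑ := by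
    intro x
    calc ‖r x‖ₑ ≤ ∫⁻ y, ‖κ (x - y) * (w y * (v x - v y))‖ₑ := enorm_integral_le_lintegral_enorm _
      _ ≤ ∫⁻ y, ENNReal.ofReal G * (‖κ (x - y)‖ₑ * ‖v x - v (x - (x - y))‖ₑ) := by
          refine lintegral_mono fun y => ?_
          rw [_root_.sub_sub_cancel, enorm_mul, enorm_mul, ← ofReal_norm (w y), mul_left_comm]
          gcongr
          exact hG y
      _ = _ := by
          rw [lintegral_const_mul' _ _ ENNReal.ofReal_ne_top,
            lintegral_sub_left_eq_self (fun u => ‖κ u‖ₑ * ‖v x - v (x - u)‖ₑ)]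
  have hmv : Measurable fun z : Eu d × Eu d => ‖v z.1 - v (z.1 - z.2)‖ₑ :=
    ((v.continuous.comp continuous_fst).sub
      (v.continuous.comp (continuous_fst.sub continuous_snd))).enorm.measurable
  have hmk : Measurable fun z : Eu d × Eu d => ‖κ z.2‖ₑ :=
    (κ.continuous.comp continuous_snd).enorm.measurable
  set I := ∫⁻ ξ, ENNReal.ofReal (‖ξ‖ ^ 2) * ‖𝓕 v ξ‖ₑ ^ 2 with hI
  have hr2 : ∫⁻ x, ‖r x‖ₑ ^ 2 ≤
      ENNReal.ofReal (4 * Real.pi ^ 2 * G ^ 2 * A ^ 2 * ρ⁻¹ ^ 2) * I := by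
    calc ∫⁻ x, ‖r x‖ₑ ^ 2
        ≤ ∫⁻ x, (ENNReal.ofReal G ^ 2 * ENNReal.ofReal A) *
          ∫⁻ u, ‖κ u‖ₑ * ‖v x - v (x - u)‖ₑ ^ 2 := by
          refine lintegral_mono fun x => ?_
          refine (ENNReal.pow_le_pow_left (hrx x)).trans ?_
          rw [mul_pow, mul_assoc]
          gcongr
          refine (sq_lintegral_mul_le κ.continuous.enorm.measurable.aemeasurable
            (hmv.comp measurable_prodMk_left).aemeasurable).trans ?_
          gcongr
          rfl
      _ = (ENNReal.ofReal G ^ 2 * ENNReal.ofReal A) *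
          ∫⁻ u, ‖κ u‖ₑ * ∫⁻ x, ‖v x - v (x - u)‖ₑ ^ 2 := by
          rw [lintegral_const_mul' _ _ (by finiteness)]
          congr 1
          rw [lintegral_lintegral_swap (hmk.mul (hmv.pow_const 2)).aemeasurable]
          refine lintegral_congr fun u => ?_
          rw [lintegral_const_mul' _ _ (by finiteness)]
      _ ≤ (ENNReal.ofReal G ^ 2 * ENNReal.ofReal A) *
          ∫⁻ u, (‖κ u‖ₑ * ENNReal.ofReal ((1 + ρ * ‖u‖) ^ (2 : ℝ))) *
            (ENNReal.ofReal (4 * Real.pi ^ 2 * ρ⁻¹ ^ 2) * I) := by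
          refine mul_le_mul_right (lintegral_mono fun u => ?_) _
          refine (mul_le_mul_right (sqNorm_sub_translate_le v u) _).trans ?_
          rw [mul_assoc ‖κ u‖ₑ, ← mul_assoc (ENNReal.ofReal ((1 + ρ * ‖u‖) ^ (2 : ℝ))),
            ← ENNReal.ofReal_mul (by positivity)]
          refine mul_le_mul_right (mul_le_mul_left (ENNReal.ofReal_le_ofReal ?_) _) _
          rw [Real.rpow_two]
          have h5 : ‖u‖ ^ 2 = (ρ * ‖u‖) ^ 2 * ρ⁻¹ ^ 2 := by field_simp
          have h6 : (ρ * ‖u‖) ^ 2 ≤ (1 + ρ * ‖u‖) ^ 2 := by gcongr; linarith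
          calc 4 * Real.pi ^ 2 * ‖u‖ ^ 2 = (ρ * ‖u‖) ^ 2 * (4 * Real.pi ^ 2 * ρ⁻¹ ^ 2) := by
                rw [h5]; ring
            _ ≤ _ := by gcongr
      _ ≤ (ENNReal.ofReal G ^ 2 * ENNReal.ofReal A) *
          (ENNReal.ofReal A * (ENNReal.ofReal (4 * Real.pi ^ 2 * ρ⁻¹ ^ 2) * I)) := by
          rw [lintegral_mul_const]
          · gcongr
          · have h7 : Measurable fun u : Eu d => ENNReal.ofReal ((1 + ρ * ‖u‖) ^ (2 : ℝ)) := by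
              fun_prop
            exact κ.continuous.enorm.measurable.mul h7
      _ = _ := by
          rw [← mul_assoc, ← mul_assoc, ← ENNReal.ofReal_pow hG0, ← ENNReal.ofReal_mul (by positivity),
            ← ENNReal.ofReal_mul (by positivity), ← ENNReal.ofReal_mul (by positivity)]
          congr 2
          ring
  have hp := sqNorm_mult_good_le h zero_le_two hρ.le (prodS w v)
  have hpw : sqNorm (prodS w v) = sqNorm (fun x => w x * v x) :=
    lintegral_congr fun x => by rw [prodS_apply]
  rw [hpw] at hp
  calc sqNorm (fun x => mult σ w x * v x)
      ≤ ∫⁻ x, (2 * ‖mult σ (prodS w v) x‖ₑ ^ 2 + 2 * ‖r x‖ₑ ^ 2) := by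
        refine lintegral_mono fun x => ?_
        change ‖mult σ w x * v x‖ₑ ^ 2 ≤ _
        rw [hsplit]
        have := enorm_add_sq_le (q := 1 / 2) (by norm_num) (by norm_num) (mult σ (prodS w v) x) (r x)
        norm_num at this
        exact this
    _ = 2 * sqNorm (mult σ (prodS w v)) + 2 * ∫⁻ x, ‖r x‖ₑ ^ 2 := by
        rw [lintegral_add_left, lintegral_const_mul' _ _ (by finiteness),
          lintegral_const_mul' _ _ (by finiteness)]
        exact ((mult σ (prodS w v)).continuous.enorm.measurable.pow_const 2).const_mul 2
    _ ≤ 2 * (ENNReal.ofReal (A ^ 2) * sqNorm (fun x => w x * v x)) +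
        2 * (ENNReal.ofReal (4 * Real.pi ^ 2 * G ^ 2 * A ^ 2 * ρ⁻¹ ^ 2) * I) := by gcongr
    _ = _ := by
        have h2 : ∀ a : ℝ, (2 : ℝ≥0∞) * ENNReal.ofReal a = ENNReal.ofReal (2 * a) := fun a => by
          rw [ENNReal.ofReal_mul zero_le_two]; simp
        rw [← mul_assoc, ← mul_assoc, h2, h2]
        congr 3
        ring

end Localization

section Carleson

variable {d : ℕ}

/-- The Gaussian low frequency cutoff at frequency `2 ^ n`. -/
abbrev heat (n : ℕ) : Eu d → ℝ := gs ((4 : ℝ) ^ n)⁻¹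

lemma heat_temperate (n : ℕ) : (heat n : Eu d → ℝ).HasTemperateGrowth := gs_temperate (by positivity)

lemma mul_exp_neg_le (x : ℝ) :
    x * Real.exp (-x) ≤ 4 / 3 * (Real.exp (-(x / 4)) - Real.exp (-x)) := by
  have h1 : Real.exp (-(x / 4)) = Real.exp (-x) * Real.exp (3 * x / 4) := by
    rw [← Real.exp_add]; congr 1; ring
  have h2 := Real.add_one_le_exp (3 * x / 4)
  have h3 := Real.exp_pos (-x)
  rw [h1]
  nlinarith

lemma heat_eq (n : ℕ) (ξ : Eu d) : heat n ξ = Real.exp (-(‖ξ‖ ^ 2 / 4 ^ n)) := by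
  rw [heat, gs, div_eq_inv_mul]

lemma heat_succ_eq (n : ℕ) (ξ : Eu d) : heat (n + 1) ξ = Real.exp (-(‖ξ‖ ^ 2 / 4 ^ n / 4)) := by
  rw [heat_eq, pow_succ (4 : ℝ), div_div]

lemma heat_mono (n : ℕ) (ξ : Eu d) : heat n ξ ≤ heat (n + 1) ξ := by
  rw [heat_eq, heat_succ_eq]
  have : 0 ≤ ‖ξ‖ ^ 2 / 4 ^ n := by positivity
  exact Real.exp_le_exp.2 (by linarith)

lemma sum_heat_sub_le (N : ℕ) (ξ : Eu d) :
    ∑ n ∈ Finset.range N, (heat (n + 1) ξ - heat n ξ) ≤ 1 := by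
  rw [Finset.sum_range_sub (fun n => heat n ξ)]
  have h1 := gs_le_one (t := ((4 : ℝ) ^ N)⁻¹) (by positivity) ξ
  have h2 := gs_pos ((4 : ℝ) ^ 0)⁻¹ ξ
  simp only [heat]
  linarith

lemma sum_sq_heat_le (N : ℕ) (ξ : Eu d) :
    ∑ n ∈ Finset.range N, (heat (n + 1) ξ - heat n ξ) ^ 2 ≤ 1 := by
  refine (Finset.sum_le_sum fun n _ => ?_).trans (sum_heat_sub_le N ξ)
  have h0 := heat_mono n ξ
  have h1 := gs_le_one (t := ((4 : ℝ) ^ (n + 1))⁻¹) (by positivity) ξ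
  have h2 := gs_pos ((4 : ℝ) ^ n)⁻¹ ξ
  have h3 : heat (n + 1) ξ - heat n ξ ≤ 1 := by simp only [heat]; linarith
  nlinarith

lemma sum_norm_sq_heat_le (N : ℕ) (ξ : Eu d) :
    ∑ n ∈ Finset.range N, ((2 : ℝ) ^ n)⁻¹ ^ 2 * ‖ξ‖ ^ 2 * heat n ξ ^ 2 ≤ 4 / 3 := by
  have := sum_heat_sub_le N ξ
  calc _ ≤ ∑ n ∈ Finset.range N, 4 / 3 * (heat (n + 1) ξ - heat n ξ) := by
        refine Finset.sum_le_sum fun n _ => ?_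
        have e : ((2 : ℝ) ^ n)⁻¹ ^ 2 * ‖ξ‖ ^ 2 = ‖ξ‖ ^ 2 / 4 ^ n := by
          rw [inv_pow, ← pow_mul, mul_comm n, pow_mul]; norm_num; ring
        rw [e]
        have h0 := mul_exp_neg_le (‖ξ‖ ^ 2 / 4 ^ n)
        rw [← heat_eq, ← heat_succ_eq] at h0
        refine le_trans ?_ h0
        have h1 := gs_le_one (t := ((4 : ℝ) ^ n)⁻¹) (by positivity) ξ
        have h2 := gs_pos ((4 : ℝ) ^ n)⁻¹ ξ
        gcongr
        simp only [heat]
        nlinarith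
    _ ≤ _ := by
        rw [← Finset.mul_sum]; linarith

lemma sum_sq_chi_sub_heat_le (N : ℕ) (ξ : Eu d) :
    ∑ n ∈ Finset.range N, (chi (n + 2) ξ - heat n ξ) ^ 2 ≤ 4 / 3 * Real.exp 64 := by
  have := sum_heat_sub_le N ξ
  have he := Real.exp_pos 64
  calc _ ≤ ∑ n ∈ Finset.range N, 4 / 3 * Real.exp 64 * (heat (n + 1) ξ - heat n ξ) := by
        refine Finset.sum_le_sum fun n _ => ?_
        have h0 := mul_exp_neg_le (‖ξ‖ ^ 2 / 4 ^ n)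
        rw [← heat_eq, ← heat_succ_eq] at h0
        set x := ‖ξ‖ ^ 2 / 4 ^ n with hx
        have hx0 : 0 ≤ x := by positivity
        have h1 : heat n ξ ≤ 1 := gs_le_one (t := ((4 : ℝ) ^ n)⁻¹) (by positivity) ξ
        have h2 : 0 < heat n ξ := gs_pos ((4 : ℝ) ^ n)⁻¹ ξ
        have h3 : 1 - x ≤ heat n ξ := by
          rw [heat_eq]; have := Real.add_one_le_exp (-x); linarith
        have hc0 : 0 ≤ chi ((n : ℤ) + 2) ξ := phi_nonneg _
        have hc1 : chi ((n : ℤ) + 2) ξ ≤ 1 := phi_le_one _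
        have h4 : Real.exp 64 * (4 / 3 * (heat (n + 1) ξ - heat n ξ)) ≥
          Real.exp 64 * (x * heat n ξ) := by gcongr
        have e2 : ‖ξ‖ ^ 2 = x * (2 ^ n) ^ 2 := by
          rw [hx, ← pow_mul, mul_comm n, pow_mul]; norm_num
        have key : (chi ((n : ℤ) + 2) ξ - heat n ξ) ^ 2 ≤ Real.exp 64 * (x * heat n ξ) := by
          rcases le_total x 64 with h64 | h64
          · have h5 : 1 ≤ Real.exp 64 * heat n ξ := by
              rw [heat_eq, ← Real.exp_add, Real.one_le_exp_iff]
              linarith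
            have h6 : (chi ((n : ℤ) + 2) ξ - heat n ξ) ^ 2 ≤ x := by
              rcases le_total x 16 with h16 | h16
              · have h7 : chi ((n : ℤ) + 2) ξ = 1 := by
                  refine chi_eq_one ?_
                  rw [zpow_add₀ two_ne_zero, zpow_natCast]
                  refine abs_le_of_sq_le_sq' ?_ (by positivity) |>.2
                  rw [e2]
                  have : (0 : ℝ) < (2 ^ n) ^ 2 := by positivity
                  norm_num
                  nlinarith
                rw [h7]
                nlinarith
              · nlinarith
            nlinarith
          · have h7 : chi ((n : ℤ) + 2) ξ = 0 := by
              refine chi_eq_zero ?_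
              rw [zpow_add₀ two_ne_zero, zpow_add₀ two_ne_zero, zpow_natCast]
              refine abs_le_of_sq_le_sq' ?_ (by positivity) |>.2
              rw [e2]
              have : (0 : ℝ) < (2 ^ n) ^ 2 := by positivity
              norm_num
              nlinarith
            rw [h7]
            have h8 : 1 ≤ Real.exp 64 := Real.one_le_exp_iff.2 (by norm_num)
            have h9 : heat n ξ ≤ x * heat n ξ := by nlinarith
            nlinarith
        linarith
    _ ≤ _ := by
        rw [← Finset.mul_sum]; nlinarith

lemma contDiffAt_gs_sub_inv {η : Eu d} (hη : η ≠ 0) :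
    ContDiffAt ℝ (⊤ : ℕ∞) (fun η : Eu d => (gs (1 / 2) η - gs 1 η)⁻¹) η := by
  refine ContDiffAt.inv ?_ ?_
  · unfold gs
    have h : ContDiff ℝ (⊤ : ℕ∞) fun η : Eu d => ‖η‖ ^ 2 := contDiff_norm_sq ℝ
    exact (((contDiff_const.mul h).neg.exp).sub ((contDiff_const.mul h).neg.exp)).contDiffAt
  · have h : 0 < ‖η‖ ^ 2 := by positivity
    have : gs 1 η < gs (1 / 2) η := Real.exp_lt_exp.2 (by linarith)
    linarith

lemma ann_zero_apply {a b k : ℕ} (hk : 1 ≤ k) : ann a b k (0 : Eu d) = 0 := by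
  rw [ann, if_neg (by lia), chi_eq_one, chi_eq_one, sub_self] <;> rw [norm_zero] <;> positivity

lemma sqNorm_mul_le_of_bdd {a : Eu d → ℂ} {B : ℝ} (ha : ∀ x, ‖a x‖ ≤ B) (v : Eu d → ℂ) :
    sqNorm (fun x => a x * v x) ≤ ENNReal.ofReal (B ^ 2) * sqNorm v := by
  have hB : 0 ≤ B := (norm_nonneg _).trans (ha 0)
  rw [← lintegral_const_mul' _ _ ENNReal.ofReal_ne_top]
  refine lintegral_mono fun x => ?_
  change ‖a x * v x‖ₑ ^ 2 ≤ _
  rw [enorm_mul, mul_pow, ENNReal.ofReal_pow hB, ← ofReal_norm (a x)]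
  have := ha x
  gcongr

lemma sqNorm_add_le {q : ℝ} (hq0 : 0 < q) (hq1 : q < 1) {u v : Eu d → ℂ} (hu : Continuous u)
    {f : Eu d → ℂ} (h : ∀ x, f x = u x + v x) :
    sqNorm f ≤ ENNReal.ofReal q⁻¹ * sqNorm u + ENNReal.ofReal (1 - q)⁻¹ * sqNorm v := by
  rw [← lintegral_const_mul' _ _ ENNReal.ofReal_ne_top,
    ← lintegral_const_mul' _ _ ENNReal.ofReal_ne_top, ← lintegral_add_left]
  · refine lintegral_mono fun x => ?_
    change ‖f x‖ₑ ^ 2 ≤ _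
    rw [h]
    exact enorm_add_sq_le hq0 hq1 _ _
  · have : Measurable fun x => ‖u x‖ₑ ^ 2 := hu.enorm.measurable.pow_const 2
    exact this.const_mul _

lemma sqNorm_add_le_two {u v : Eu d → ℂ} (hu : Continuous u)
    {f : Eu d → ℂ} (h : ∀ x, f x = u x + v x) :
    sqNorm f ≤ 2 * sqNorm u + 2 * sqNorm v := by
  have := sqNorm_add_le (q := 1 / 2) (by norm_num) (by norm_num) hu h
  norm_num at this
  exact this

theorem carleson_band (d : ℕ) (s : ℝ) : ∃ C : ℝ, 0 < C ∧
    ∀ (g h : Sw d) (G : ℝ), (∀ x, ‖g x‖ ≤ G) → ∀ N : ℕ,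
      ∑ m ∈ Finset.range N, sqNorm (fun x => mult (band s 0 1 m) g x * mult (heat m) h x) ≤
        ENNReal.ofReal (C * G ^ 2) * sqNorm h := by
  obtain ⟨B, hB, hgb⟩ := exists_good_band d s 0 1
  obtain ⟨A, hA, hga⟩ := exists_good_ann (d := d) s 0 1
    (θ := fun η : Eu d => (gs (1 / 2) η - gs 1 η)⁻¹) (fun η => by simp [gs])
    (fun η hη => contDiffAt_gs_sub_inv hη)
  set T := (3 : ℝ) ^ ((d : ℝ) / 2) with hT
  have hT0 : 0 < T := by positivity
  refine ⟨B ^ 2 + (36 * A ^ 2 * T + 32 * Real.pi ^ 2 * A ^ 2 * (4 / 3)), by positivity,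
    fun g h G hG N => ?_⟩
  have hG0 : 0 ≤ G := (norm_nonneg _).trans (hG 0)
  set w : ℕ → Sw d := fun m =>
    mult (fun ξ => gs (2 * ((4 : ℝ) ^ (m + 1))⁻¹) ξ - gs ((4 : ℝ) ^ m)⁻¹ ξ) g with hw
  have hw2 : ∀ m x, ‖w m x‖ ≤ 2 * G := fun m x => by
    have e : w m = mult (gs (2 * ((4 : ℝ) ^ (m + 1))⁻¹)) g - mult (gs ((4 : ℝ) ^ m)⁻¹) g :=
      mult_eq_of_fourier (σ := fun ξ => gs (2 * ((4 : ℝ) ^ (m + 1))⁻¹) ξ - gs ((4 : ℝ) ^ m)⁻¹ ξ)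
        ((gs_temperate (by positivity)).sub (gs_temperate (by positivity)))
        fun ξ => by
          rw [fourier_sub_apply, fourier_mult (gs_temperate (by positivity)),
            fourier_mult (gs_temperate (by positivity))]
          push_cast
          ring
    rw [e]
    refine (norm_sub_le _ _).trans ?_
    have h1 := norm_mult_gs_le (t := 2 * ((4 : ℝ) ^ (m + 1))⁻¹) (by positivity) hG x
    have h2 := norm_mult_gs_le (t := ((4 : ℝ) ^ m)⁻¹) (by positivity) hG x
    linarith
  set I : ℕ → ℝ≥0∞ := fun m => ∫⁻ ξ, ENNReal.ofReal (‖ξ‖ ^ 2) * ‖𝓕 (mult (heat m) h) ξ‖ₑ ^ 2 with hI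
  have hpos : ∀ m, 1 ≤ m → sqNorm (fun x => mult (band s 0 1 m) g x * mult (heat m) h x) ≤
      ENNReal.ofReal (2 * A ^ 2) * sqNorm (fun x => w m x * mult (heat m) h x) +
      ENNReal.ofReal (32 * Real.pi ^ 2 * A ^ 2 * G ^ 2) *
        (ENNReal.ofReal (((2 : ℝ) ^ m)⁻¹ ^ 2) * I m) := by
    intro m hm
    have hg := hga m hm
    have e : mult (band s 0 1 m) g = mult (fun ξ : Eu d => ((2 : ℝ) ^ m) ^ (-s) * jap s ξ * ann 0 1 m ξ *
        (gs (1 / 2) (((2 : ℝ) ^ m)⁻¹ • ξ) - gs 1 (((2 : ℝ) ^ m)⁻¹ • ξ))⁻¹) (w m) := by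
      rw [hw, mult_mult (τ := fun ξ => gs (2 * ((4 : ℝ) ^ (m + 1))⁻¹) ξ - gs ((4 : ℝ) ^ m)⁻¹ ξ)
        hg.temperate ((gs_temperate (by positivity)).sub
        (gs_temperate (by positivity)))]
      congr 1
      congr 1
      funext ξ
      rw [gs_smul, gs_smul]
      have e1 : 1 / 2 * (((2 : ℝ) ^ m)⁻¹) ^ 2 = 2 * ((4 : ℝ) ^ (m + 1))⁻¹ := by
        rw [inv_pow, ← pow_mul, mul_comm m, pow_mul, pow_succ (4 : ℝ), mul_inv]; norm_num; ring
      have e2 : 1 * (((2 : ℝ) ^ m)⁻¹) ^ 2 = ((4 : ℝ) ^ m)⁻¹ := by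
        rw [inv_pow, ← pow_mul, mul_comm m, pow_mul]; norm_num
      rw [e1, e2]
      by_cases hξ : ξ = 0
      · rw [hξ, band, ann_zero_apply hm]; ring
      · have hne : gs (2 * ((4 : ℝ) ^ (m + 1))⁻¹) ξ - gs ((4 : ℝ) ^ m)⁻¹ ξ ≠ 0 := by
          have h1 : 0 < ‖ξ‖ ^ 2 := by positivity
          have h2 : 0 < ((4 : ℝ) ^ (m + 1))⁻¹ := by positivity
          have : gs ((4 : ℝ) ^ m)⁻¹ ξ < gs (2 * ((4 : ℝ) ^ (m + 1))⁻¹) ξ := by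
            refine Real.exp_lt_exp.2 ?_
            rw [inv_four_pow m]
            nlinarith
          linarith
        rw [inv_mul_cancel_right₀ hne, band]
    rw [e]
    refine (sqNorm_mult_mul_le hg (by positivity) (hw2 m) (mult (heat m) h)).trans (le_of_eq ?_)
    rw [← mul_assoc (ENNReal.ofReal (32 * Real.pi ^ 2 * A ^ 2 * G ^ 2)),
      ← ENNReal.ofReal_mul (by positivity)]
    congr 3
    ring
  have hterm : ∀ m, sqNorm (fun x => mult (band s 0 1 m) g x * mult (heat m) h x) ≤
      (if m = 0 then ENNReal.ofReal (B ^ 2 * G ^ 2) * sqNorm h else 0) +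
      (ENNReal.ofReal (2 * A ^ 2) * sqNorm (fun x => w m x * mult (heat m) h x) +
      ENNReal.ofReal (32 * Real.pi ^ 2 * A ^ 2 * G ^ 2) *
        (ENNReal.ofReal (((2 : ℝ) ^ m)⁻¹ ^ 2) * I m)) := by
    intro m
    rcases Nat.eq_zero_or_pos m with hm | hm
    · rw [if_pos hm]
      refine le_add_right ?_
      refine (sqNorm_mul_le_of_bdd (norm_mult_good_le (hgb m) zero_le_two (by positivity) hG)
        _).trans ?_
      rw [mul_pow]
      gcongr
      have := sqNorm_mult_le (heat_temperate m) (C := 1) (fun ξ => by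
        have h1 := gs_le_one (t := ((4 : ℝ) ^ m)⁻¹) (by positivity) ξ
        have h2 := gs_pos ((4 : ℝ) ^ m)⁻¹ ξ
        simp only [heat]
        nlinarith) h
      simpa using this
    · rw [if_neg hm.ne', zero_add]
      exact hpos m hm
  have hIsum : ∑ m ∈ Finset.range N, ENNReal.ofReal (((2 : ℝ) ^ m)⁻¹ ^ 2) * I m ≤
      ENNReal.ofReal (4 / 3) * sqNorm h := by
    rw [← sqNorm_fourier h, ← lintegral_const_mul' _ _ ENNReal.ofReal_ne_top]
    simp only [hI]
    simp_rw [← lintegral_const_mul' _ _ ENNReal.ofReal_ne_top]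
    rw [← lintegral_finsetSum']
    · refine lintegral_mono fun ξ => ?_
      refine le_trans (le_of_eq ?_) (mul_le_mul_left
        (ENNReal.ofReal_le_ofReal (sum_norm_sq_heat_le N ξ)) (‖𝓕 h ξ‖ₑ ^ 2))
      rw [ENNReal.ofReal_sum_of_nonneg (fun _ _ => by positivity), Finset.sum_mul]
      refine Finset.sum_congr rfl fun m _ => ?_
      rw [fourier_mult (heat_temperate m), enorm_ofReal_mul_sq, ENNReal.ofReal_mul (by positivity),
        ENNReal.ofReal_mul (by positivity), mul_assoc, mul_assoc]
    · intro m _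
      have h1 : Measurable fun ξ : Eu d => ENNReal.ofReal (‖ξ‖ ^ 2) := by fun_prop
      have h2 : Measurable fun ξ : Eu d => ‖𝓕 (mult (heat m) h) ξ‖ₑ ^ 2 :=
        (𝓕 (mult (heat m) h)).continuous.enorm.measurable.pow_const 2
      exact ((h1.mul h2).const_mul _).aemeasurable
  calc _ ≤ ∑ m ∈ Finset.range N, ((if m = 0 then ENNReal.ofReal (B ^ 2 * G ^ 2) * sqNorm h else 0) +
      (ENNReal.ofReal (2 * A ^ 2) * sqNorm (fun x => w m x * mult (heat m) h x) +
      ENNReal.ofReal (32 * Real.pi ^ 2 * A ^ 2 * G ^ 2) *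
        (ENNReal.ofReal (((2 : ℝ) ^ m)⁻¹ ^ 2) * I m))) := Finset.sum_le_sum fun m _ => hterm m
    _ ≤ ENNReal.ofReal (B ^ 2 * G ^ 2) * sqNorm h +
        (ENNReal.ofReal (2 * A ^ 2) * (ENNReal.ofReal (18 * T * G ^ 2) * sqNorm h) +
        ENNReal.ofReal (32 * Real.pi ^ 2 * A ^ 2 * G ^ 2) * (ENNReal.ofReal (4 / 3) * sqNorm h)) := by
        rw [Finset.sum_add_distrib, Finset.sum_add_distrib, ← Finset.mul_sum, ← Finset.mul_sum]
        gcongr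
        · rw [Finset.sum_ite_eq']
          split_ifs
          · exact le_rfl
          · exact zero_le
        · exact carleson_gauss hG h N
    _ = _ := by
        rw [← mul_assoc, ← mul_assoc, ← ENNReal.ofReal_mul (by positivity),
          ← ENNReal.ofReal_mul (by positivity), ← add_mul, ← add_mul,
          ← ENNReal.ofReal_add (by positivity) (by positivity),
          ← ENNReal.ofReal_add (by positivity) (by positivity)]
        congr 2
        ring

lemma low_succ (r : ℝ) (n : ℕ) (ξ : Eu d) :
    low r (n + 1) ξ = (2 : ℝ) ^ (-r) * low r n ξ + band r 0 1 (n + 1) ξ := by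
  have e : ((2 : ℝ) ^ (n + 1)) ^ (-r) = 2 ^ (-r) * (2 ^ n) ^ (-r) := by
    rw [pow_succ', Real.mul_rpow (by positivity) (by positivity)]
  rw [low, low, band, ann, if_neg (by lia), e]
  have e1 : ((n + 1 : ℕ) : ℤ) - (1 : ℕ) = n := by push_cast; ring
  have e2 : ((n + 1 : ℕ) : ℤ) + (0 : ℕ) = (n + 1 : ℕ) := by push_cast; ring
  rw [e1, e2]
  ring

lemma sum_le_of_recursion {q : ℝ} (hq0 : 0 ≤ q) (hq1 : q < 1) {X Y : ℕ → ℝ≥0∞}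
    (h : ∀ n, X (n + 1) ≤ ENNReal.ofReal q * X n + Y n) (N : ℕ) :
    ∑ n ∈ Finset.range (N + 1), X n + ENNReal.ofReal (1 - q)⁻¹ * (ENNReal.ofReal q * X N) ≤
      ENNReal.ofReal (1 - q)⁻¹ * (X 0 + ∑ n ∈ Finset.range N, Y n) := by
  set K := ENNReal.ofReal (1 - q)⁻¹ with hK
  have h1 : 0 < 1 - q := by linarith
  have hKq : 1 + K * ENNReal.ofReal q = K := by
    rw [hK, ← ENNReal.ofReal_mul (by positivity), ← ENNReal.ofReal_one,
      ← ENNReal.ofReal_add zero_le_one (by positivity)]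
    congr 1
    field_simp
    ring
  have hX : ∀ n, X n + K * (ENNReal.ofReal q * X n) = K * X n := fun n => by
    conv_rhs => rw [← hKq]
    ring
  induction N with
  | zero => simp [hX]
  | succ N ih =>
    rw [Finset.sum_range_succ, add_assoc, hX]
    calc _ ≤ ∑ n ∈ Finset.range (N + 1), X n + K * (ENNReal.ofReal q * X N + Y N) := by
          gcongr; exact h N
      _ = ∑ n ∈ Finset.range (N + 1), X n + K * (ENNReal.ofReal q * X N) + K * Y N := by ring
      _ ≤ K * (X 0 + ∑ n ∈ Finset.range N, Y n) + K * Y N := by gcongr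
      _ = _ := by rw [Finset.sum_range_succ _ N]; ring

/-- The Carleson estimate for the low frequency truncations of `J ^ s g`. -/
theorem carleson_low (d : ℕ) {s : ℝ} (hs : 0 < s) : ∃ C : ℝ, 0 < C ∧
    ∀ (g h : Sw d) (G : ℝ), (∀ x, ‖g x‖ ≤ G) → ∀ N : ℕ,
      ∑ n ∈ Finset.range N, sqNorm (fun x => mult (low s n) g x * mult (chi (n + 2)) h x) ≤
        ENNReal.ofReal (C * G ^ 2) * sqNorm h := by
  obtain ⟨B, hB, hgb⟩ := carleson_band d s
  obtain ⟨_, _, hgb'⟩ := exists_good_band d s 0 1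
  obtain ⟨A, hA, hga⟩ := exists_good_low d (le_refl (0 : ℝ)) hs zero_le_two
  obtain ⟨D, hD, hgd⟩ := exists_good_chi d
  have hq1 := two_rpow_neg_lt_one hs
  have hq0 : (0 : ℝ) < 2 ^ (-s) := by positivity
  set q : ℝ := 2 ^ (-s) with hq
  have hq2 : 0 < 1 - q := by linarith
  set R := (1 - q)⁻¹ with hR
  have hR0 : 0 < R := by positivity
  set L := 4 / 3 * Real.exp 64 with hL
  have hL0 : 0 < L := by positivity
  refine ⟨2 * (R * (A ^ 2 + R * (2 * A ^ 2 + 2 * B))) + 2 * (A ^ 2 * L), by positivity,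
    fun g h G hG N => ?_⟩
  have hG0 : 0 ≤ G := (norm_nonneg _).trans (hG 0)
  have ha : ∀ n x, ‖mult (low s n) g x‖ ≤ A * G := fun n =>
    norm_mult_good_le (hga n) le_rfl (by positivity) hG
  have h2 : ∀ a : ℝ, (2 : ℝ≥0∞) * ENNReal.ofReal a = ENNReal.ofReal (2 * a) := fun a => by
    rw [ENNReal.ofReal_mul zero_le_two]; simp
  have hP : ∀ n, sqNorm (mult (heat n) h) ≤ sqNorm h := fun n => by
    have := sqNorm_mult_le (heat_temperate n) (C := 1) (fun ξ => by
      have h1 := gs_le_one (t := ((4 : ℝ) ^ n)⁻¹) (by positivity) ξ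
      have h2 := gs_pos ((4 : ℝ) ^ n)⁻¹ ξ
      simp only [heat]
      nlinarith) h
    simpa using this
  set σ : ℕ → Eu d → ℝ := fun n ξ => heat (n + 1) ξ - heat n ξ with hσ
  have hσt : ∀ n, (σ n).HasTemperateGrowth := fun n => (heat_temperate (n + 1)).sub (heat_temperate n)
  set τ : ℕ → Eu d → ℝ := fun n ξ => chi (n + 2) ξ - heat n ξ with hτ
  have hτt : ∀ n, (τ n).HasTemperateGrowth := fun n => ((hgd (n + 2)).temperate).sub (heat_temperate n)
  set X : ℕ → ℝ≥0∞ := fun n => sqNorm (fun x => mult (low s n) g x * mult (heat n) h x) with hX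
  set Z : ℕ → ℝ≥0∞ := fun n => sqNorm (fun x => mult (band s 0 1 n) g x * mult (heat n) h x) with hZ
  set Y : ℕ → ℝ≥0∞ := fun n => ENNReal.ofReal R *
    (2 * (ENNReal.ofReal ((A * G) ^ 2) * sqNorm (mult (σ n) h)) + 2 * Z (n + 1)) with hY
  have hrec : ∀ n, X (n + 1) ≤ ENNReal.ofReal q * X n + Y n := by
    intro n
    have e1 : mult (low s (n + 1)) g = q • mult (low s n) g + mult (band s 0 1 (n + 1)) g := by
      refine mult_eq_of_fourier (hga (n + 1)).temperate fun ξ => ?_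
      rw [fourier_add_apply, fourier_smul_apply, fourier_mult (hga n).temperate,
        fourier_mult (hgb' (n + 1)).temperate, low_succ]
      push_cast
      ring
    have e2 : mult (heat (n + 1)) h = mult (heat n) h + mult (σ n) h := by
      refine mult_eq_of_fourier (heat_temperate (n + 1)) fun ξ => ?_
      rw [fourier_add_apply, fourier_mult (heat_temperate n), fourier_mult (hσt n)]
      push_cast [hσ]
      ring
    have h1 := sqNorm_add_le hq0 hq1 (u := fun x => q * (mult (low s n) g x * mult (heat n) h x))
      (v := fun x => q * mult (low s n) g x * mult (σ n) h x +
        mult (band s 0 1 (n + 1)) g x * mult (heat (n + 1)) h x)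
      (f := fun x => mult (low s (n + 1)) g x * mult (heat (n + 1)) h x)
      (by fun_prop) (fun x => by
        have e3 : mult (low s (n + 1)) g x = q * mult (low s n) g x + mult (band s 0 1 (n + 1)) g x := by
          rw [e1, add_apply, smul_apply, Complex.real_smul]
        have e4 : mult (heat (n + 1)) h x = mult (heat n) h x + mult (σ n) h x := by
          rw [e2, add_apply]
        rw [e3]
        nth_rewrite 1 [e4]
        rw [e4]
        ring)
    refine h1.trans (add_le_add ?_ ?_)
    · have : ∀ z : ℂ, ‖(q : ℂ) * z‖ₑ ^ 2 = ENNReal.ofReal (q ^ 2) * ‖z‖ₑ ^ 2 :=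
        enorm_ofReal_mul_sq q
      simp only [sqNorm, this]
      rw [lintegral_const_mul' _ _ ENNReal.ofReal_ne_top, ← mul_assoc,
        ← ENNReal.ofReal_mul (by positivity)]
      refine mul_le_mul_left (ENNReal.ofReal_le_ofReal (le_of_eq ?_)) _
      field_simp
    · refine mul_le_mul_right ?_ _
      refine (sqNorm_add_le_two (u := fun x => q * mult (low s n) g x * mult (σ n) h x)
        (v := fun x => mult (band s 0 1 (n + 1)) g x * mult (heat (n + 1)) h x)
        (by fun_prop) (fun x => rfl)).trans ?_
      refine add_le_add (mul_le_mul_right ?_ _) le_rfl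
      refine sqNorm_mul_le_of_bdd (fun x => ?_) _
      rw [norm_mul, Complex.norm_real, Real.norm_of_nonneg hq0.le]
      exact (mul_le_of_le_one_left (norm_nonneg _) hq1.le).trans (ha n x)
  have hXsum : ∀ N, ∑ n ∈ Finset.range N, X n ≤
      ENNReal.ofReal (R * (A ^ 2 + R * (2 * A ^ 2 + 2 * B)) * G ^ 2) * sqNorm h := by
    intro N
    calc ∑ n ∈ Finset.range N, X n ≤ ∑ n ∈ Finset.range (N + 1), X n :=
          Finset.sum_le_sum_of_subset (Finset.range_subset_range.2 N.le_succ)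
      _ ≤ _ := le_self_add.trans (sum_le_of_recursion hq0.le hq1 hrec N)
      _ ≤ ENNReal.ofReal R * (ENNReal.ofReal ((A * G) ^ 2) * sqNorm h + ENNReal.ofReal R *
          (2 * (ENNReal.ofReal ((A * G) ^ 2) * (ENNReal.ofReal 1 * sqNorm h)) +
            2 * (ENNReal.ofReal (B * G ^ 2) * sqNorm h))) := by
          refine mul_le_mul_right (add_le_add ?_ ?_) _
          · exact (sqNorm_mul_le_of_bdd (ha 0) _).trans (mul_le_mul_right (hP 0) _)
          · rw [hY, ← Finset.mul_sum, Finset.sum_add_distrib, ← Finset.mul_sum, ← Finset.mul_sum,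
              ← Finset.mul_sum]
            refine mul_le_mul_right (add_le_add (mul_le_mul_right (mul_le_mul_right ?_ _) _)
              (mul_le_mul_right ?_ _)) _
            · exact sum_sqNorm_mult_le _ (fun n _ => hσt n) (sum_sq_heat_le N) h
            · refine le_trans ?_ (hgb g h G hG (N + 1))
              rw [Finset.sum_range_succ']
              exact le_self_add
      _ = _ := by
          have e : R * (A ^ 2 + R * (2 * A ^ 2 + 2 * B)) * G ^ 2 =
            R * ((A * G) ^ 2 + R * (2 * (A * G) ^ 2 + 2 * (B * G ^ 2))) := by ring
          rw [e, ENNReal.ofReal_mul hR0.le, ENNReal.ofReal_add (by positivity) (by positivity),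
            ENNReal.ofReal_mul hR0.le, ENNReal.ofReal_add (by positivity) (by positivity),
            ← h2, ← h2, ENNReal.ofReal_one]
          ring
  calc _ ≤ ∑ n ∈ Finset.range N, (2 * X n +
        2 * (ENNReal.ofReal ((A * G) ^ 2) * sqNorm (mult (τ n) h))) := by
        refine Finset.sum_le_sum fun n _ => ?_
        refine (sqNorm_add_le_two (u := fun x => mult (low s n) g x * mult (heat n) h x)
          (v := fun x => mult (low s n) g x * mult (τ n) h x) (by fun_prop) (fun x => ?_)).trans
          (add_le_add le_rfl (mul_le_mul_right (sqNorm_mul_le_of_bdd (ha n) _) _))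
        have e2 : mult (chi (n + 2)) h = mult (heat n) h + mult (τ n) h := by
          refine mult_eq_of_fourier (hgd (n + 2)).temperate fun ξ => ?_
          rw [fourier_add_apply, fourier_mult (heat_temperate n), fourier_mult (hτt n)]
          push_cast [hτ]
          ring
        rw [e2, add_apply, mul_add]
    _ ≤ 2 * (ENNReal.ofReal (R * (A ^ 2 + R * (2 * A ^ 2 + 2 * B)) * G ^ 2) * sqNorm h) +
        2 * (ENNReal.ofReal ((A * G) ^ 2) * (ENNReal.ofReal L * sqNorm h)) := by
        rw [Finset.sum_add_distrib, ← Finset.mul_sum, ← Finset.mul_sum, ← Finset.mul_sum]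
        refine add_le_add (mul_le_mul_right (hXsum N) _)
          (mul_le_mul_right (mul_le_mul_right ?_ _) _)
        exact sum_sqNorm_mult_le _ (fun n _ => hτt n) (sum_sq_chi_sub_heat_le N) h
    _ = _ := by
        have e : (2 * (R * (A ^ 2 + R * (2 * A ^ 2 + 2 * B))) + 2 * (A ^ 2 * L)) * G ^ 2 =
          2 * (R * (A ^ 2 + R * (2 * A ^ 2 + 2 * B)) * G ^ 2) + 2 * ((A * G) ^ 2 * L) := by ring
        rw [e, ENNReal.ofReal_add (by positivity) (by positivity), ← h2, ← h2,
          ENNReal.ofReal_mul (by positivity) (p := (A * G) ^ 2)]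
        ring

end Carleson

section Rep
variable {d : ℕ}

/-- The operators `T` and `T'` are transposes of each other, given by a kernel at scale `1 / ρ`. -/
def RepS (δ ρ A : ℝ) (T T' : Sw d → Sw d) : Prop :=
  ∃ k : Eu d → Eu d → ℂ, SchurKernel δ ρ (ENNReal.ofReal A) k ∧ (∀ F, ⇑(T F) = kint k F) ∧
    ∀ F, ⇑(T' F) = kint (fun x y => k y x) F

/-- As `RepS`, with a kernel that is Lipschitz in its first variable. -/
def RepL (δ ρ A : ℝ) (T T' : Sw d → Sw d) : Prop :=
  ∃ k : Eu d → Eu d → ℂ, SchurKernel δ ρ (ENNReal.ofReal A) k ∧ (∀ F, ⇑(T F) = kint k F) ∧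
    (∀ F, ⇑(T' F) = kint (fun x y => k y x) F) ∧ LipRow ρ (ENNReal.ofReal A) k

/-- As `RepS`, with a kernel that is Lipschitz in both variables. -/
def RepC (δ ρ A : ℝ) (T T' : Sw d → Sw d) : Prop :=
  ∃ k : Eu d → Eu d → ℂ, ScaledKernel δ ρ (ENNReal.ofReal A) k ∧ (∀ F, ⇑(T F) = kint k F) ∧
    ∀ F, ⇑(T' F) = kint (fun x y => k y x) F

variable {δ ρ A B : ℝ} {T T' S S' : Sw d → Sw d}

lemma RepS.swap (h : RepS δ ρ A T T') : RepS δ ρ A T' T := by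
  obtain ⟨k, h1, h2, h3⟩ := h
  exact ⟨_, h1.swap, h3, h2⟩

lemma RepC.repL (h : RepC δ ρ A T T') : RepL δ ρ A T T' := by
  obtain ⟨k, h1, h2, h3⟩ := h
  exact ⟨k, h1.schur, h2, h3, h1.lipRow⟩

lemma RepC.mono (h : RepC δ ρ A T T') (hAB : A ≤ B) : RepC δ ρ B T T' := by
  obtain ⟨k, h1, h2, h3⟩ := h
  have h0 := ENNReal.ofReal_le_ofReal hAB
  exact ⟨k, ⟨h1.meas, h1.bdd, fun y => (h1.col y).trans h0, fun y => (h1.row y).trans h0,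
    fun y y' => (h1.lipCol y y').trans (mul_le_mul_left h0 _),
    fun y y' => (h1.lipRow y y').trans (mul_le_mul_left h0 _)⟩, h2, h3⟩

lemma kint_kcomp_rep {a b : Eu d → Eu d → ℂ} (ha : SchurKernel δ ρ (ENNReal.ofReal A) a)
    (hb : SchurKernel δ ρ (ENNReal.ofReal B) b) (hδ : 0 ≤ δ) (hρ : 0 ≤ ρ)
    (h1 : ∀ F, ⇑(T F) = kint a F) (h2 : ∀ F, ⇑(S F) = kint b F) (F : Sw d) :
    ⇑(T (S F)) = kint (kcomp a b) F := by
  rw [SchurKernel.kint_kcomp ha hb hδ hρ ENNReal.ofReal_ne_top F.integrable, h1, h2]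

lemma RepL.comp (h : RepL δ ρ A T T') (h' : RepS δ ρ B S S') (hδ : 0 ≤ δ) (hρ : 0 ≤ ρ)
    (hA : 0 ≤ A) :
    RepL δ ρ (A * B) (fun F => T (S F)) (fun F => S' (T' F)) := by
  obtain ⟨a, a1, a2, a3, a4⟩ := h
  obtain ⟨b, b1, b2, b3⟩ := h'
  refine ⟨kcomp a b, ?_, kint_kcomp_rep a1 b1 hδ hρ a2 b2, ?_, ?_⟩
  · rw [ENNReal.ofReal_mul hA]
    exact a1.comp b1 hδ hρ ENNReal.ofReal_ne_top ENNReal.ofReal_ne_top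
  · rw [kcomp_swap]
    exact kint_kcomp_rep b1.swap a1.swap hδ hρ b3 a3
  · rw [ENNReal.ofReal_mul hA]
    exact SchurKernel.lipRow_comp a1 b1 hδ hρ ENNReal.ofReal_ne_top a4

lemma RepL.comp_scaled (h : RepL δ ρ A T T') (h' : RepL δ ρ B S' S) (hδ : 0 ≤ δ) (hρ : 0 ≤ ρ)
    (hA : 0 ≤ A) :
    RepC δ ρ (A * B) (fun F => T (S F)) (fun F => S' (T' F)) := by
  obtain ⟨a, a1, a2, a3, a4⟩ := h
  obtain ⟨b, b1, b2, b3, b4⟩ := h'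
  refine ⟨kcomp a (fun x y => b y x), ?_, kint_kcomp_rep a1 b1.swap hδ hρ a2 b3, ?_⟩
  · rw [ENNReal.ofReal_mul hA]
    exact SchurKernel.comp_scaled a1 b1.swap hδ hρ ENNReal.ofReal_ne_top ENNReal.ofReal_ne_top a4 b4
  · rw [kcomp_swap]
    exact kint_kcomp_rep b1 a1.swap hδ hρ b2 a3

lemma RepL.mul_right (h : RepL δ ρ A T T') (hA : 0 ≤ A) (m : Sw d) {N : ℝ} (hN : ∀ x, ‖m x‖ ≤ N) :
    RepL δ ρ (A * N) (fun F => T (prodS m F)) (fun F => prodS m (T' F)) := by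
  obtain ⟨a, a1, a2, a3, a4⟩ := h
  refine ⟨fun x y => a x y * m y, ?_, fun F => ?_, fun F => ?_, ?_⟩
  · rw [ENNReal.ofReal_mul hA]
    exact a1.mul_right m.continuous.measurable hN
  · rw [a2]
    funext x
    simp only [kint, prodS_apply, mul_assoc]
  · funext x
    rw [prodS_apply, a3]
    simp only [kint]
    rw [← integral_const_mul]
    exact integral_congr_ae (ae_of_all _ fun y => by ring)
  · rw [ENNReal.ofReal_mul hA]
    exact a4.mul_right hN

lemma Good.repC {σ : Eu d → ℝ} (h : Good δ A ρ σ) (hρ : 0 < ρ) :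
    RepC δ ρ A (mult σ) (mult σ) := by
  obtain ⟨κ, h1, h2, -, h4⟩ := h.exists_kernel le_rfl hρ
  refine ⟨_, h4, mult_eq_kint h.temperate h1, fun F => ?_⟩
  rw [mult_eq_kint h.temperate h1]
  funext x
  simp only [kint]
  refine integral_congr_ae (ae_of_all _ fun y => ?_)
  simp only [← h2 (x - y), neg_sub]

/-- A product sandwiched between two frequency localisations. -/
lemma Good.repC_sandwich {σ τ : Eu d → ℝ} (h : Good δ A ρ σ) (h' : Good δ B ρ τ) (hδ : 0 ≤ δ)
    (hρ : 0 < ρ) (m : Sw d) {N : ℝ} (hN : ∀ x, ‖m x‖ ≤ N) :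
    RepC δ ρ (A * (B * N)) (fun F => mult σ (prodS m (mult τ F)))
      (fun F => mult τ (prodS m (mult σ F))) :=
  RepL.comp_scaled (S := fun F => prodS m (mult τ F)) (S' := fun F => mult τ (prodS m F))
    (h.repC hρ).repL ((h'.repC hρ).repL.mul_right h'.nonneg m hN) hδ hρ.le h.nonneg

lemma kint_sum_rep {J : Finset ℕ} {k : ℕ → Eu d → Eu d → ℂ}
    (hm : ∀ j ∈ J, Measurable (Function.uncurry (k j))) (hb : ∀ j ∈ J, ∃ M : ℝ, ∀ x y, ‖k j x y‖ ≤ M)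
    {T : ℕ → Sw d → Sw d} (h : ∀ j ∈ J, ∀ F, ⇑(T j F) = kint (k j) F) (F : Sw d) :
    ⇑(∑ j ∈ J, T j F : Sw d) = kint (fun x y => ∑ j ∈ J, k j x y) F := by
  funext x
  rw [sum_apply]
  simp only [kint, Finset.sum_mul]
  rw [integral_finsetSum]
  · exact Finset.sum_congr rfl fun j hj => by rw [h j hj]; rfl
  · intro j hj
    obtain ⟨M, hM⟩ := hb j hj
    exact integrable_kernel_mul (hm j hj) hM F.integrable x

/-- Boundedness on `L^p` of a sum of operators at dyadic scales, given a bound on `L^2` for the sum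
or for its transpose. -/
lemma exists_eLpNorm_sum_le (hd : 0 < d) (hδ : 0 < δ) {p : ℝ} (hp : 1 < p) :
    ∃ C : ℝ, 0 < C ∧ ∀ (A : ℝ), 0 < A → ∀ (J : Finset ℕ) (T T' : ℕ → Sw d → Sw d),
      (∀ j ∈ J, RepC δ (2 ^ j) A (T j) (T' j)) →
      ((∀ F, sqNorm (∑ j ∈ J, T j F : Sw d) ≤ ENNReal.ofReal (A ^ 2) * sqNorm F) ∨
        (∀ F, sqNorm (∑ j ∈ J, T' j F : Sw d) ≤ ENNReal.ofReal (A ^ 2) * sqNorm F)) →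
      ∀ F : Sw d, eLpNorm (∑ j ∈ J, T j F : Sw d) (ENNReal.ofReal p) volume ≤
        ENNReal.ofReal (C * A) * eLpNorm F (ENNReal.ofReal p) volume := by
  obtain ⟨C, hC, h⟩ := exists_lintegral_rpow_sum_le hd hδ hp
  have hp0 : 0 < p := zero_lt_one.trans hp
  have hCp : C ^ p⁻¹ ≠ ∞ := ENNReal.rpow_ne_top_of_nonneg (by positivity) hC
  refine ⟨(C ^ p⁻¹).toReal + 1, by positivity, fun A hA J T T' hT hL F => ?_⟩
  choose! k hk1 hk2 hk3 using hT
  have e1 := kint_sum_rep (fun j hj => (hk1 j hj).meas) (fun j hj => (hk1 j hj).bdd) hk2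
  have e2 := kint_sum_rep (fun j hj => (hk1 j hj).swap.meas) (fun j hj => (hk1 j hj).swap.bdd) hk3
  have hL' : (∀ F : Sw d,
        sqNorm (kint (fun x y => ∑ j ∈ J, k j x y) F) ≤ ENNReal.ofReal A ^ 2 * sqNorm F) ∨
      (∀ F : Sw d,
        sqNorm (kint (fun x y => ∑ j ∈ J, k j y x) F) ≤ ENNReal.ofReal A ^ 2 * sqNorm F) := by
    rw [← ENNReal.ofReal_pow hA.le]
    refine hL.imp (fun h F => ?_) (fun h F => ?_)
    · rw [← e1 F]; exact h F
    · rw [← e2 F]; exact h F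
  have hc := (∑ j ∈ J, T j F : Sw d).continuous
  rw [e1 F] at hc
  have h1 := h A hA J k hk1 hL' F F.continuous F.integrable (exists_norm_le F) hc
  rw [← e1 F] at h1
  have hpt : ENNReal.ofReal p ≠ ∞ := ENNReal.ofReal_ne_top
  have hp00 : ENNReal.ofReal p ≠ 0 := by simpa using hp0
  rw [eLpNorm_eq_lintegral_rpow_enorm_toReal hp00 hpt, eLpNorm_eq_lintegral_rpow_enorm_toReal hp00 hpt,
    ENNReal.toReal_ofReal hp0.le, one_div]
  calc _ ≤ (C * ENNReal.ofReal A ^ p * ∫⁻ x, ‖F x‖ₑ ^ p) ^ p⁻¹ :=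
        ENNReal.rpow_le_rpow h1 (by positivity)
    _ = C ^ p⁻¹ * ENNReal.ofReal A * (∫⁻ x, ‖F x‖ₑ ^ p) ^ p⁻¹ := by
        rw [ENNReal.mul_rpow_of_nonneg _ _ (by positivity), ENNReal.mul_rpow_of_nonneg _ _ (by positivity),
          ← ENNReal.rpow_mul, mul_inv_cancel₀ hp0.ne', ENNReal.rpow_one]
    _ ≤ _ := by
        refine mul_le_mul_left ?_ _
        rw [ENNReal.ofReal_mul (by positivity)]
        refine mul_le_mul_left ?_ _
        rw [← ENNReal.ofReal_toReal hCp]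
        exact ENNReal.ofReal_le_ofReal (by simp)

end Rep

section Terms
variable {d : ℕ}

/-- A scaled commutator of a multiplier with a Lipschitz function. -/
lemma Good.repS_commutator {δ A ρ : ℝ} {σ : Eu d → ℝ} (h : Good (1 + δ) A ρ σ)
    (hρ : 0 < ρ) (m : Sw d) {L : ℝ} (hL : ∀ x y, ‖m x - m y‖ ≤ L * dist x y) (hL0 : 0 ≤ L) :
    RepS δ ρ (A * L) (fun F => ρ • (mult σ (prodS m F) - prodS m (mult σ F)))
      (fun F => ρ • (prodS m (mult σ F) - mult σ (prodS m F))) := by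
  obtain ⟨κ, hκ, hev, h1, hsc⟩ := h.exists_kernel (le_refl (1 + δ)) hρ
  have hA := h.nonneg
  obtain ⟨M, hM⟩ := exists_norm_le m
  have hM0 : 0 ≤ M := (norm_nonneg _).trans (hM 0)
  have hsw : ∀ x y, κ (x - y) = κ (y - x) := fun x y => by rw [← hev, neg_sub]
  set k : Eu d → Eu d → ℂ := fun x y => ρ * (κ (x - y) * (m y - m x)) with hk
  have hm : Measurable (Function.uncurry k) := by
    have m1 : Measurable fun z : Eu d × Eu d => κ (z.1 - z.2) := hsc.meas
    have m2 : Measurable fun z : Eu d × Eu d => m z.2 - m z.1 :=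
      (m.continuous.measurable.comp measurable_snd).sub (m.continuous.measurable.comp measurable_fst)
    exact (m1.mul m2).const_mul (ρ : ℂ)
  have hb : ∃ N : ℝ, ∀ x y, ‖k x y‖ ≤ N := by
    obtain ⟨N, hN⟩ := hsc.bdd
    refine ⟨ρ * (N * (M + M)), fun x y => ?_⟩
    rw [hk, norm_mul, norm_mul, Complex.norm_real, Real.norm_of_nonneg hρ.le]
    have := norm_sub_le_of_le (hM y) (hM x)
    have := hN x y
    have : 0 ≤ N := (norm_nonneg _).trans this
    gcongr
  have hrow : ∀ x, ∫⁻ y, ‖k x y‖ₑ * wt δ ρ x y ≤ ENNReal.ofReal (A * L) := by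
    intro x
    calc ∫⁻ y, ‖k x y‖ₑ * wt δ ρ x y
        ≤ ∫⁻ y, (fun u => ENNReal.ofReal L * (‖κ u‖ₑ * ENNReal.ofReal ((1 + ρ * ‖u‖) ^ (1 + δ))))
          (x - y) := by
          refine lintegral_mono fun y => ?_
          have hr : 0 < 1 + ρ * ‖x - y‖ := by positivity
          simp only [hk, wt, dist_eq_norm]
          rw [← ofReal_norm, ← ofReal_norm, norm_mul, norm_mul, Complex.norm_real,
            Real.norm_of_nonneg hρ.le, ← ENNReal.ofReal_mul (by positivity),
            ← ENNReal.ofReal_mul (by positivity), ← ENNReal.ofReal_mul hL0, Real.rpow_add hr,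
            Real.rpow_one]
          refine ENNReal.ofReal_le_ofReal ?_
          have h2 := hL y x
          rw [dist_eq_norm, norm_sub_rev y x] at h2
          calc ρ * (‖κ (x - y)‖ * ‖m y - m x‖) * (1 + ρ * ‖x - y‖) ^ δ
              ≤ ρ * (‖κ (x - y)‖ * (L * ‖x - y‖)) * (1 + ρ * ‖x - y‖) ^ δ := by gcongr
            _ = L * (‖κ (x - y)‖ * ((ρ * ‖x - y‖) * (1 + ρ * ‖x - y‖) ^ δ)) := by ring
            _ ≤ _ := by gcongr; linarith
      _ = ∫⁻ u, ENNReal.ofReal L * (‖κ u‖ₑ * ENNReal.ofReal ((1 + ρ * ‖u‖) ^ (1 + δ))) :=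
          lintegral_sub_left_eq_self (fun u => ENNReal.ofReal L *
            (‖κ u‖ₑ * ENNReal.ofReal ((1 + ρ * ‖u‖) ^ (1 + δ)))) x
      _ ≤ _ := by
          rw [lintegral_const_mul' _ _ ENNReal.ofReal_ne_top, mul_comm A, ENNReal.ofReal_mul hL0]
          exact mul_le_mul_right h1 _
  have hks : ∀ x y, ‖k x y‖ₑ = ‖k y x‖ₑ := fun x y => by
    simp only [hk]
    rw [hsw x y, ← neg_sub (m x) (m y), mul_neg, mul_neg, enorm_neg]
  have hinteg : ∀ (F : Sw d) x, Integrable fun y => κ (x - y) * F y := fun F x => by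
    obtain ⟨N, hN⟩ := hsc.bdd
    exact integrable_kernel_mul hsc.meas hN F.integrable x
  have hrep : ∀ (F : Sw d) x, mult σ (prodS m F) x - m x * mult σ F x =
      ∫ y, κ (x - y) * (m y - m x) * F y := by
    intro F x
    rw [mult_apply_eq h.temperate hκ, mult_apply_eq h.temperate hκ, ← integral_const_mul,
      ← integral_sub (hinteg _ x) ((hinteg F x).const_mul _)]
    refine integral_congr_ae (ae_of_all _ fun y => ?_)
    simp only [prodS_apply]
    ring
  refine ⟨k, ⟨hm, hb, fun y => ?_, hrow⟩, fun F => ?_, fun F => ?_⟩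
  · simp only [hks _ y, wt_comm _ _ _ y]
    exact hrow y
  · funext x
    rw [smul_apply, sub_apply, prodS_apply, hrep, kint, Complex.real_smul, ← integral_const_mul]
    refine integral_congr_ae (ae_of_all _ fun y => ?_)
    simp only [hk]
    ring
  · funext x
    rw [smul_apply, sub_apply, prodS_apply, ← neg_sub, hrep, kint, Complex.real_smul,
      ← integral_neg, ← integral_const_mul]
    refine integral_congr_ae (ae_of_all _ fun y => ?_)
    simp only [hk, hsw x y]
    ring

lemma sum_range_add_le {f : ℕ → ℝ} {C : ℝ} (h : ∀ J : Finset ℕ, ∑ j ∈ J, f j ≤ C) (c N : ℕ) :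
    ∑ j ∈ Finset.range N, f (j + c) ≤ C := by
  have := h ((Finset.range N).map (addRightEmbedding c))
  simpa using this

lemma Good.shift {w A : ℝ} {σ : ℕ → Eu d → ℝ} (h : ∀ n : ℕ, Good w A (2 ^ n) (σ n)) (hw : 0 ≤ w)
    (c k : ℕ) : Good w (A * 2 ^ c) (2 ^ k) (σ (k + c)) := by
  have h1 := (h (k + c)).downscale hw (ρ' := 2 ^ k) (by positivity)
    (pow_le_pow_right₀ one_le_two (by lia))
  rwa [pow_add, mul_div_cancel_left₀ _ (by positivity)] at h1

lemma exists_commutator_le (hd : 0 < d) (s : ℝ) {p : ℝ} (hp : 1 < p) : ∃ C : ℝ, 0 < C ∧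
    ∀ (N : ℕ) (f : ℕ → Sw d) (L : ℝ), 0 < L → (∀ m x y, ‖f m x - f m y‖ ≤ L * dist x y) →
    ∀ F : Sw d, eLpNorm (∑ m ∈ Finset.range N, mult (band 0 2 3 (m + 3)) ((2 : ℝ) ^ m •
      (mult (band s 2 3 (m + 3)) (prodS (f m) (mult (band (1 - s) 0 1 (m + 3)) F)) -
        prodS (f m) (mult (band s 2 3 (m + 3)) (mult (band (1 - s) 0 1 (m + 3)) F)))) : Sw d)
      (ENNReal.ofReal p) volume ≤ ENNReal.ofReal (C * L) * eLpNorm F (ENNReal.ofReal p) volume := by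
  obtain ⟨C, hC, hb⟩ := exists_eLpNorm_sum_le hd zero_lt_one hp
  obtain ⟨A₁, hA₁, g₁⟩ := exists_good_band d 0 2 3
  obtain ⟨A₂, hA₂, g₂⟩ := exists_good_band d s 2 3
  obtain ⟨A₃, hA₃, g₃⟩ := exists_good_band d (1 - s) 0 1
  obtain ⟨C₁, hC₁, q₁⟩ := exists_sum_band_sq_le d 0 2 3
  obtain ⟨C₃, hC₃, q₃⟩ := exists_sum_band_sq_le d (1 - s) 0 1
  have k₁ := fun m => Good.shift g₁ zero_le_two 3 m
  have k₂ := fun m => Good.shift g₂ zero_le_two 3 m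
  have k₃ := fun m => Good.shift g₃ zero_le_two 3 m
  set B₁ := A₁ * 2 ^ 3
  set B₂ := A₂ * 2 ^ 3
  set B₃ := A₃ * 2 ^ 3
  have hB₁ : 0 < B₁ := by positivity
  have hB₂ : 0 < B₂ := by positivity
  have hB₃ : 0 < B₃ := by positivity
  set K := B₁ * (B₃ * B₂) + (C₁ * C₃ + 1) * B₂ with hK
  have hK0 : 0 < K := by positivity
  refine ⟨C * K, by positivity, fun N f L hL hf F => ?_⟩
  rw [mul_assoc]
  have hS : ∀ m, RepS 1 (2 ^ m) (B₂ * L)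
      (fun F => (2 : ℝ) ^ m • (mult (band s 2 3 (m + 3)) (prodS (f m) F) -
        prodS (f m) (mult (band s 2 3 (m + 3)) F)))
      (fun F => (2 : ℝ) ^ m • (prodS (f m) (mult (band s 2 3 (m + 3)) F) -
        mult (band s 2 3 (m + 3)) (prodS (f m) F))) := fun m =>
    Good.repS_commutator (by norm_num; exact k₂ m) (by positivity) (f m) (hf m) hL.le
  refine hb (K * L) (by positivity) (Finset.range N)
    (fun m F => mult (band 0 2 3 (m + 3)) ((2 : ℝ) ^ m •
      (mult (band s 2 3 (m + 3)) (prodS (f m) (mult (band (1 - s) 0 1 (m + 3)) F)) -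
        prodS (f m) (mult (band s 2 3 (m + 3)) (mult (band (1 - s) 0 1 (m + 3)) F)))))
    (fun m F => mult (band (1 - s) 0 1 (m + 3)) ((2 : ℝ) ^ m •
      (prodS (f m) (mult (band s 2 3 (m + 3)) (mult (band 0 2 3 (m + 3)) F)) -
        mult (band s 2 3 (m + 3)) (prodS (f m) (mult (band 0 2 3 (m + 3)) F)))))
    (fun m _ => ?_) (Or.inl fun F => ?_) F
  · have hρ : (0 : ℝ) < 2 ^ m := by positivity
    have h1 := RepL.comp_scaled (((k₁ m).weaken one_le_two hρ.le).repC hρ).repL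
      ((((k₃ m).weaken one_le_two hρ.le).repC hρ).repL.comp (hS m).swap zero_le_one hρ.le hB₃.le)
      zero_le_one hρ.le hB₁.le
    refine h1.mono ?_
    rw [← mul_assoc B₃, ← mul_assoc B₁]
    refine mul_le_mul_of_nonneg_right ?_ hL.le
    rw [hK]
    have : 0 ≤ (C₁ * C₃ + 1) * B₂ := by positivity
    linarith
  · have h2 : ∀ m ∈ Finset.range N, (band 0 2 3 (m + 3) : Eu d → ℝ).HasTemperateGrowth :=
      fun m _ => (k₁ m).temperate
    refine (sqNorm_sum_mult_le _ h2 (fun ξ => sum_range_add_le (fun J => q₁ J ξ) 3 N) _).trans ?_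
    have h3 := sum_sqNorm_mult_le (Finset.range N) (fun m _ => (k₃ m).temperate)
      (fun ξ => sum_range_add_le (fun J => q₃ J ξ) 3 N) F
    have h4 : ∀ m, ∀ v : Sw d, sqNorm ((2 : ℝ) ^ m • (mult (band s 2 3 (m + 3)) (prodS (f m) v) -
        prodS (f m) (mult (band s 2 3 (m + 3)) v)) : Sw d) ≤
        ENNReal.ofReal (B₂ * L) ^ 2 * sqNorm v := by
      intro m v
      obtain ⟨k, e1, e2, -⟩ := hS m
      have := e1.sqNorm_kint_le zero_le_one (by positivity) ENNReal.ofReal_ne_top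
        (f := v) v.continuous.aestronglyMeasurable
      rwa [← e2] at this
    calc _ ≤ ENNReal.ofReal C₁ * ∑ m ∈ Finset.range N, ENNReal.ofReal (B₂ * L) ^ 2 *
          sqNorm (mult (band (1 - s) 0 1 (m + 3)) F) :=
          mul_le_mul_right (Finset.sum_le_sum fun m _ => h4 m _) _
      _ = ENNReal.ofReal (C₁ * (B₂ * L) ^ 2) * ∑ m ∈ Finset.range N,
          sqNorm (mult (band (1 - s) 0 1 (m + 3)) F) := by
          rw [← Finset.mul_sum, ← mul_assoc, ENNReal.ofReal_mul hC₁.le, ENNReal.ofReal_pow (by positivity)]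
      _ ≤ ENNReal.ofReal (C₁ * (B₂ * L) ^ 2) * (ENNReal.ofReal C₃ * sqNorm F) :=
          mul_le_mul_right h3 _
      _ ≤ _ := by
          rw [← mul_assoc, ← ENNReal.ofReal_mul (by positivity)]
          refine mul_le_mul_left (ENNReal.ofReal_le_ofReal ?_) _
          have e : ((C₁ * C₃ + 1) * B₂ * L) ^ 2 ≤ (K * L) ^ 2 := by
            have : 0 ≤ B₁ * (B₃ * B₂) := by positivity
            gcongr
            rw [hK]; linarith
          refine le_trans ?_ e
          have e2 : C₁ * C₃ ≤ (C₁ * C₃ + 1) ^ 2 := by nlinarith [mul_pos hC₁ hC₃]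
          calc C₁ * (B₂ * L) ^ 2 * C₃ = C₁ * C₃ * (B₂ * L) ^ 2 := by ring
            _ ≤ (C₁ * C₃ + 1) ^ 2 * (B₂ * L) ^ 2 := by gcongr
            _ = _ := by ring

lemma exists_high_le (hd : 0 < d) {s : ℝ} (hs : 0 < s) {p : ℝ} (hp : 1 < p) : ∃ C : ℝ, 0 < C ∧
    ∀ (N : ℕ) (g : ℕ → Sw d) (G : ℝ), 0 < G → (∀ k x, ‖g k x‖ ≤ G) →
    ∀ F : Sw d, eLpNorm (∑ k ∈ Finset.range N, mult (low s (k + 4)) (prodS (g k)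
      (mult (band (-s) 0 1 k) F)) : Sw d)
      (ENNReal.ofReal p) volume ≤ ENNReal.ofReal (C * G) * eLpNorm F (ENNReal.ofReal p) volume := by
  set δ := min s 1 / 2 with hδ
  have hδ0 : 0 < δ := by positivity
  have hδs : δ < s := by have := min_le_left s 1; linarith
  have hδ1 : δ ≤ 2 := by have := min_le_right s 1; linarith
  obtain ⟨C, hC, hb⟩ := exists_eLpNorm_sum_le hd hδ0 hp
  obtain ⟨A₁, hA₁, g₁⟩ := exists_good_low d hδ0.le hδs hδ1
  obtain ⟨A₂, hA₂, g₂⟩ := exists_good_band d (-s) 0 1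
  obtain ⟨C₁, hC₁, q₁⟩ := exists_sum_low_sq_le d hs
  obtain ⟨C₂, hC₂, q₂⟩ := exists_sum_band_sq_le d (-s) 0 1
  have k₁ := fun m => Good.shift g₁ hδ0.le 4 m
  set B₁ := A₁ * 2 ^ 4
  have hB₁ : 0 < B₁ := by positivity
  set K := B₁ * A₂ + (C₁ * C₂ + 1) with hK
  have hK0 : 0 < K := by positivity
  refine ⟨C * K, by positivity, fun N g G hG hg F => ?_⟩
  rw [mul_assoc]
  refine hb (K * G) (by positivity) (Finset.range N)
    (fun k F => mult (low s (k + 4)) (prodS (g k) (mult (band (-s) 0 1 k) F)))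
    (fun k F => mult (band (-s) 0 1 k) (prodS (g k) (mult (low s (k + 4)) F)))
    (fun k _ => ?_) (Or.inl fun F => ?_) F
  · have hρ : (0 : ℝ) < 2 ^ k := by positivity
    refine ((k₁ k).repC_sandwich ((g₂ k).weaken hδ1 hρ.le) hδ0.le hρ (g k) (hg k)).mono ?_
    rw [← mul_assoc]
    refine mul_le_mul_of_nonneg_right ?_ hG.le
    rw [hK]
    have : 0 ≤ (C₁ * C₂ + 1) := by positivity
    linarith
  · refine (sqNorm_sum_mult_le _ (fun k _ => (k₁ k).temperate)
      (fun ξ => sum_range_add_le (fun J => q₁ J ξ) 4 N) _).trans ?_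
    have h3 := sum_sqNorm_mult_le (Finset.range N) (fun m _ => (g₂ m).temperate) (fun ξ => q₂ _ ξ) F
    have h4 : ∀ k, sqNorm (prodS (g k) (mult (band (-s) 0 1 k) F)) ≤
        ENNReal.ofReal (G ^ 2) * sqNorm (mult (band (-s) 0 1 k) F) := by
      intro k
      simpa [sqNorm] using sqNorm_mul_le_of_bdd (hg k) (mult (band (-s) 0 1 k) F)
    calc _ ≤ ENNReal.ofReal C₁ * ∑ k ∈ Finset.range N, ENNReal.ofReal (G ^ 2) *
          sqNorm (mult (band (-s) 0 1 k) F) :=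
          mul_le_mul_right (Finset.sum_le_sum fun m _ => h4 m) _
      _ = ENNReal.ofReal (C₁ * G ^ 2) * ∑ k ∈ Finset.range N, sqNorm (mult (band (-s) 0 1 k) F) := by
          rw [← Finset.mul_sum, ← mul_assoc, ENNReal.ofReal_mul hC₁.le]
      _ ≤ ENNReal.ofReal (C₁ * G ^ 2) * (ENNReal.ofReal C₂ * sqNorm F) :=
          mul_le_mul_right h3 _
      _ ≤ _ := by
          rw [← mul_assoc, ← ENNReal.ofReal_mul (by positivity)]
          refine mul_le_mul_left (ENNReal.ofReal_le_ofReal ?_) _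
          have e : ((C₁ * C₂ + 1) * G) ^ 2 ≤ (K * G) ^ 2 := by
            have : 0 ≤ B₁ * A₂ := by positivity
            gcongr
            rw [hK]; linarith
          refine le_trans ?_ e
          have e2 : C₁ * C₂ ≤ (C₁ * C₂ + 1) ^ 2 := by nlinarith [mul_pos hC₁ hC₂]
          calc C₁ * G ^ 2 * C₂ = C₁ * C₂ * G ^ 2 := by ring
            _ ≤ (C₁ * C₂ + 1) ^ 2 * G ^ 2 := by gcongr
            _ = _ := by ring

lemma exists_low_le (hd : 0 < d) {s : ℝ} (hs : 0 < s) {p : ℝ} (hp : 1 < p) : ∃ C : ℝ, 0 < C ∧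
    ∀ (N : ℕ) (g : Sw d) (G : ℝ), 0 < G → (∀ x, ‖g x‖ ≤ G) →
    ∀ F : Sw d, eLpNorm (∑ k ∈ Finset.range N, mult (chi ((k + 2 : ℕ) + 2)) (prodS
      (mult (low s (k + 2)) g) (mult (band (-s) 0 1 k) F)) : Sw d)
      (ENNReal.ofReal p) volume ≤ ENNReal.ofReal (C * G) * eLpNorm F (ENNReal.ofReal p) volume := by
  obtain ⟨C, hC, hb⟩ := exists_eLpNorm_sum_le hd zero_lt_one hp
  obtain ⟨A₀, hA₀, g₀⟩ := exists_good_low d (le_refl (0 : ℝ)) hs zero_le_two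
  obtain ⟨A₁, hA₁, g₁⟩ := exists_good_chi d
  obtain ⟨A₂, hA₂, g₂⟩ := exists_good_band d (-s) 0 1
  obtain ⟨C₁, hC₁, q₁⟩ := carleson_low d hs
  obtain ⟨C₂, hC₂, q₂⟩ := exists_sum_band_sq_le d (-s) 0 1
  have k₁ : ∀ k : ℕ, Good 2 (A₁ * 2 ^ 4) (2 ^ k) (chi ((k + 2 : ℕ) + 2) : Eu d → ℝ) := by
    intro k
    have h1 := Good.shift (σ := fun n : ℕ => (chi n : Eu d → ℝ))
      (fun n => by simpa using g₁ n) zero_le_two 4 k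
    have e : ((k + 4 : ℕ) : ℤ) = (k + 2 : ℕ) + 2 := by push_cast; ring
    simpa only [e] using h1
  set B₁ := A₁ * 2 ^ 4
  have hB₁ : 0 < B₁ := by positivity
  set K := B₁ * (A₂ * A₀) + (C₁ * C₂ + 1) with hK
  have hK0 : 0 < K := by positivity
  refine ⟨C * K, by positivity, fun N g G hG hg F => ?_⟩
  rw [mul_assoc]
  refine hb (K * G) (by positivity) (Finset.range N)
    (fun k F => mult (chi ((k + 2 : ℕ) + 2)) (prodS (mult (low s (k + 2)) g)
      (mult (band (-s) 0 1 k) F)))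
    (fun k F => mult (band (-s) 0 1 k) (prodS (mult (low s (k + 2)) g)
      (mult (chi ((k + 2 : ℕ) + 2)) F)))
    (fun k _ => ?_) (Or.inr fun F => ?_) F
  · have hρ : (0 : ℝ) < 2 ^ k := by positivity
    refine (((k₁ k).weaken one_le_two hρ.le).repC_sandwich ((g₂ k).weaken one_le_two hρ.le)
      zero_le_one hρ _ (norm_mult_good_le (g₀ (k + 2)) le_rfl (by positivity) hg)).mono ?_
    rw [← mul_assoc A₂, ← mul_assoc]
    refine mul_le_mul_of_nonneg_right ?_ hG.le
    rw [hK]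
    have : 0 ≤ (C₁ * C₂ + 1) := by positivity
    linarith
  · refine (sqNorm_sum_mult_le _ (fun k _ => (g₂ k).temperate) (fun ξ => q₂ _ ξ) _).trans ?_
    have h4 : ∑ k ∈ Finset.range N, sqNorm (prodS (mult (low s (k + 2)) g)
        (mult (chi ((k + 2 : ℕ) + 2)) F)) ≤ ENNReal.ofReal (C₁ * G ^ 2) * sqNorm F := by
      refine le_trans ?_ (q₁ g F G hg (N + 2))
      rw [add_comm N 2, Finset.sum_range_add]
      refine le_trans (le_of_eq (Finset.sum_congr rfl fun k _ => ?_)) le_add_self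
      rw [add_comm 2 k]
      exact lintegral_congr fun x => by rw [prodS_apply]
    calc _ ≤ ENNReal.ofReal C₂ * (ENNReal.ofReal (C₁ * G ^ 2) * sqNorm F) :=
          mul_le_mul_right h4 _
      _ ≤ _ := by
          rw [← mul_assoc, ← ENNReal.ofReal_mul (by positivity)]
          refine mul_le_mul_left (ENNReal.ofReal_le_ofReal ?_) _
          have e : ((C₁ * C₂ + 1) * G) ^ 2 ≤ (K * G) ^ 2 := by
            have : 0 ≤ B₁ * (A₂ * A₀) := by positivity
            gcongr
            rw [hK]; linarith
          refine le_trans ?_ e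
          have e2 : C₁ * C₂ ≤ (C₁ * C₂ + 1) ^ 2 := by nlinarith [mul_pos hC₁ hC₂]
          calc C₂ * (C₁ * G ^ 2) = C₁ * C₂ * G ^ 2 := by ring
            _ ≤ (C₁ * C₂ + 1) ^ 2 * G ^ 2 := by gcongr
            _ = _ := by ring

end Terms

section Decomposition
variable {d : ℕ}

lemma lipschitz_mult_good_le {w A ρ : ℝ} {σ : Eu d → ℝ} (h : Good w A ρ σ) (hw : 0 ≤ w)
    (hρ : 0 ≤ ρ) {f : Sw d} {L : ℝ} (hL0 : 0 ≤ L) (hL : ∀ x y, ‖f x - f y‖ ≤ L * dist x y) (x y : Eu d) :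
    ‖mult σ f x - mult σ f y‖ ≤ A * L * dist x y := by
  obtain ⟨κ, h1, h2, -⟩ := h.ker
  have h3 := lintegral_enorm_le_of_weight hw hρ h2
  have hA := h.nonneg
  obtain ⟨M, hM⟩ := exists_norm_le f
  have e : ∀ z, mult σ f z = ∫ u, κ u * f (z - u) := fun z => by
    rw [mult_apply_eq h.temperate h1, ← integral_sub_left_eq_self _ volume z]
    simp
  have hi : ∀ z, Integrable fun u => κ u * f (z - u) := fun z =>
    κ.integrable.mul_bdd (c := M) (by fun_prop) (Eventually.of_forall fun u => hM _)
  rw [e, e, ← integral_sub (hi x) (hi y)]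
  have h4 : ‖∫ u, (κ u * f (x - u) - κ u * f (y - u))‖ₑ ≤ ENNReal.ofReal (A * L * dist x y) := by
    calc _ ≤ ∫⁻ u, ‖κ u * f (x - u) - κ u * f (y - u)‖ₑ := enorm_integral_le_lintegral_enorm _
      _ ≤ ∫⁻ u, ‖κ u‖ₑ * ENNReal.ofReal (L * dist x y) := by
          refine lintegral_mono fun u => ?_
          rw [← mul_sub, enorm_mul, ← ofReal_norm (f _ - _)]
          refine mul_le_mul_right (ENNReal.ofReal_le_ofReal ?_) _
          simpa using hL (x - u) (y - u)
      _ ≤ _ := by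
          rw [lintegral_mul_const' _ _ ENNReal.ofReal_ne_top, mul_assoc, ENNReal.ofReal_mul hA]
          gcongr
  rw [← ofReal_norm] at h4
  exact (ENNReal.ofReal_le_ofReal_iff (by positivity)).1 h4

lemma prodS_sub_left (f g h : Sw d) : prodS (f - g) h = prodS f h - prodS g h := by
  ext x; simp [sub_mul]

lemma prodS_sub_right (f g h : Sw d) : prodS f (g - h) = prodS f g - prodS f h := by
  ext x; simp [mul_sub]

lemma prodS_smul_left (c : ℝ) (f g : Sw d) : prodS (c • f) g = c • prodS f g := by
  ext x; simp [mul_assoc]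

lemma prodS_smul_right (c : ℝ) (f g : Sw d) : prodS f (c • g) = c • prodS f g := by
  ext x; simp [mul_left_comm]

lemma prodS_comm (f g : Sw d) : prodS f g = prodS g f := by
  ext x; simp [mul_comm]

/-- The commutator `J^s (f g) - f J^s g`. -/
def comm (s : ℝ) (f g : Sw d) : Sw d := mult (jap s) (prodS f g) - prodS f (mult (jap s) g)

lemma comm_sub_left (s : ℝ) (f g h : Sw d) : comm s (f - g) h = comm s f h - comm s g h := by
  simp only [comm, prodS_sub_left, map_sub]
  abel

lemma comm_sub_right (s : ℝ) (f g h : Sw d) : comm s f (g - h) = comm s f g - comm s f h := by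
  simp only [comm, prodS_sub_right, map_sub]
  abel

lemma comm_smul_right (s c : ℝ) (f g : Sw d) : comm s f (c • g) = c • comm s f g := by
  simp only [comm, prodS_smul_right, map_smul, smul_sub]

lemma chi_temperate (n : ℤ) : (chi n : Eu d → ℝ).HasTemperateGrowth := by
  obtain ⟨A, -, h⟩ := exists_good_chi d
  exact (h n).temperate

lemma band_zero (a b k : ℕ) : (band 0 a b k : Eu d → ℝ) = ann a b k := by
  funext ξ; simp [band, jap_zero]

lemma band_temperate (r : ℝ) (a b k : ℕ) : (band r a b k : Eu d → ℝ).HasTemperateGrowth := by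
  obtain ⟨A, -, h⟩ := exists_good_band d r a b
  exact (h k).temperate

lemma ann_temperate (a b k : ℕ) : (ann a b k : Eu d → ℝ).HasTemperateGrowth := by
  rw [← band_zero]; exact band_temperate 0 a b k

lemma low_temperate (r : ℝ) (n : ℕ) : (low r n : Eu d → ℝ).HasTemperateGrowth :=
  ((Function.HasTemperateGrowth.const _).mul (jap_temperate r)).mul (chi_temperate n)

lemma mult_ann_zero (f : Sw d) : mult (ann 0 1 0) f = mult (chi 0) f :=
  mult_congr (ann_temperate 0 1 0) (chi_temperate 0) fun ξ _ => by simp [ann]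

lemma mult_ann_succ (n : ℕ) (f : Sw d) :
    mult (ann 0 1 (n + 1)) f = mult (chi (n + 1 : ℕ)) f - mult (chi n) f := by
  refine mult_eq_of_fourier (ann_temperate _ _ _) fun ξ => ?_
  rw [fourier_sub_apply, fourier_mult (chi_temperate _), fourier_mult (chi_temperate _), ann,
    if_neg (by lia)]
  push_cast
  simp only [add_zero, add_sub_cancel_right]
  ring

/-- The paraproduct decomposition of the commutator. -/
lemma comm_chi_eq (s : ℝ) (f g : Sw d) (M : ℕ) :
    comm s (mult (chi M) f) (mult (chi (M + 2 : ℕ)) g) =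
      ∑ k ∈ Finset.range (M + 1), comm s (mult (ann 0 1 k) f) (mult (chi (k + 2 : ℕ)) g) +
      ∑ m ∈ Finset.range M, comm s (mult (chi m) f) (mult (ann 0 1 (m + 3)) g) := by
  induction M with
  | zero => simp [mult_ann_zero]
  | succ M ih =>
    rw [Finset.sum_range_succ _ (M + 1),
      Finset.sum_range_succ (fun m : ℕ => comm s (mult (chi m) f) (mult (ann 0 1 (m + 3)) g)) M,
      mult_ann_succ M, mult_ann_succ (M + 2),
      comm_sub_left, comm_sub_right, add_add_add_comm, ← ih, show M + 1 + 2 = M + 2 + 1 by ring]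
    abel

lemma symbol_ne_zero {σ : Eu d → ℝ} (hσ : σ.HasTemperateGrowth) {f : Sw d} {ξ : Eu d}
    (h : 𝓕 (mult σ f) ξ ≠ 0) : σ ξ ≠ 0 := by
  rw [fourier_mult hσ] at h
  exact_mod_cast left_ne_zero_of_mul h

lemma exists_of_fourier_prodS {f g : Sw d} {ξ : Eu d} (h : 𝓕 (prodS f g) ξ ≠ 0) :
    ∃ t, 𝓕 f t ≠ 0 ∧ 𝓕 g (ξ - t) ≠ 0 := by
  by_contra! h'
  exact h (fourier_prodS_eq_zero fun t h1 h2 => h2 (h' t h1))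

lemma norm_lt_of_chi {n : ℤ} {ξ : Eu d} (h : chi n ξ ≠ 0) : ‖ξ‖ < 2 ^ (n + 1) :=
  lt_of_not_ge fun h' => h (chi_eq_zero h')

lemma norm_le_of_ann {k : ℕ} {ξ : Eu d} (h : ann 0 1 k ξ ≠ 0) : ‖ξ‖ ≤ 2 ^ (k + 1) := by
  rcases Nat.eq_zero_or_pos k with rfl | hk
  · have := norm_lt_of_chi (n := 0) (by simpa [ann] using h)
    simpa using this.le
  · have := (ann_support hk h).2
    rw [zero_add, pow_one] at this
    rw [pow_succ]; linarith

lemma mult_ann_eq_band (r : ℝ) (k : ℕ) (f : Sw d) :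
    mult (ann 0 1 k) f = ((2 : ℝ) ^ k) ^ r • mult (band r 0 1 k) (mult (jap (-r)) f) := by
  refine mult_eq_of_fourier (ann_temperate _ _ _) fun ξ => ?_
  rw [fourier_smul_apply, fourier_mult (band_temperate _ _ _ _), fourier_mult (jap_temperate _), band]
  have h1 : jap r ξ * jap (-r) ξ = 1 := by rw [← jap_add]; simp [jap_zero]
  have h2 : ((2 : ℝ) ^ k) ^ r * ((2 : ℝ) ^ k) ^ (-r) = 1 := by
    rw [← Real.rpow_add (by positivity)]; simp
  have h3 : ((((2 : ℝ) ^ k) ^ r : ℝ) : ℂ) * (((((2 : ℝ) ^ k) ^ (-r) * jap r ξ * ann 0 1 k ξ : ℝ) : ℂ) *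
      (((jap (-r) ξ : ℝ) : ℂ) * 𝓕 f ξ)) = ((((2 : ℝ) ^ k) ^ r * ((2 : ℝ) ^ k) ^ (-r)) *
      (jap r ξ * jap (-r) ξ) * ann 0 1 k ξ : ℝ) * 𝓕 f ξ := by
    push_cast; ring
  rw [h3, h1, h2]
  simp

lemma fourier_prodS_ann_chi {k : ℕ} {u v : Sw d} (hu : ∀ ξ, 𝓕 u ξ ≠ 0 → ann 0 1 k ξ ≠ 0)
    (hv : ∀ ξ, 𝓕 v ξ ≠ 0 → chi (k + 2 : ℕ) ξ ≠ 0) (ξ : Eu d) (h : 𝓕 (prodS u v) ξ ≠ 0) :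
    chi (k + 4 : ℕ) ξ = 1 := by
  obtain ⟨t, h1, h2⟩ := exists_of_fourier_prodS h
  have h3 := norm_le_of_ann (hu t h1)
  have h4 := norm_lt_of_chi (hv _ h2)
  refine chi_eq_one ?_
  have h5 : ‖ξ‖ ≤ ‖t‖ + ‖ξ - t‖ := by simpa using norm_add_le t (ξ - t)
  have e : (2 : ℝ) ^ (((k + 2 : ℕ) : ℤ) + 1) = 2 ^ (k + 3) := by
    rw [← zpow_natCast]; congr 1
  rw [e] at h4
  rw [zpow_natCast]
  rw [pow_add] at h3 h4 ⊢
  have : (0 : ℝ) < 2 ^ k := by positivity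
  linarith

lemma comm_ann_chi_eq (s : ℝ) (f g : Sw d) (k : ℕ) :
    comm s (mult (ann 0 1 k) f) (mult (chi (k + 2 : ℕ)) g) =
      ((2 : ℝ) ^ 4) ^ s • mult (low s (k + 4)) (prodS (mult (chi (k + 2 : ℕ)) g)
        (mult (band (-s) 0 1 k) (mult (jap s) f))) -
      ((2 : ℝ) ^ 2) ^ s • mult (chi ((k + 2 : ℕ) + 2)) (prodS (mult (low s (k + 2)) g)
        (mult (band (-s) 0 1 k) (mult (jap s) f))) := by
  set v := mult (band (-s) 0 1 k) (mult (jap s) f) with hv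
  have e1 : mult (ann 0 1 k) f = ((2 : ℝ) ^ k) ^ (-s) • v := by
    rw [mult_ann_eq_band (-s), neg_neg]
  have e2 : mult (jap s) (mult (chi (k + 2 : ℕ)) g) =
      ((2 : ℝ) ^ (k + 2)) ^ s • mult (low s (k + 2)) g := by
    refine mult_eq_of_fourier (jap_temperate s) fun ξ => ?_
    rw [fourier_smul_apply, fourier_mult (chi_temperate _), fourier_mult (low_temperate _ _), low]
    have h2 : ((2 : ℝ) ^ (k + 2)) ^ s * ((2 : ℝ) ^ (k + 2)) ^ (-s) = 1 := by
      rw [← Real.rpow_add (by positivity)]; simp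
    have h3 : ((((2 : ℝ) ^ (k + 2)) ^ s : ℝ) : ℂ) * (((((2 : ℝ) ^ (k + 2)) ^ (-s) * jap s ξ *
        chi (k + 2 : ℕ) ξ : ℝ) : ℂ) * 𝓕 g ξ) =
        ((((2 : ℝ) ^ (k + 2)) ^ s * ((2 : ℝ) ^ (k + 2)) ^ (-s)) * jap s ξ *
        chi (k + 2 : ℕ) ξ : ℝ) * 𝓕 g ξ := by
      push_cast; ring
    rw [h3, h2]
    push_cast; ring
  have hvs : ∀ ξ, 𝓕 v ξ ≠ 0 → ann 0 1 k ξ ≠ 0 := fun ξ h => by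
    have := symbol_ne_zero (band_temperate _ _ _ _) h
    rw [band] at this
    exact right_ne_zero_of_mul this
  have e3 : mult (jap s) (prodS v (mult (chi (k + 2 : ℕ)) g)) =
      ((2 : ℝ) ^ (k + 4)) ^ s • mult (low s (k + 4)) (prodS v (mult (chi (k + 2 : ℕ)) g)) := by
    refine mult_eq_of_fourier (jap_temperate s) fun ξ => ?_
    by_cases h0 : 𝓕 (prodS v (mult (chi (k + 2 : ℕ)) g)) ξ = 0
    · rw [fourier_smul_apply, fourier_mult (low_temperate _ _), h0]; simp
    have h1 := fourier_prodS_ann_chi hvs (fun ξ h => symbol_ne_zero (chi_temperate _) h) ξ h0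
    rw [fourier_smul_apply, fourier_mult (low_temperate _ _), low, h1]
    have h2 : ((2 : ℝ) ^ (k + 4)) ^ s * ((2 : ℝ) ^ (k + 4)) ^ (-s) = 1 := by
      rw [← Real.rpow_add (by positivity)]; simp
    rw [← mul_assoc, ← Complex.ofReal_mul, ← mul_assoc, ← mul_assoc, h2, one_mul, mul_one]
  have e4 : mult (chi ((k + 2 : ℕ) + 2)) (prodS v (mult (low s (k + 2)) g)) =
      prodS v (mult (low s (k + 2)) g) := by
    refine mult_eq_of_fourier (chi_temperate _) fun ξ => ?_
    by_cases h0 : 𝓕 (prodS v (mult (low s (k + 2)) g)) ξ = 0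
    · rw [h0]; simp
    have h1 := fourier_prodS_ann_chi hvs (fun ξ h => by
      have := symbol_ne_zero (low_temperate _ _) h
      rw [low] at this
      exact right_ne_zero_of_mul this) ξ h0
    have e : ((k + 4 : ℕ) : ℤ) = (k + 2 : ℕ) + 2 := by push_cast; ring
    rw [← e, h1]; simp
  have c1 : ((2 : ℝ) ^ k) ^ (-s) * ((2 : ℝ) ^ (k + 4)) ^ s = ((2 : ℝ) ^ 4) ^ s := by
    rw [pow_add, Real.mul_rpow (by positivity) (by positivity), ← mul_assoc,
      ← Real.rpow_add (by positivity)]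
    simp
  have c2 : ((2 : ℝ) ^ k) ^ (-s) * ((2 : ℝ) ^ (k + 2)) ^ s = ((2 : ℝ) ^ 2) ^ s := by
    rw [pow_add, Real.mul_rpow (by positivity) (by positivity), ← mul_assoc,
      ← Real.rpow_add (by positivity)]
    simp
  rw [comm, e1, e2, prodS_smul_left, prodS_smul_left, prodS_smul_right, map_smul, e3, smul_smul,
    smul_smul, c1, c2, prodS_comm _ v, prodS_comm _ v, e4]

lemma ann_two_three_eq_one {m : ℕ} {ξ : Eu d} (h1 : 2 ^ (m + 1) ≤ ‖ξ‖) (h2 : ‖ξ‖ ≤ 2 ^ (m + 5)) :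
    ann 2 3 (m + 3) ξ = 1 := by
  rw [ann, if_neg (by lia), chi_eq_one, chi_eq_zero, sub_zero]
  · refine le_trans (le_of_eq ?_) h1
    rw [← zpow_natCast]; congr 1; push_cast; ring
  · refine h2.trans (le_of_eq ?_)
    rw [← zpow_natCast]; congr 1

lemma comm_chi_ann_eq (s : ℝ) (f g : Sw d) (m : ℕ) :
    comm s (mult (chi m) f) (mult (ann 0 1 (m + 3)) g) =
      (8 : ℝ) • mult (band 0 2 3 (m + 3)) ((2 : ℝ) ^ m •
      (mult (band s 2 3 (m + 3)) (prodS (mult (chi m) f) (mult (band (1 - s) 0 1 (m + 3))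
        (mult (jap (s - 1)) g))) - prodS (mult (chi m) f)
        (mult (band s 2 3 (m + 3)) (mult (band (1 - s) 0 1 (m + 3)) (mult (jap (s - 1)) g))))) := by
  set φ := mult (chi m) f with hφ
  set v := mult (band (1 - s) 0 1 (m + 3)) (mult (jap (s - 1)) g) with hv
  have e1 : mult (ann 0 1 (m + 3)) g = ((2 : ℝ) ^ (m + 3)) ^ (1 - s) • v := by
    rw [mult_ann_eq_band (1 - s), neg_sub]
  have hvs : ∀ ξ, 𝓕 v ξ ≠ 0 → 2 ^ (m + 2) ≤ ‖ξ‖ ∧ ‖ξ‖ ≤ 2 ^ (m + 4) := fun ξ h => by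
    have h0 := symbol_ne_zero (band_temperate _ _ _ _) h
    rw [band] at h0
    have h1 := ann_support (by lia) (right_ne_zero_of_mul h0)
    have : (0 : ℝ) < 2 ^ m := by positivity
    simp only [pow_add] at h1 ⊢
    constructor <;> linarith
  have hprod : ∀ w : Sw d, (∀ ξ, 𝓕 w ξ ≠ 0 → 2 ^ (m + 2) ≤ ‖ξ‖ ∧ ‖ξ‖ ≤ 2 ^ (m + 4)) → ∀ ξ,
      𝓕 (prodS φ w) ξ ≠ 0 → ann 2 3 (m + 3) ξ = 1 := by
    intro w hw ξ h
    obtain ⟨t, h1, h2⟩ := exists_of_fourier_prodS h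
    have h3 := norm_lt_of_chi (symbol_ne_zero (chi_temperate _) h1)
    obtain ⟨h4, h5⟩ := hw _ h2
    have h6 : ‖ξ‖ ≤ ‖t‖ + ‖ξ - t‖ := by simpa using norm_add_le t (ξ - t)
    have h7 : ‖ξ - t‖ ≤ ‖ξ‖ + ‖t‖ := norm_sub_le ξ t
    have e : (2 : ℝ) ^ ((m : ℤ) + 1) = 2 ^ (m + 1) := by
      rw [← zpow_natCast]; congr 1
    rw [e] at h3
    have : (0 : ℝ) < 2 ^ m := by positivity
    simp only [pow_add] at h3 h4 h5
    refine ann_two_three_eq_one ?_ ?_ <;> simp only [pow_add] <;> linarith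
  have hann : ∀ u : Sw d, (∀ ξ, 𝓕 u ξ ≠ 0 → ann 2 3 (m + 3) ξ = 1) →
      mult (jap s) u = ((2 : ℝ) ^ (m + 3)) ^ s • mult (band s 2 3 (m + 3)) u := by
    intro u hu
    refine mult_eq_of_fourier (jap_temperate s) fun ξ => ?_
    by_cases h0 : 𝓕 u ξ = 0
    · rw [fourier_smul_apply, fourier_mult (band_temperate _ _ _ _), h0]; simp
    rw [fourier_smul_apply, fourier_mult (band_temperate _ _ _ _), band, hu ξ h0]
    have h2 : ((2 : ℝ) ^ (m + 3)) ^ s * ((2 : ℝ) ^ (m + 3)) ^ (-s) = 1 := by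
      rw [← Real.rpow_add (by positivity)]; simp
    rw [← mul_assoc, ← Complex.ofReal_mul, ← mul_assoc, ← mul_assoc, h2, one_mul, mul_one]
  have hband : ∀ u : Sw d, (∀ ξ, 𝓕 u ξ ≠ 0 → ann 2 3 (m + 3) ξ = 1) →
      mult (band 0 2 3 (m + 3)) u = u := by
    intro u hu
    refine mult_eq_of_fourier (band_temperate _ _ _ _) fun ξ => ?_
    by_cases h0 : 𝓕 u ξ = 0
    · simp [h0]
    rw [band_zero, hu ξ h0]; simp
  have e2 : mult (band 0 2 3 (m + 3)) (mult (band s 2 3 (m + 3)) (prodS φ v)) =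
      mult (band s 2 3 (m + 3)) (prodS φ v) :=
    hband _ fun ξ h => hprod v hvs ξ fun h0 => h (by
      rw [fourier_mult (band_temperate _ _ _ _), h0, mul_zero])
  have hsv : ∀ ξ, 𝓕 (mult (band s 2 3 (m + 3)) v) ξ ≠ 0 → 𝓕 v ξ ≠ 0 := fun ξ h h0 => h (by
    rw [fourier_mult (band_temperate _ _ _ _), h0, mul_zero])
  have e3 : mult (band 0 2 3 (m + 3)) (prodS φ (mult (band s 2 3 (m + 3)) v)) =
      prodS φ (mult (band s 2 3 (m + 3)) v) :=
    hband _ (hprod _ fun ξ h => hvs ξ (hsv ξ h))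
  have c1 : ((2 : ℝ) ^ (m + 3)) ^ (1 - s) * ((2 : ℝ) ^ (m + 3)) ^ s = 8 * 2 ^ m := by
    rw [← Real.rpow_add (by positivity)]
    simp only [sub_add_cancel, Real.rpow_one, pow_add]
    ring
  rw [e1, comm_smul_right, comm, hann _ (hprod v hvs), hann v (fun ξ h => by
      obtain ⟨h1, h2⟩ := hvs ξ h
      have : (0 : ℝ) < 2 ^ m := by positivity
      refine ann_two_three_eq_one ?_ ?_ <;> simp only [pow_add] at h1 h2 ⊢ <;> linarith),
    prodS_smul_right, ← smul_sub, smul_smul, c1, map_smul, map_sub, e2, e3, smul_smul]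

end Decomposition

section Limit
variable {d : ℕ}

/-- The commutator estimate for frequency truncations. -/
lemma exists_comm_chi_le (hd : 0 < d) {s : ℝ} (hs : 0 < s) {p : ℝ} (hp : 1 < p) : ∃ C : ℝ, 0 < C ∧
    ∀ (f g : Sw d) (L G : ℝ), 0 < L → 0 < G → (∀ x y, ‖f x - f y‖ ≤ L * dist x y) →
    (∀ x, ‖g x‖ ≤ G) → ∀ M : ℕ,
    eLpNorm (comm s (mult (chi M) f) (mult (chi (M + 2 : ℕ)) g)) (ENNReal.ofReal p) volume ≤
      ENNReal.ofReal (C * L) * eLpNorm (mult (jap (s - 1)) g) (ENNReal.ofReal p) volume +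
      ENNReal.ofReal (C * G) * eLpNorm (mult (jap s) f) (ENNReal.ofReal p) volume := by
  obtain ⟨C₁, hC₁, h₁⟩ := exists_high_le hd hs hp
  obtain ⟨C₂, hC₂, h₂⟩ := exists_low_le hd hs hp
  obtain ⟨C₃, hC₃, h₃⟩ := exists_commutator_le hd s hp
  obtain ⟨A, hA, hχ⟩ := exists_good_chi d
  set a : ℝ := ((2 : ℝ) ^ 4) ^ s
  set b : ℝ := ((2 : ℝ) ^ 2) ^ s
  have ha : 0 < a := by positivity
  have hb : 0 < b := by positivity
  set K := a * (C₁ * A) + b * C₂ with hK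
  refine ⟨K + 8 * (C₃ * A), by positivity, fun f g L G hL hG hf hg M => ?_⟩
  set q := ENNReal.ofReal p with hq
  have hq1 : 1 ≤ q := by rw [hq, ENNReal.one_le_ofReal]; exact hp.le
  have t₁ := h₁ (M + 1) (fun k => mult (chi (k + 2 : ℕ)) g) (A * G) (by positivity)
    (fun k => norm_mult_good_le (hχ _) zero_le_two (by positivity) hg) (mult (jap s) f)
  have t₂ := h₂ (M + 1) g G hG hg (mult (jap s) f)
  have t₃ := h₃ M (fun m => mult (chi m) f) (A * L) (by positivity)
    (fun m => lipschitz_mult_good_le (hχ _) zero_le_two (by positivity) hL.le hf) (mult (jap (s - 1)) g)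
  simp only [comm_chi_eq, comm_ann_chi_eq, comm_chi_ann_eq, Finset.sum_sub_distrib, ← Finset.smul_sum]
  set X : Sw d := ∑ k ∈ Finset.range (M + 1), mult (low s (k + 4)) (prodS (mult (chi (k + 2 : ℕ)) g)
    (mult (band (-s) 0 1 k) (mult (jap s) f)))
  set Y : Sw d := ∑ k ∈ Finset.range (M + 1), mult (chi ((k + 2 : ℕ) + 2)) (prodS
    (mult (low s (k + 2)) g) (mult (band (-s) 0 1 k) (mult (jap s) f)))
  set Z : Sw d := ∑ m ∈ Finset.range M, mult (band 0 2 3 (m + 3)) ((2 : ℝ) ^ m •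
      (mult (band s 2 3 (m + 3)) (prodS (mult (chi m) f) (mult (band (1 - s) 0 1 (m + 3))
        (mult (jap (s - 1)) g))) - prodS (mult (chi m) f)
        (mult (band s 2 3 (m + 3)) (mult (band (1 - s) 0 1 (m + 3)) (mult (jap (s - 1)) g)))))
  set P := eLpNorm (mult (jap (s - 1)) g) q volume
  set Q := eLpNorm (mult (jap s) f) q volume
  have hsm : ∀ (c : ℝ) (u : Sw d), 0 ≤ c →
      eLpNorm (⇑(c • u)) q volume = ENNReal.ofReal c * eLpNorm u q volume := fun c u hc => by
    have e : ⇑(c • u) = c • ⇑u := rfl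
    rw [e, eLpNorm_const_smul, Real.enorm_eq_ofReal hc]
  have hadd : ∀ u v : Sw d, eLpNorm (⇑(u + v)) q volume ≤ eLpNorm u q volume + eLpNorm v q volume :=
    fun u v => eLpNorm_add_le u.continuous.aestronglyMeasurable v.continuous.aestronglyMeasurable hq1
  have hsub : ∀ u v : Sw d, eLpNorm (⇑(u - v)) q volume ≤ eLpNorm u q volume + eLpNorm v q volume :=
    fun u v => eLpNorm_sub_le u.continuous.aestronglyMeasurable v.continuous.aestronglyMeasurable hq1
  calc eLpNorm (⇑(a • X - b • Y + (8 : ℝ) • Z)) q volume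
      ≤ ENNReal.ofReal a * eLpNorm X q volume + ENNReal.ofReal b * eLpNorm Y q volume +
        ENNReal.ofReal 8 * eLpNorm Z q volume := by
        rw [← hsm a X ha.le, ← hsm b Y hb.le, ← hsm 8 Z (by norm_num)]
        exact (hadd _ _).trans (add_le_add_left (hsub _ _) _)
    _ ≤ ENNReal.ofReal a * (ENNReal.ofReal (C₁ * (A * G)) * Q) +
        ENNReal.ofReal b * (ENNReal.ofReal (C₂ * G) * Q) +
        ENNReal.ofReal 8 * (ENNReal.ofReal (C₃ * (A * L)) * P) := by gcongr
    _ = ENNReal.ofReal (8 * (C₃ * A) * L) * P + ENNReal.ofReal (K * G) * Q := by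
        have r : ∀ (u v : ℝ) (W : ℝ≥0∞), 0 ≤ u →
            ENNReal.ofReal u * (ENNReal.ofReal v * W) = ENNReal.ofReal (u * v) * W :=
          fun u v W hu => by rw [← mul_assoc, ← ENNReal.ofReal_mul hu]
        have e₁ : K * G = a * (C₁ * (A * G)) + b * (C₂ * G) := by rw [hK]; ring
        have e₂ : 8 * (C₃ * A) * L = 8 * (C₃ * (A * L)) := by ring
        rw [r _ _ _ ha.le, r _ _ _ hb.le, r _ _ _ (by norm_num), ← add_mul,
          ← ENNReal.ofReal_add (by positivity) (by positivity), add_comm, e₁, e₂]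
    _ ≤ _ := by
        have hK0 : 0 < K := by positivity
        gcongr
        · linarith
        · exact le_add_of_nonneg_right (by positivity)

lemma eq_integral_fourier (u : Sw d) (x : Eu d) :
    u x = ∫ v, Real.fourierChar (inner ℝ v x) • 𝓕 u v := by
  have h1 : u x = 𝓕⁻ (𝓕 u : Sw d) x := by rw [FourierTransform.fourierInv_fourier_eq]
  rw [h1, SchwartzMap.fourierInv_coe, Real.fourierInv_eq]

lemma tendsto_apply_of_fourier {u : ℕ → Sw d} {v : Sw d} {H : Eu d → ℝ} (hH : Integrable H)
    (hb : ∀ n ξ, ‖𝓕 (u n) ξ‖ ≤ H ξ) (h : ∀ ξ, Tendsto (fun n => 𝓕 (u n) ξ) atTop (𝓝 (𝓕 v ξ)))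
    (x : Eu d) : Tendsto (fun n => u n x) atTop (𝓝 (v x)) := by
  simp only [eq_integral_fourier _ x]
  refine tendsto_integral_of_dominated_convergence H (fun n => ?_) hH
    (fun n => ae_of_all _ fun ξ => ?_) (ae_of_all _ fun ξ => ?_)
  · have hc : Continuous fun v : Eu d => Real.fourierChar (inner ℝ v x) :=
      Real.continuous_fourierChar.comp (by fun_prop)
    exact (hc.smul (𝓕 (u n) : Sw d).continuous).aestronglyMeasurable
  · rw [Circle.norm_smul]; exact hb n ξ
  · exact (h ξ).const_smul _

lemma chi_abs_le_one (n : ℤ) (ξ : Eu d) : ‖((chi n ξ : ℝ) : ℂ)‖ ≤ 1 := by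
  rw [Complex.norm_real, chi, Real.norm_of_nonneg (phi_nonneg _)]
  exact phi_le_one _

lemma eventually_chi_eq_one (c : ℕ) (ξ : Eu d) : ∀ᶠ M : ℕ in atTop, chi (M + c : ℕ) ξ = 1 := by
  have h : Tendsto (fun M : ℕ => (2 : ℝ) ^ M) atTop atTop := tendsto_pow_atTop_atTop_of_one_lt one_lt_two
  filter_upwards [h.eventually_ge_atTop ‖ξ‖] with M hM
  refine chi_eq_one (hM.trans ?_)
  rw [zpow_natCast]
  exact pow_le_pow_right₀ one_le_two (by lia)

lemma norm_fourier_mult_chi_le (n : ℤ) (f : Sw d) (ξ : Eu d) : ‖𝓕 (mult (chi n) f) ξ‖ ≤ ‖𝓕 f ξ‖ := by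
  rw [fourier_mult (chi_temperate n), norm_mul]
  exact mul_le_of_le_one_left (norm_nonneg _) (chi_abs_le_one n ξ)

lemma tendsto_fourier_mult_chi (c : ℕ) (f : Sw d) (ξ : Eu d) :
    Tendsto (fun M : ℕ => 𝓕 (mult (chi (M + c : ℕ)) f) ξ) atTop (𝓝 (𝓕 f ξ)) := by
  refine tendsto_const_nhds.congr' ?_
  filter_upwards [eventually_chi_eq_one c ξ] with M hM
  rw [fourier_mult (chi_temperate _), hM]; simp

lemma jap_le_mul {s : ℝ} (hs : 0 ≤ s) (ξ t : Eu d) :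
    jap s ξ ≤ 2 ^ (s / 2) * (jap s t * jap s (ξ - t)) := by
  have h6 : ‖ξ‖ ≤ ‖t‖ + ‖ξ - t‖ := by simpa using norm_add_le t (ξ - t)
  have h7 : ‖ξ‖ ^ 2 ≤ 2 * ‖t‖ ^ 2 + 2 * ‖ξ - t‖ ^ 2 := by
    nlinarith [norm_nonneg ξ, sq_nonneg (‖t‖ - ‖ξ - t‖)]
  have hp := Real.pi_pos
  rw [jap, jap, jap, ← Real.mul_rpow (by positivity) (by positivity),
    ← Real.mul_rpow (by positivity) (by positivity)]
  refine Real.rpow_le_rpow (by positivity) ?_ (by positivity)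
  have h8 : 0 ≤ (4 * Real.pi ^ 2 * ‖t‖ ^ 2) * (4 * Real.pi ^ 2 * ‖ξ - t‖ ^ 2) := by positivity
  have h9 := mul_le_mul_of_nonneg_left h7 (by positivity : 0 ≤ 4 * Real.pi ^ 2)
  nlinarith

lemma tendsto_mult_jap_prodS {s : ℝ} (hs : 0 ≤ s) (f g : Sw d) (x : Eu d) :
    Tendsto (fun M : ℕ => mult (jap s) (prodS (mult (chi M) f) (mult (chi (M + 2 : ℕ)) g)) x) atTop
      (𝓝 (mult (jap s) (prodS f g) x)) := by
  have hjt := jap_temperate (d := d) s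
  have e : ∀ u : Sw d, ∀ ξ, ‖𝓕 (mult (jap s) u) ξ‖ = jap s ξ * ‖𝓕 u ξ‖ := fun u ξ => by
    rw [fourier_mult hjt, norm_mul, Complex.norm_real, Real.norm_of_nonneg (jap_pos s ξ).le]
  have hinteg : ∀ (u v : Sw d) ξ, Integrable fun t => ‖u t‖ * ‖v (ξ - t)‖ := fun u v ξ => by
    obtain ⟨N, hN⟩ := exists_norm_le v
    exact u.integrable.norm.mul_bdd (c := N) (by fun_prop) (Eventually.of_forall fun t => by simpa using hN _)
  set H : Eu d → ℝ := fun ξ => 2 ^ (s / 2) *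
    ∫ t, ‖𝓕 (mult (jap s) f) t‖ * ‖𝓕 (mult (jap s) g) (ξ - t)‖ with hH
  have hHi : Integrable H := by
    have h := Integrable.integrable_convolution (ContinuousLinearMap.mul ℝ ℝ)
      (𝓕 (mult (jap s) f) : Sw d).integrable.norm (𝓕 (mult (jap s) g) : Sw d).integrable.norm
      (μ := (volume : Measure (Eu d)))
    exact h.const_mul _
  have hH0 : ∀ ξ, jap s ξ * ∫ t, ‖𝓕 f t‖ * ‖𝓕 g (ξ - t)‖ ≤ H ξ := by
    intro ξ
    simp only [hH]
    rw [← integral_const_mul, ← integral_const_mul]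
    refine integral_mono ((hinteg (𝓕 f) (𝓕 g) ξ).const_mul _)
      ((hinteg (𝓕 (mult (jap s) f)) (𝓕 (mult (jap s) g)) ξ).const_mul _) fun t => ?_
    simp only [e]
    have h1 := mul_le_mul_of_nonneg_right (jap_le_mul hs ξ t)
      (by positivity : 0 ≤ ‖𝓕 f t‖ * ‖𝓕 g (ξ - t)‖)
    refine h1.trans (le_of_eq ?_)
    ring
  refine tendsto_apply_of_fourier hHi (fun M ξ => ?_) (fun ξ => ?_) x
  · rw [e]
    refine le_trans ?_ (hH0 ξ)
    refine mul_le_mul_of_nonneg_left ?_ (jap_pos s ξ).le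
    rw [fourier_prodS]
    refine (norm_integral_le_integral_norm _).trans
      (integral_mono_of_nonneg (ae_of_all _ fun t => norm_nonneg _) (hinteg (𝓕 f) (𝓕 g) ξ)
        (ae_of_all _ fun t => ?_))
    simp only [norm_mul]
    exact mul_le_mul (norm_fourier_mult_chi_le _ _ _) (norm_fourier_mult_chi_le _ _ _)
      (norm_nonneg _) (norm_nonneg _)
  · simp only [fourier_mult hjt, fourier_prodS]
    refine Tendsto.const_mul _ (tendsto_integral_of_dominated_convergence
      (fun t => ‖𝓕 f t‖ * ‖𝓕 g (ξ - t)‖) (fun M => ?_) (hinteg (𝓕 f) (𝓕 g) ξ)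
      (fun M => ae_of_all _ fun t => ?_) (ae_of_all _ fun t => ?_))
    · refine Continuous.aestronglyMeasurable ?_
      exact (𝓕 (mult (chi M) f) : Sw d).continuous.mul
        ((𝓕 (mult (chi (M + 2 : ℕ)) g) : Sw d).continuous.comp (by fun_prop))
    · rw [norm_mul]
      exact mul_le_mul (norm_fourier_mult_chi_le _ _ _) (norm_fourier_mult_chi_le _ _ _)
        (norm_nonneg _) (norm_nonneg _)
    · exact (tendsto_fourier_mult_chi 0 f t).mul (tendsto_fourier_mult_chi 2 g _)

lemma tendsto_comm_chi {s : ℝ} (hs : 0 ≤ s) (f g : Sw d) (x : Eu d) :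
    Tendsto (fun M : ℕ => comm s (mult (chi M) f) (mult (chi (M + 2 : ℕ)) g) x) atTop
      (𝓝 (comm s f g x)) := by
  have h1 : Tendsto (fun M : ℕ => mult (chi M) f x) atTop (𝓝 (f x)) :=
    tendsto_apply_of_fourier (𝓕 f : Sw d).integrable.norm
      (fun M ξ => norm_fourier_mult_chi_le _ _ _) (tendsto_fourier_mult_chi 0 f) x
  have h2 : Tendsto (fun M : ℕ => mult (jap s) (mult (chi (M + 2 : ℕ)) g) x) atTop
      (𝓝 (mult (jap s) g x)) := by
    refine tendsto_apply_of_fourier (𝓕 (mult (jap s) g) : Sw d).integrable.norm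
      (fun M ξ => ?_) (fun ξ => ?_) x
    · rw [fourier_mult (jap_temperate s), fourier_mult (jap_temperate s), norm_mul, norm_mul]
      exact mul_le_mul_of_nonneg_left (norm_fourier_mult_chi_le _ _ _) (norm_nonneg _)
    · simp only [fourier_mult (jap_temperate s)]
      exact (tendsto_fourier_mult_chi 2 g ξ).const_mul _
  simp only [comm, sub_apply, prodS_apply]
  exact (tendsto_mult_jap_prodS hs f g x).sub (h1.mul h2)

lemma enorm_le_eLpNorm_top {F : Type*} [NormedAddCommGroup F] {u : Eu d → F} (hu : Continuous u)
    (x : Eu d) : ‖u x‖ₑ ≤ eLpNorm u ⊤ volume := by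
  rw [eLpNorm_exponent_top]
  by_contra! h
  have h0 : volume {y | eLpNormEssSup u volume < ‖u y‖ₑ} = 0 := by
    have := ae_le_eLpNormEssSup (f := u) (μ := volume)
    simpa [ae_iff] using this
  have ho : IsOpen {y | eLpNormEssSup u volume < ‖u y‖ₑ} := isOpen_lt continuous_const hu.enorm
  rw [ho.measure_eq_zero_iff volume] at h0
  have hx : x ∈ {y | eLpNormEssSup u volume < ‖u y‖ₑ} := h
  rw [h0] at hx
  exact hx

lemma norm_le_toReal_eLpNorm_top {F : Type*} [NormedAddCommGroup F] {u : Eu d → F} (hu : Continuous u)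
    (h : eLpNorm u ⊤ volume ≠ ∞) (x : Eu d) : ‖u x‖ ≤ (eLpNorm u ⊤ volume).toReal := by
  rw [← toReal_enorm]
  exact ENNReal.toReal_mono h (enorm_le_eLpNorm_top hu x)

/-- The commutator estimate for Schwartz functions. -/
lemma exists_comm_le (hd : 0 < d) {s : ℝ} (hs : 0 < s) {p : ℝ} (hp : 1 < p) : ∃ C : ℝ, 0 < C ∧
    ∀ f g : Sw d, eLpNorm (comm s f g) (ENNReal.ofReal p) volume ≤ ENNReal.ofReal C *
      (eLpNorm (fun x => fderiv ℝ (⇑f) x) ⊤ volume *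
        eLpNorm (mult (jap (s - 1)) g) (ENNReal.ofReal p) volume +
      eLpNorm (mult (jap s) f) (ENNReal.ofReal p) volume * eLpNorm (⇑g) ⊤ volume) := by
  obtain ⟨C, hC, h⟩ := exists_comm_chi_le hd hs hp
  refine ⟨C, hC, fun f g => ?_⟩
  have hf' : Continuous fun x => fderiv ℝ (⇑f) x := (f.smooth 1).continuous_fderiv one_ne_zero
  have hft : eLpNorm (fun x => fderiv ℝ (⇑f) x) ⊤ volume ≠ ∞ :=
    ((SchwartzMap.fderivCLM ℝ (Eu d) ℂ f).memLp ⊤ volume).2.ne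
  have hgt : eLpNorm (⇑g) ⊤ volume ≠ ∞ := (g.memLp ⊤ volume).2.ne
  set l := (eLpNorm (fun x => fderiv ℝ (⇑f) x) ⊤ volume).toReal with hl
  set m := (eLpNorm (⇑g) ⊤ volume).toReal with hm
  have hl0 : 0 ≤ l := ENNReal.toReal_nonneg
  have hm0 : 0 ≤ m := ENNReal.toReal_nonneg
  set P := eLpNorm (mult (jap (s - 1)) g) (ENNReal.ofReal p) volume
  set Q := eLpNorm (mult (jap s) f) (ENNReal.ofReal p) volume
  have hP : P ≠ ∞ := ((mult (jap (s - 1)) g).memLp _ volume).2.ne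
  have hQ : Q ≠ ∞ := ((mult (jap s) f).memLp _ volume).2.ne
  have hLip : ∀ x y, ‖f x - f y‖ ≤ l * dist x y := fun x y => by
    rw [dist_eq_norm]
    exact convex_univ.norm_image_sub_le_of_norm_fderiv_le (𝕜 := ℝ)
      (fun z _ => f.differentiable.differentiableAt)
      (fun z _ => norm_le_toReal_eLpNorm_top hf' hft z) (mem_univ y) (mem_univ x)
  have h1 : ∀ ε : ℝ, 0 < ε → eLpNorm (comm s f g) (ENNReal.ofReal p) volume ≤
      ENNReal.ofReal (C * (l + ε)) * P + ENNReal.ofReal (C * (m + ε)) * Q := by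
    intro ε hε
    refine (Lp.eLpNorm_lim_le_liminf_eLpNorm (fun M => (comm s (mult (chi (M : ℕ)) f)
      (mult (chi (M + 2 : ℕ)) g)).continuous.aestronglyMeasurable) _
      (ae_of_all _ fun x => tendsto_comm_chi hs.le f g x)).trans ?_
    refine (liminf_le_liminf (Eventually.of_forall fun M => h f g (l + ε) (m + ε) (by positivity)
      (by positivity) (fun x y => (hLip x y).trans ?_) (fun x => ?_) M)).trans (liminf_const _).le
    · have := dist_nonneg (x := x) (y := y)
      nlinarith
    · have := norm_le_toReal_eLpNorm_top g.continuous hgt x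
      linarith
  have h2 : ∀ a : ℝ, Tendsto (fun ε : ℝ => ENNReal.ofReal (C * (a + ε))) (𝓝[>] 0)
      (𝓝 (ENNReal.ofReal (C * (a + 0)))) := fun a => by
    refine ((ENNReal.continuous_ofReal.comp ?_).tendsto 0).mono_left nhdsWithin_le_nhds
    fun_prop
  have h3 := ge_of_tendsto ((ENNReal.Tendsto.mul_const (h2 l) (Or.inr hP)).add
    (ENNReal.Tendsto.mul_const (h2 m) (Or.inr hQ)))
    (eventually_nhdsWithin_of_forall fun ε hε => h1 ε hε)
  refine h3.trans (le_of_eq ?_)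
  rw [add_zero, add_zero, ENNReal.ofReal_mul hC.le, ENNReal.ofReal_mul hC.le, hl, hm,
    ENNReal.ofReal_toReal hft, ENNReal.ofReal_toReal hgt, mul_add]
  ring

lemma comm_eq_zero (hd : d = 0) (s : ℝ) (f g : Sw d) : comm s f g = 0 := by
  subst hd
  have h : ∀ u : Sw 0, mult (jap s) u = u := fun u =>
    mult_eq_of_fourier (jap_temperate s) fun ξ => by
      rw [Subsingleton.elim ξ 0]
      simp [jap]
  rw [comm, h, h, sub_self]

lemma fourierInv_jap_mul_fourier (s : ℝ) (f : Sw d) :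
    𝓕⁻ (fun ξ : Eu d => (((1 + 4 * Real.pi ^ 2 * ‖ξ‖ ^ 2) ^ (s / 2) : ℝ) : ℂ) * 𝓕 (⇑f) ξ) =
      ⇑(mult (jap s) f) := by
  have e : (fun ξ : Eu d => (((1 + 4 * Real.pi ^ 2 * ‖ξ‖ ^ 2) ^ (s / 2) : ℝ) : ℂ) * 𝓕 (⇑f) ξ) =
      ⇑(𝓕 (mult (jap s) f) : Sw d) := by
    funext ξ
    rw [fourier_mult (jap_temperate s), jap, SchwartzMap.fourier_coe]
  rw [e, ← SchwartzMap.fourierInv_coe, FourierTransform.fourierInv_fourier_eq]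

end Limit

end KatoPonce

open KatoPonce in
lemma besselPotential_eq_mult (d : ℕ) (s : ℝ) (f : SchwartzMap (EuclideanSpace ℝ (Fin d)) ℂ) :
    besselPotential d s ⇑f = ⇑(mult (jap s) f) :=
  fourierInv_jap_mul_fourier s f

/-- Kato–Ponce commutator estimate: for `s > 0`, `p ∈ (1,∞)` and Schwartz `f, g`,
`‖J^s(fg) - f J^s g‖_{L^p} ≤ C (‖∇f‖_{L^∞} ‖J^{s-1}g‖_{L^p} + ‖J^s f‖_{L^p} ‖g‖_{L^∞})`. -/
theorem stmt13 (d : ℕ) (s p : ℝ) (hs : 0 < s) (hp : 1 < p) :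
    ∃ C : ℝ, 0 < C ∧ ∀ f g : SchwartzMap (EuclideanSpace ℝ (Fin d)) ℂ,
      eLpNorm (fun x => besselPotential d s (fun y => f y * g y) x
          - f x * besselPotential d s (⇑g) x) (ENNReal.ofReal p) volume
        ≤ ENNReal.ofReal C *
          (eLpNorm (fun x => fderiv ℝ (⇑f) x) ⊤ volume *
              eLpNorm (besselPotential d (s - 1) ⇑g) (ENNReal.ofReal p) volume +
            eLpNorm (besselPotential d s ⇑f) (ENNReal.ofReal p) volume *
              eLpNorm (⇑g) ⊤ volume) := by
  have hprod : ∀ f g : SchwartzMap (EuclideanSpace ℝ (Fin d)) ℂ,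
      (fun y => f y * g y) = ⇑(KatoPonce.prodS f g) := fun f g => by
    funext y
    rw [KatoPonce.prodS_apply]
  have hcomm : ∀ f g : SchwartzMap (EuclideanSpace ℝ (Fin d)) ℂ,
      (fun x => besselPotential d s (fun y => f y * g y) x - f x * besselPotential d s (⇑g) x) =
        ⇑(KatoPonce.comm s f g) := fun f g => by
    funext x
    rw [hprod, besselPotential_eq_mult, besselPotential_eq_mult, KatoPonce.comm, sub_apply,
      KatoPonce.prodS_apply]
  simp only [hcomm]
  simp only [besselPotential_eq_mult]
  rcases Nat.eq_zero_or_pos d with hd | hd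
  · refine ⟨1, one_pos, fun f g => ?_⟩
    rw [KatoPonce.comm_eq_zero hd]
    exact (eLpNorm_zero (μ := volume)).trans_le zero_le
  · exact KatoPonce.exists_comm_le hd hs hp

end
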